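/- Let n ≥ 2 and let G satisfy hypotheses (H1)–(H4). If γ > 1, then there exists λ_u = λ_u(n, G) such that for every λ > λ_u the unit ball B₁ is an unstable volume-constrained critical point of F_{γ,G_λ}: B₁ is a volume-constrained stationary set for F_{γ,G_λ}, but there exists X ∈ C_c^∞(ℝⁿ;ℝⁿ) inducing a volume-preserving flow on B₁ with δ²F_{γ,G_λ}(B₁)[X] < 0. In particular B₁ cannot be a minimizer of (P_{γ,λ}) for λ > λ_u. -/

import Mathlib

open MeasureTheory Metric Filter Asymptotics ENNReal
open scoped ENNReal NNReal Topology

noncomputable section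

abbrev V (n : ℕ) := EuclideanSpace ℝ (Fin n)

/-- Divergence of a vector field on `ℝⁿ`. -/
def vdiv {n : ℕ} (φ : V n → V n) (x : V n) : ℝ :=
  ∑ i : Fin n, fderiv ℝ φ x (EuclideanSpace.single i 1) i

/-- The perimeter of a set in `ℝⁿ` (the total variation of its indicator function),
defined by duality against compactly supported `C¹` vector fields bounded by `1`. -/
def perimeter {n : ℕ} (E : Set (V n)) : ℝ≥0∞ :=
  ⨆ φ : {φ : V n → V n // ContDiff ℝ 1 φ ∧ HasCompactSupport φ ∧ ∀ x, ‖φ x‖ ≤ 1},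
    ENNReal.ofReal (∫ x in E, vdiv φ.1 x)

/-- A set of finite perimeter. -/
def HasFinitePerimeter {n : ℕ} (E : Set (V n)) : Prop :=
  MeasurableSet E ∧ perimeter E < ⊤

/-- Real-valued perimeter `P(E)`. -/
def P {n : ℕ} (E : Set (V n)) : ℝ := (perimeter E).toReal

/-- The nonlocal `G`-perimeter `Per_G(E) = ∬_{E × Eᶜ} G(x−y) dx dy`. -/
def PerG {n : ℕ} (G : V n → ℝ) (E : Set (V n)) : ℝ :=
  ∫ x in E, ∫ y in Eᶜ, G (x - y)

/-- The constant `𝐄_{p,n}`: the average over the unit sphere `S^{n-1} ⊆ ℝⁿ` of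
`|e·x|^p` (with respect to the `(n-1)`-dimensional Hausdorff measure), for the
unit vector `e = e₀`. -/
def Kconst (n : ℕ) (p : ℝ) : ℝ :=
  if h : n = 0 then 0 else
    ⨍ x in sphere (0 : V n) 1, |x ⟨0, Nat.pos_of_ne_zero h⟩| ^ p ∂ μH[(n : ℝ) - 1]

/-- Hypotheses (H1)–(H2): `G` is a nonnegative measurable radial kernel on `ℝⁿ`,
integrable, with first moment `∫ |x| G(x) dx = 2/𝐄_{1,n}`. -/
structure H12 {n : ℕ} (G : V n → ℝ) : Prop where
  measurable : Measurable G
  nonneg : ∀ x, 0 ≤ G x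
  radial : ∃ g : ℝ → ℝ, (∀ r, 0 < r → 0 ≤ g r) ∧ ∀ᵐ x : V n ∂volume, G x = g ‖x‖
  integrable : Integrable G (volume : Measure (V n))
  firstMoment : ∫ x : V n, ‖x‖ * G x = 2 / Kconst n 1

/-- Hypotheses (H3)–(H4): `G(x) = o(|x|^{α−n})` at the origin for some `α > 0`, and
`G(x) = o(|x|^{−(n+β)})` at infinity for some `β > 0` if `n ≥ 3`,
resp. `G(x) = o(|x|^{−3})` at infinity if `n = 2`. -/
structure H34 {n : ℕ} (G : V n → ℝ) : Prop where
  origin : ∃ α : ℝ, 0 < α ∧ G =o[𝓝[≠] (0 : V n)] fun x => ‖x‖ ^ (α - (n : ℝ))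
  inftyHi : 3 ≤ n → ∃ β : ℝ, 0 < β ∧
    G =o[Bornology.cobounded (V n)] fun x => ‖x‖ ^ (-((n : ℝ) + β))
  inftyTwo : n = 2 → G =o[Bornology.cobounded (V n)] fun x => ‖x‖ ^ (-3 : ℝ)

/-- The rescaled kernel `G_λ(x) = λ^{n+1} G(λ x)`. -/
def Gscale {n : ℕ} (G : V n → ℝ) (l : ℝ) : V n → ℝ := fun x => l ^ (n + 1) * G (l • x)

/-- The functional `F_{γ,G_λ}(E) = P(E) − γ Per_{G_λ}(E)`. -/
def Ffun {n : ℕ} (γ : ℝ) (G : V n → ℝ) (l : ℝ) (E : Set (V n)) : ℝ :=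
  P E - γ * PerG (Gscale G l) E

/-- A minimizer of the problem (P_{γ,λ}): minimize `F_{γ,G_λ}` among sets of finite
perimeter of volume `|B₁|`. -/
def IsMinimizer {n : ℕ} (γ : ℝ) (G : V n → ℝ) (l : ℝ) (E : Set (V n)) : Prop :=
  HasFinitePerimeter E ∧ volume E = volume (ball (0 : V n) 1) ∧
    ∀ F : Set (V n), HasFinitePerimeter F → volume F = volume (ball (0 : V n) 1) →
      Ffun γ G l E ≤ Ffun γ G l F

/-- `Φ` is the flow of the smooth compactly supported vector field `X`. -/
structure IsFlowOf {n : ℕ} (X : V n → V n) (Φ : ℝ → V n → V n) : Prop where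
  smooth : ContDiff ℝ (⊤ : ℕ∞) X
  cptSupp : HasCompactSupport X
  init : ∀ x, Φ 0 x = x
  isFlow : ∀ t x, HasDerivAt (fun s => Φ s x) (X (Φ t x)) t

/-- The flow `Φ` induces a volume-preserving flow on `E`. -/
def PreservesVolume {n : ℕ} (Φ : ℝ → V n → V n) (E : Set (V n)) : Prop :=
  ∃ δ : ℝ, 0 < δ ∧ ∀ t : ℝ, |t| < δ → volume (Φ t '' E) = volume E


section
lemma rot_exists {n : ℕ} (x y : V n) (h : ‖x‖ = ‖y‖) : ∃ R : V n ≃ₗᵢ[ℝ] V n, R x = y :=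
  ⟨Submodule.reflection (Submodule.span ℝ {x - y})ᗮ, Submodule.reflection_sub h⟩

lemma polar {n : ℕ} (hn : 0 < n) (f : ℝ → ℝ) (h : V n → ℝ)
    (hh : ∀ (r : ℝ) x, 0 < r → h (r • x) = r * h x) :
    ∫ x : V n, f ‖x‖ * h x =
      (∫ x : sphere (0 : V n) 1, h x ∂(volume : Measure (V n)).toSphere) *
      (∫ r : Set.Ioi (0:ℝ), f r * r ∂(Measure.volumeIoiPow (n - 1))) := by
  have : Nonempty (Fin n) := ⟨⟨0, hn⟩⟩
  have : Nontrivial (V n) := inferInstance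
  calc
    ∫ x : V n, f (‖x‖) * h x = ∫ x : ({(0)}ᶜ : Set (V n)), f (‖x.1‖) * h x.1 ∂((volume : Measure (V n)).comap Subtype.val) := by
      rw [integral_subtype_comap (measurableSet_singleton _).compl fun x ↦ f (‖x‖) * h x,
        restrict_compl_singleton]
    _ = ∫ x : (sphere (0 : V n) 1) × Set.Ioi (0:ℝ), h x.1 * (f x.2 * x.2)
          ∂(volume : Measure (V n)).toSphere.prod (.volumeIoiPow (n - 1)) := by
      have := (volume : Measure (V n)).measurePreserving_homeomorphUnitSphereProd.integral_comp
        (Homeomorph.measurableEmbedding _)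
        (fun x : (sphere (0 : V n) 1) × Set.Ioi (0:ℝ) => h x.1 * (f x.2 * x.2))
      simp only [finrank_euclideanSpace, Fintype.card_fin] at this
      rw [← this]
      refine integral_congr_ae (Eventually.of_forall fun x => ?_)
      have hx : 0 < ‖(x : V n)‖ := norm_pos_iff.2 x.2
      have := hh ‖(x : V n)‖ (‖(x : V n)‖⁻¹ • x) hx
      rw [smul_smul, mul_inv_cancel₀ hx.ne', one_smul] at this
      simp only [homeomorphUnitSphereProd_apply_fst_coe, homeomorphUnitSphereProd_apply_snd_coe]
      rw [this]; ring
    _ = _ := by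
      rw [integral_prod_mul (fun x : sphere (0 : V n) 1 => h x)
        (fun r : Set.Ioi (0:ℝ) => f r * r)]

lemma homog {n : ℕ} (hn : 0 < n) (f g : ℝ → ℝ) (h : V n → ℝ)
    (hh : ∀ (r : ℝ) x, 0 < r → h (r • x) = r * h x) :
    (∫ x : V n, f ‖x‖ * h x) * (∫ x : V n, g ‖x‖ * ‖x‖) =
    (∫ x : V n, g ‖x‖ * h x) * (∫ x : V n, f ‖x‖ * ‖x‖) := by
  have h1 : ∀ (r : ℝ) (x : V n), 0 < r → ‖r • x‖ = r * ‖x‖ := fun r x hr => by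
    rw [norm_smul, Real.norm_of_nonneg hr.le]
  rw [polar hn f h hh, polar hn g h hh, polar hn f _ h1, polar hn g _ h1]; ring

lemma ball_norm_pow {n : ℕ} (hn : 0 < n) (k : ℕ) :
    ∫ x in ball (0 : V n) 1, ‖x‖ ^ k = (n : ℝ) / (n + k) * volume.real (ball (0 : V n) 1) := by
  have : Nonempty (Fin n) := ⟨⟨0, hn⟩⟩
  have : Nontrivial (V n) := inferInstance
  have h1 := integral_fun_norm_addHaar (volume : Measure (V n))
    (fun r => (Set.Iio (1:ℝ)).indicator (fun r => r ^ k) r)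
  have h2 : ∫ x in ball (0 : V n) 1, ‖x‖ ^ k =
      ∫ x : V n, (Set.Iio (1:ℝ)).indicator (fun r => r ^ k) ‖x‖ := by
    rw [← integral_indicator measurableSet_ball]
    congr 1; ext x
    simp [Set.indicator]
  rw [h2, h1]
  have h3 : ∫ y in Set.Ioi (0:ℝ), y ^ (Module.finrank ℝ (V n) - 1) •
      (Set.Iio (1:ℝ)).indicator (fun r => r ^ k) y = 1 / (n + k) := by
    have : (fun y : ℝ => y ^ (Module.finrank ℝ (V n) - 1) •
      (Set.Iio (1:ℝ)).indicator (fun r => r ^ k) y) =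
      (Set.Iio (1:ℝ)).indicator (fun y => y ^ (n - 1 + k)) := by
      ext y
      simp only [finrank_euclideanSpace, Fintype.card_fin, Set.indicator, smul_eq_mul]
      split_ifs <;> simp [pow_add]
    rw [this, setIntegral_indicator measurableSet_Iio]
    have : Set.Ioi (0:ℝ) ∩ Set.Iio 1 = Set.Ioo 0 1 := rfl
    rw [this, ← integral_Ioc_eq_integral_Ioo, ← intervalIntegral.integral_of_le zero_le_one,
      integral_pow]
    have : ((n - 1 + k : ℕ) : ℝ) + 1 = n + k := by
      have : n - 1 + k + 1 = n + k := by omega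
      exact_mod_cast this
    rw [this]; simp
  rw [h3]
  simp [finrank_euclideanSpace]; ring
end

section
lemma normalize_lip {E : Type*} [NormedAddCommGroup E] [NormedSpace ℝ E] (x y : E)
    (hx : 1 ≤ ‖x‖) (hy : 1 ≤ ‖y‖) : ‖‖x‖⁻¹ • x - ‖y‖⁻¹ • y‖ ≤ 2 * ‖x - y‖ := by
  have hx0 : 0 < ‖x‖ := by linarith
  have hy0 : 0 < ‖y‖ := by linarith
  have e : ‖x‖⁻¹ • x - ‖y‖⁻¹ • y = ‖x‖⁻¹ • (x - y) + (‖x‖⁻¹ - ‖y‖⁻¹) • y := by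
    rw [smul_sub, sub_smul]; abel
  have h1 : ‖‖x‖⁻¹ • (x - y)‖ ≤ ‖x - y‖ := by
    rw [norm_smul, norm_inv, norm_norm]
    exact mul_le_of_le_one_left (norm_nonneg _) (inv_le_one_of_one_le₀ hx)
  have h2 : ‖(‖x‖⁻¹ - ‖y‖⁻¹) • y‖ ≤ ‖x - y‖ := by
    rw [norm_smul, Real.norm_eq_abs, inv_sub_inv hx0.ne' hy0.ne', abs_div, abs_mul, abs_norm,
      abs_norm]
    have := abs_norm_sub_norm_le y x
    rw [norm_sub_rev y x] at this
    rw [div_mul_eq_mul_div, div_le_iff₀ (by positivity)]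
    nlinarith [norm_nonneg (x - y), mul_nonneg (norm_nonneg (x-y)) hy0.le]
  rw [e]
  linarith [norm_add_le (‖x‖⁻¹ • (x - y)) ((‖x‖⁻¹ - ‖y‖⁻¹) • y)]

lemma sphere_fin (m : ℕ) : μH[(m : ℝ)] (sphere (0 : V (m+1)) 1) < ⊤ := by
  let e : Fin (m+1) → ℝ → (Fin m → ℝ) → V (m+1) := fun i s y =>
    WithLp.toLp 2 (Fin.insertNth (α := fun _ => ℝ) i s y)
  have hlip : ∀ i s, LipschitzWith (((m:ℝ≥0)+1)) (e i s) := by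
    intro i s
    refine LipschitzWith.of_dist_le_mul fun y z => ?_
    rw [EuclideanSpace.dist_eq]
    have h0 : (0:ℝ) ≤ ((m:ℝ)+1) * dist y z := by positivity
    rw [Real.sqrt_le_iff]
    refine ⟨by simpa using h0, ?_⟩
    simp only [e]
    rw [Fin.sum_univ_succAbove _ i]
    simp only [Fin.insertNth_apply_same, dist_self, Fin.insertNth_apply_succAbove]
    have : ∑ j : Fin m, dist (y j) (z j) ^ 2 ≤ ∑ j : Fin m, (dist y z)^2 :=
      Finset.sum_le_sum fun j _ => by
        gcongr; exact dist_le_pi_dist y z j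
    simp at this
    push_cast
    have hd := sq_nonneg (dist y z)
    have hm : (0:ℝ) ≤ m := by positivity
    nlinarith [mul_nonneg hm hd, mul_nonneg (mul_nonneg hm hm) hd]
  have hnorm : ∀ i s y, |s| = 1 → 1 ≤ ‖e i s y‖ := by
    intro i s y hs
    have := PiLp.norm_apply_le (e i s y) i
    simp only [e, Fin.insertNth_apply_same, Real.norm_eq_abs, hs] at this
    exact this
  let F : Fin (m+1) → ℝ → (Fin m → ℝ) → V (m+1) := fun i s y => ‖e i s y‖⁻¹ • e i s y
  have hF : ∀ i s, |s| = 1 → LipschitzWith (2 * ((m:ℝ≥0)+1)) (F i s) := by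
    intro i s hs
    refine LipschitzWith.of_dist_le_mul fun y z => ?_
    rw [dist_eq_norm]
    refine (normalize_lip _ _ (hnorm i s y hs) (hnorm i s z hs)).trans ?_
    have := (hlip i s).dist_le_mul y z
    rw [dist_eq_norm] at this
    push_cast at this ⊢
    linarith
  have hfin : ∀ i s, |s| = 1 → μH[(m : ℝ)] (F i s '' (Set.Icc (-1) 1)) < ⊤ := by
    intro i s hs
    refine ((hF i s hs).hausdorffMeasure_image_le (by positivity) _).trans_lt ?_
    refine ENNReal.mul_lt_top ?_ ?_
    · exact ENNReal.rpow_lt_top_of_nonneg (by positivity) ENNReal.coe_ne_top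
    · have := hausdorffMeasure_pi_real (ι := Fin m)
      simp only [Fintype.card_fin] at this
      rw [this]
      exact isCompact_Icc.measure_lt_top
  have hsub : sphere (0 : V (m+1)) 1 ⊆ ⋃ i, (F i 1 '' (Set.Icc (-1) 1) ∪ F i (-1) '' (Set.Icc (-1) 1)) := by
    intro x hx
    have hx1 : ‖x‖ = 1 := by simpa using hx
    obtain ⟨i, -, hi⟩ := Finset.exists_max_image Finset.univ (fun i => |x i|) ⟨0, Finset.mem_univ _⟩
    have hpos : 0 < |x i| := by
      by_contra h
      have : x = 0 := by
        ext j
        have := hi j (Finset.mem_univ _)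
        have h2 := abs_nonneg (x j)
        have : |x j| = 0 := by linarith
        simpa using this
      rw [this] at hx1; simp at hx1
    have key : ∀ s : ℝ, |s| = 1 → x i = s * |x i| → x ∈ F i s '' (Set.Icc (-1) 1) := by
      intro s hs hxs
      refine ⟨fun j => x (i.succAbove j) / |x i|, ?_, ?_⟩
      · constructor
        · intro j
          simp only [Pi.neg_apply, Pi.one_apply]
          rw [le_div_iff₀ hpos]
          have := hi (i.succAbove j) (Finset.mem_univ _)
          linarith [neg_abs_le (x (i.succAbove j))]
        · intro j
          simp only [Pi.one_apply]
          rw [div_le_iff₀ hpos]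
          have := hi (i.succAbove j) (Finset.mem_univ _)
          linarith [le_abs_self (x (i.succAbove j))]
      · have he : e i s (fun j => x (i.succAbove j) / |x i|) = |x i|⁻¹ • x := by
          ext j
          simp only [e, PiLp.smul_apply, smul_eq_mul]
          refine Fin.succAboveCases i ?_ ?_ j
          · simp only [Fin.insertNth_apply_same]
            rw [hxs, abs_mul, hs, abs_abs, one_mul]; field_simp
          · intro j; simp only [Fin.insertNth_apply_succAbove]; ring
        simp only [F, he, norm_smul, hx1, norm_inv, Real.norm_eq_abs, abs_abs, mul_one, inv_inv]
        rw [smul_smul, mul_inv_cancel₀ hpos.ne', one_smul]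
    refine Set.mem_iUnion.2 ⟨i, ?_⟩
    rcases le_total 0 (x i) with h | h
    · left; exact key 1 (by simp) (by rw [abs_of_nonneg h, one_mul])
    · right; exact key (-1) (by simp) (by rw [abs_of_nonpos h]; ring)
  refine (measure_mono hsub).trans_lt ?_
  refine (measure_iUnion_le _).trans_lt ?_
  rw [tsum_fintype]
  refine ENNReal.sum_lt_top.2 fun i _ => ?_
  refine (measure_union_le _ _).trans_lt (ENNReal.add_lt_top.2 ⟨hfin i 1 (by simp), hfin i (-1) (by simp)⟩)

lemma sphere_pos (m : ℕ) : 0 < μH[(m : ℝ)] (sphere (0 : V (m+1)) 1) := by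
  let p : V (m+1) → (Fin m → ℝ) := fun x j => x j.succ
  have hp : LipschitzWith 1 p := by
    refine LipschitzWith.of_dist_le_mul fun x y => ?_
    rw [NNReal.coe_one, one_mul, dist_pi_le_iff dist_nonneg]
    intro j
    rw [dist_eq_norm, dist_eq_norm]
    exact PiLp.norm_apply_le (x - y) j.succ
  have hsub : ball (0 : Fin m → ℝ) (1 / (m + 1)) ⊆ p '' sphere 0 1 := by
    intro y hy
    have hm : (0:ℝ) < m + 1 := by positivity
    have hy' : ‖y‖ < 1 / (m+1) := by simpa using hy
    have hs : ∑ j, y j ^ 2 ≤ 1 := by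
      have h1 : ∑ j : Fin m, y j ^ 2 ≤ ∑ j : Fin m, (1 / ((m:ℝ)+1))^2 :=
        Finset.sum_le_sum fun j _ => by
          rw [← sq_abs]
          gcongr
          exact (norm_le_pi_norm y j).trans hy'.le
      simp only [Finset.sum_const, Finset.card_univ, Fintype.card_fin, nsmul_eq_mul] at h1
      refine h1.trans ?_
      rw [div_pow, one_pow, mul_one_div, div_le_one (by positivity)]
      nlinarith [(Nat.cast_nonneg m : (0:ℝ) ≤ m)]
    refine ⟨WithLp.toLp 2 (Fin.cons (Real.sqrt (1 - ∑ j, y j ^ 2)) y), ?_, ?_⟩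
    · rw [mem_sphere_zero_iff_norm, EuclideanSpace.norm_eq, Real.sqrt_eq_one, Fin.sum_univ_succ]
      simp only [Fin.cons_zero, Fin.cons_succ, Real.norm_eq_abs, sq_abs]
      rw [Real.sq_sqrt (by linarith)]; ring
    · ext j; simp [p]
  have h1 := hp.hausdorffMeasure_image_le (d := (m:ℝ)) (by positivity) (sphere (0 : V (m+1)) 1)
  have h2 := hausdorffMeasure_pi_real (ι := Fin m)
  simp only [Fintype.card_fin] at h2
  rw [h2] at h1
  have h3 : 0 < volume (ball (0 : Fin m → ℝ) (1 / (m + 1))) :=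
    measure_ball_pos _ _ (by positivity)
  have h4 := h3.trans_le ((measure_mono hsub).trans h1)
  simpa using h4
end

section
def e0 (m : ℕ) : V (m+1) := EuclideanSpace.single 0 1

lemma e0_norm (m : ℕ) : ‖e0 m‖ = 1 := by simp [e0]

lemma inner_e0 {m : ℕ} (x : V (m+1)) : inner ℝ (e0 m) x = x 0 := by
  simp [e0, EuclideanSpace.inner_single_left]

lemma rot_meas {n : ℕ} (R : V n ≃ₗᵢ[ℝ] V n) : MeasurePreserving R volume volume :=
  R.measurePreserving

lemma rot_setIntegral {n : ℕ} (R : V n ≃ₗᵢ[ℝ] V n) (f : V n → ℝ) (r : ℝ) :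
    ∫ x in ball (0 : V n) r, f (R x) = ∫ x in ball (0 : V n) r, f x := by
  have h := (rot_meas R).setIntegral_preimage_emb R.toHomeomorph.measurableEmbedding f (ball 0 r)
  have : R ⁻¹' ball 0 r = ball 0 r := by
    ext x; simp
  rw [this] at h
  exact h

lemma Kconst_eq (m : ℕ) :
    ∫ z in ball (0 : V (m+1)) 1, |z 0| = Kconst (m+1) 1 * ∫ z in ball (0 : V (m+1)) 1, ‖z‖ := by
  set μ : Measure (V (m+1)) := (μH[(m:ℝ)]).restrict (sphere 0 1) with hμ
  have hfin : IsFiniteMeasure μ := ⟨by rw [hμ, Measure.restrict_apply_univ]; exact sphere_fin m⟩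
  have hpos : 0 < μ.real Set.univ := by
    rw [measureReal_def, hμ, Measure.restrict_apply_univ]
    exact ENNReal.toReal_pos (sphere_pos m).ne' (sphere_fin m).ne
  have hK : Kconst (m+1) 1 * μ.real Set.univ = ∫ x, |x 0| ∂μ := by
    have h1 : (((m+1 : ℕ) : ℝ) - 1) = m := by push_cast; ring
    simp only [Kconst, Nat.add_eq_zero_iff, one_ne_zero, and_false, dite_false, Real.rpow_one, h1]
    rw [← hμ, average_eq, smul_eq_mul, mul_comm, ← mul_assoc, mul_inv_cancel₀ hpos.ne', one_mul]
    rfl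
  have hball : IsFiniteMeasure ((volume : Measure (V (m+1))).restrict (ball 0 1)) :=
    ⟨by rw [Measure.restrict_apply_univ]; exact measure_ball_lt_top⟩
  have hsph : ∀ᵐ x ∂μ, ‖x‖ = 1 := by
    have := ae_restrict_mem (μ := (μH[(m:ℝ)] : Measure (V (m+1)))) (s := sphere 0 1)
      isClosed_sphere.measurableSet
    filter_upwards [this] with x hx
    simpa using hx
  have hInt : Integrable (Function.uncurry fun (z x : V (m+1)) => |(inner ℝ z x : ℝ)|)
      (((volume : Measure (V (m+1))).restrict (ball 0 1)).prod μ) := by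
    refine Integrable.of_bound (C := 1) ?_ ?_
    · have : Continuous (Function.uncurry fun (z x : V (m+1)) => |(inner ℝ z x : ℝ)|) := by
        unfold Function.uncurry; fun_prop
      exact this.aestronglyMeasurable
    · have h1 : ∀ᵐ p ∂(((volume : Measure (V (m+1))).restrict (ball 0 1)).prod μ), ‖p.2‖ = 1 :=
        Measure.quasiMeasurePreserving_snd.ae hsph
      have h2 : ∀ᵐ p ∂(((volume : Measure (V (m+1))).restrict (ball 0 1)).prod μ), ‖p.1‖ < 1 := by
        refine Measure.quasiMeasurePreserving_fst.ae (p := fun z => ‖z‖ < 1) ?_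
        filter_upwards [ae_restrict_mem measurableSet_ball] with x hx
        simpa using hx
      filter_upwards [h1, h2] with p hp1 hp2
      simp only [Function.uncurry, norm_abs_eq_norm]
      refine (norm_inner_le_norm _ _).trans ?_
      rw [hp1, mul_one]; exact hp2.le
  have hswap := integral_integral_swap hInt
  have hL : ∀ z : V (m+1), ∫ x, |(inner ℝ z x : ℝ)| ∂μ = ‖z‖ * ∫ x, |x 0| ∂μ := by
    intro z
    obtain ⟨R, hR⟩ := rot_exists z (‖z‖ • e0 m) (by rw [norm_smul, e0_norm]; simp)
    have hmp : MeasurePreserving R μ μ := by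
      have h1 : MeasurePreserving R (μH[(m:ℝ)]) (μH[(m:ℝ)]) :=
        R.toIsometryEquiv.measurePreserving_hausdorffMeasure _
      have h2 := h1.restrict_preimage (s := sphere 0 1) isClosed_sphere.measurableSet
      have : R ⁻¹' sphere 0 1 = sphere 0 1 := by
        ext x; simp
      rwa [this] at h2
    rw [← integral_const_mul,
      ← hmp.integral_comp R.toHomeomorph.measurableEmbedding (fun x => ‖z‖ * |x 0|)]
    congr 1; ext x
    rw [← R.inner_map_map z x, hR, inner_smul_left, inner_e0]
    simp [abs_mul]
  have hRr : ∀ x : V (m+1), ‖x‖ = 1 → ∫ z in ball (0 : V (m+1)) 1, |(inner ℝ z x : ℝ)| =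
      ∫ z in ball (0 : V (m+1)) 1, |z 0| := by
    intro x hx
    obtain ⟨R, hR⟩ := rot_exists x (e0 m) (by rw [e0_norm, hx])
    rw [← rot_setIntegral R (fun z => |z 0|)]
    congr 1; ext z
    rw [← R.inner_map_map z x, hR, real_inner_comm, inner_e0]
  simp_rw [hL] at hswap
  rw [integral_mul_const] at hswap
  have : ∫ x, (∫ z in ball (0 : V (m+1)) 1, |(inner ℝ z x : ℝ)|) ∂μ =
      ∫ x, (∫ z in ball (0 : V (m+1)) 1, |z 0|) ∂μ :=
    integral_congr_ae (by filter_upwards [hsph] with x hx; exact hRr x hx)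
  rw [this, integral_const, ← hK, smul_eq_mul] at hswap
  have := mul_left_cancel₀ hpos.ne' (show μ.real Set.univ * _ = μ.real Set.univ * (Kconst (m+1) 1 * ∫ z in ball (0 : V (m+1)) 1, ‖z‖) by rw [← hswap]; ring)
  exact this

def slice (m : ℕ) : V (m+1) ≃ᵐ ℝ × V m :=
  ((MeasurableEquiv.toLp 2 (Fin (m+1) → ℝ)).symm.trans
    (MeasurableEquiv.piFinSuccAbove (fun _ => ℝ) 0)).trans
    (MeasurableEquiv.prodCongr (MeasurableEquiv.refl ℝ) (MeasurableEquiv.toLp 2 (Fin m → ℝ)))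

lemma slice_mp (m : ℕ) : MeasurePreserving (slice m) volume volume := by
  have h1 := EuclideanSpace.volume_preserving_symm_measurableEquiv_toLp (Fin (m+1))
  have h2 := volume_preserving_piFinSuccAbove (fun _ : Fin (m+1) => ℝ) 0
  have h3 := (EuclideanSpace.volume_preserving_symm_measurableEquiv_toLp (Fin m)).symm
  have h4 := (MeasurePreserving.id (volume : Measure ℝ)).prod h3
  exact h4.comp (h2.comp h1)

lemma slice_fst {m : ℕ} (x : V (m+1)) : (slice m x).1 = x 0 := rfl

lemma slice_norm {m : ℕ} (x : V (m+1)) : ‖x‖ ^ 2 = (x 0) ^ 2 + ‖(slice m x).2‖ ^ 2 := by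
  rw [EuclideanSpace.norm_sq_eq, EuclideanSpace.norm_sq_eq, Fin.sum_univ_succ]
  simp only [Real.norm_eq_abs, sq_abs]
  rfl

lemma slice_integral (m : ℕ) (f : ℝ × V m → ℝ) :
    ∫ x : V (m+1), f (slice m x) = ∫ p : ℝ × V m, f p :=
  (slice_mp m).integral_comp (slice m).measurableEmbedding f
end

section
def om (m : ℕ) : ℝ := volume.real (ball (0 : V m) 1)

lemma om_pos (m : ℕ) : 0 < om m := by
  unfold om
  exact ENNReal.toReal_pos (measure_ball_pos _ _ one_pos).ne' measure_ball_lt_top.ne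

lemma ball_coord {m : ℕ} (hm : 0 < m) :
    ∫ z in ball (0 : V (m+1)) 1, |z 0| = 2 / (m + 2) * om m := by
  have h1 : ∫ z in ball (0 : V (m+1)) 1, |z 0| =
      ∫ z : V (m+1), (fun p : ℝ × V m => {p : ℝ × V m | p.1^2 + ‖p.2‖^2 < 1}.indicator
        (fun p => |p.1|) p) (slice m z) := by
    rw [← integral_indicator measurableSet_ball]
    congr 1; ext z
    have hn := slice_norm z
    have : z ∈ ball (0 : V (m+1)) 1 ↔ (z 0)^2 + ‖(slice m z).2‖^2 < 1 := by
      rw [mem_ball_zero_iff, ← hn]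
      have := norm_nonneg z
      constructor
      · intro h; nlinarith
      · intro h; nlinarith
    simp only [Set.indicator, Set.mem_ofPred_eq, slice_fst, this]
    congr
  have hmeas : MeasurableSet {p : ℝ × V m | p.1^2 + ‖p.2‖^2 < 1} := by
    refine (IsOpen.measurableSet ?_)
    exact isOpen_lt (by fun_prop) (by fun_prop)
  have hInt : Integrable (fun p : ℝ × V m => {p : ℝ × V m | p.1^2 + ‖p.2‖^2 < 1}.indicator
        (fun p => |p.1|) p) ((volume : Measure ℝ).prod (volume : Measure (V m))) := by
    rw [integrable_indicator_iff hmeas]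
    have hsub : {p : ℝ × V m | p.1^2 + ‖p.2‖^2 < 1} ⊆ (closedBall (0:ℝ) 1) ×ˢ (closedBall (0 : V m) 1) := by
      rintro ⟨s, y⟩ h
      simp only [Set.mem_ofPred_eq] at h
      simp only [Set.mem_prod, mem_closedBall_zero_iff, Real.norm_eq_abs]
      constructor
      · rw [abs_le_one_iff_mul_self_le_one]; nlinarith [sq_nonneg ‖y‖]
      · nlinarith [norm_nonneg y, sq_nonneg s]
    refine IntegrableOn.mono_set ?_ hsub
    have hc : ContinuousOn (fun p : ℝ × V m => |p.1|) ((closedBall (0:ℝ) 1) ×ˢ (closedBall (0 : V m) 1)) := by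
      fun_prop
    exact hc.integrableOn_compact ((isCompact_closedBall _ _).prod (isCompact_closedBall _ _))
  rw [h1, slice_integral m]
  have h2 : ∫ p : ℝ × V m, {p : ℝ × V m | p.1^2 + ‖p.2‖^2 < 1}.indicator
        (fun p => |p.1|) p = ∫ y : V m, ∫ s : ℝ, {p : ℝ × V m | p.1^2 + ‖p.2‖^2 < 1}.indicator
        (fun p => |p.1|) (s, y) := integral_prod_symm _ hInt
  rw [h2]
  have h3 : ∀ y : V m, ∫ s : ℝ, {p : ℝ × V m | p.1^2 + ‖p.2‖^2 < 1}.indicator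
        (fun p => |p.1|) (s, y) = (ball (0 : V m) 1).indicator (fun y => 1 - ‖y‖^2) y := by
    intro y
    by_cases hy : ‖y‖ < 1
    · have hpos : 0 < 1 - ‖y‖^2 := by nlinarith [norm_nonneg y]
      set a := Real.sqrt (1 - ‖y‖^2) with ha
      have ha2 : a^2 = 1 - ‖y‖^2 := Real.sq_sqrt hpos.le
      have ha0 : 0 ≤ a := Real.sqrt_nonneg _
      have : (fun s : ℝ => {p : ℝ × V m | p.1^2 + ‖p.2‖^2 < 1}.indicator
        (fun p => |p.1|) (s, y)) = (Set.Ioo (-a) a).indicator (fun s => |s|) := by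
        ext s
        have : s^2 + ‖y‖^2 < 1 ↔ s ∈ Set.Ioo (-a) a := by
          rw [Set.mem_Ioo, ← abs_lt, ← sq_lt_sq₀ (abs_nonneg s) ha0, sq_abs, ha2]
          constructor <;> intro h <;> linarith
        simp only [Set.indicator, Set.mem_ofPred_eq, this]
      rw [this, integral_indicator measurableSet_Ioo, ← integral_Ioc_eq_integral_Ioo,
        ← intervalIntegral.integral_of_le (by linarith)]
      have hs : ∫ s in (-a)..a, |s| = (∫ s in (-a)..0, |s|) + ∫ s in (0:ℝ)..a, |s| :=
        (intervalIntegral.integral_add_adjacent_intervals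
          (continuous_abs.intervalIntegrable _ _) (continuous_abs.intervalIntegrable _ _)).symm
      have e1 : ∫ s in (-a)..0, |s| = ∫ s in (0:ℝ)..a, |s| := by
        have := intervalIntegral.integral_comp_neg (a := 0) (b := a) (fun s : ℝ => |s|)
        simp only [abs_neg, neg_zero] at this
        exact this.symm
      have e2 : ∫ s in (0:ℝ)..a, |s| = ∫ s in (0:ℝ)..a, s := by
        refine intervalIntegral.integral_congr fun s hs => ?_
        rw [Set.uIcc_of_le ha0] at hs
        exact abs_of_nonneg hs.1
      rw [hs, e1, e2, integral_id, Set.indicator_of_mem (by simpa using hy), ← ha2]; ring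
    · have : (fun s : ℝ => {p : ℝ × V m | p.1^2 + ‖p.2‖^2 < 1}.indicator
        (fun p => |p.1|) (s, y)) = fun _ => 0 := by
        ext s
        rw [Set.indicator_of_notMem]
        simp only [Set.mem_ofPred_eq]
        nlinarith [sq_nonneg s]
      rw [this, Set.indicator_of_notMem (by simpa using hy)]; simp
  simp_rw [h3]
  rw [integral_indicator measurableSet_ball, integral_sub, ball_norm_pow hm 2]
  · simp only [integral_const, measureReal_restrict_apply_univ, smul_eq_mul, mul_one]
    change om m - _ / _ * om m = _
    have : ((m:ℝ) + 2) ≠ 0 := by positivity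
    push_cast
    field_simp; ring
  · exact integrableOn_const measure_ball_lt_top.ne
  · have hc : ContinuousOn (fun y : V m => ‖y‖^2) (closedBall 0 1) := by fun_prop
    exact (hc.integrableOn_compact (isCompact_closedBall _ _)).mono_set ball_subset_closedBall

def Sf (m : ℕ) (u : ℝ) : ℝ := (Real.sqrt (1 - u^2/4)) ^ m

lemma Sf_cont (m : ℕ) : Continuous (Sf m) := by unfold Sf; fun_prop

lemma Sf_nonneg (m : ℕ) (u : ℝ) : 0 ≤ Sf m u := by unfold Sf; positivity

lemma sqrt_le_one' (u : ℝ) : Real.sqrt (1 - u^2/4) ≤ 1 := by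
  rw [Real.sqrt_le_iff]; constructor <;> nlinarith [sq_nonneg u]

lemma Sf_le_one (m : ℕ) (u : ℝ) : Sf m u ≤ 1 :=
  pow_le_one₀ (Real.sqrt_nonneg _) (sqrt_le_one' u)

lemma Sf_zero (m : ℕ) : Sf m 0 = 1 := by simp [Sf]

lemma Sf_big {m : ℕ} (hm : 0 < m) {u : ℝ} (hu : 2 ≤ u) : Sf m u = 0 := by
  unfold Sf
  rw [Real.sqrt_eq_zero_of_nonpos (by nlinarith), zero_pow hm.ne']

def cov {n : ℕ} (z : V n) : ℝ := volume.real (ball (0 : V n) 1 ∩ ball z 1)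

lemma cov_e0 {m : ℕ} (hm : 0 < m) (r : ℝ) (hr : 0 ≤ r) :
    volume (ball (0 : V (m+1)) 1 ∩ ball (r • e0 m) 1) =
      ∫⁻ u in Set.Ioi r, ENNReal.ofReal (Sf m u) * volume (ball (0 : V m) 1) := by
  have : Nonempty (Fin m) := ⟨⟨0, hm⟩⟩
  have : Nontrivial (V m) := inferInstance
  let A : Set (ℝ × V m) := {p | p.1^2 + ‖p.2‖^2 < 1} ∩ {p | (p.1 - r)^2 + ‖p.2‖^2 < 1}
  let D : Set (ℝ × V m) := {p | r < p.1} ∩ {p | p.1 < 2 * Real.sqrt (1 - ‖p.2‖^2)}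
  have hA : MeasurableSet A := IsOpen.measurableSet
    ((isOpen_lt (by fun_prop) (by fun_prop)).inter (isOpen_lt (by fun_prop) (by fun_prop)))
  have hD : MeasurableSet D := IsOpen.measurableSet
    ((isOpen_lt (by fun_prop) (by fun_prop)).inter (isOpen_lt (by fun_prop) (by fun_prop)))
  have h1 : ball (0 : V (m+1)) 1 ∩ ball (r • e0 m) 1 = slice m ⁻¹' A := by
    ext z
    have hn := slice_norm z
    have hn2 := slice_norm (z - r • e0 m)
    have e1 : (z - r • e0 m) 0 = z 0 - r := by simp [e0]
    have e2 : (slice m (z - r • e0 m)).2 = (slice m z).2 := by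
      ext j
      change (z - r • e0 m) j.succ = z j.succ
      simp [e0]
    rw [e1, e2] at hn2
    have hs : ∀ w : V (m+1), ‖w‖ < 1 ↔ ‖w‖^2 < 1 := fun w => by
      have := norm_nonneg w
      constructor
      · intro h; nlinarith
      · intro h; nlinarith
    simp only [Set.mem_inter_iff, mem_ball, dist_eq_norm, sub_zero, A, Set.mem_preimage,
      Set.mem_ofPred_eq, slice_fst, hs, hn, hn2]
  rw [h1, (slice_mp m).measure_preimage hA.nullMeasurableSet]
  have h2 : (volume : Measure (ℝ × V m)) A = (volume : Measure (ℝ × V m)) D := by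
    rw [Measure.volume_eq_prod, Measure.prod_apply_symm hA, Measure.prod_apply_symm hD]
    congr 1; ext y
    by_cases hy : ‖y‖ < 1
    · have hpos : 0 < 1 - ‖y‖^2 := by nlinarith [norm_nonneg y]
      set a := Real.sqrt (1 - ‖y‖^2) with ha
      have ha2 : a^2 = 1 - ‖y‖^2 := Real.sq_sqrt hpos.le
      have ha0 : 0 ≤ a := Real.sqrt_nonneg _
      have e1 : (fun x => (x, y)) ⁻¹' A = Set.Ioo (r - a) a := by
        ext s
        simp only [A, Set.mem_inter_iff, Set.mem_preimage, Set.mem_ofPred_eq, Set.mem_Ioo]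
        have q : ∀ s : ℝ, s^2 + ‖y‖^2 < 1 ↔ (-a < s ∧ s < a) := fun s => by
          rw [← abs_lt, ← sq_lt_sq₀ (abs_nonneg s) ha0, sq_abs, ha2]
          constructor <;> intro h <;> linarith
        rw [q, q]
        constructor
        · rintro ⟨⟨_, _⟩, _, _⟩; constructor <;> linarith
        · rintro ⟨_, _⟩; refine ⟨⟨?_, ?_⟩, ?_, ?_⟩ <;> linarith
      have e2 : (fun x => (x, y)) ⁻¹' D = Set.Ioo r (2 * a) := by
        ext s; simp [D, ← ha]
      rw [e1, e2, Real.volume_Ioo, Real.volume_Ioo]; congr 1; ring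
    · have hz : Real.sqrt (1 - ‖y‖^2) = 0 := Real.sqrt_eq_zero_of_nonpos (by nlinarith)
      have e1 : (fun x => (x, y)) ⁻¹' A = ∅ := by
        ext s
        simp only [A, Set.mem_inter_iff, Set.mem_preimage, Set.mem_ofPred_eq, Set.mem_empty_iff_false, iff_false]
        rintro ⟨h, _⟩
        nlinarith [sq_nonneg s]
      have e2 : (fun x => (x, y)) ⁻¹' D = ∅ := by
        ext s
        simp only [D, Set.mem_inter_iff, Set.mem_preimage, Set.mem_ofPred_eq, Set.mem_empty_iff_false, iff_false, hz]
        rintro ⟨h, h'⟩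
        linarith
      rw [e1, e2]
  rw [h2, Measure.volume_eq_prod, Measure.prod_apply hD, ← lintegral_indicator measurableSet_Ioi]
  congr 1; ext u
  by_cases hu : r < u
  · rw [Set.indicator_of_mem (by exact hu)]
    have e1 : Prod.mk u ⁻¹' D = ball (0 : V m) (Real.sqrt (1 - u^2/4)) := by
      ext y
      simp only [D, Set.mem_inter_iff, Set.mem_preimage, Set.mem_ofPred_eq, hu, true_and, mem_ball_zero_iff]
      have : u < 2 * Real.sqrt (1 - ‖y‖^2) ↔ u/2 < Real.sqrt (1 - ‖y‖^2) := by
        constructor <;> intro h <;> linarith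
      rw [this, Real.lt_sqrt (by linarith), Real.lt_sqrt (norm_nonneg _)]
      constructor <;> intro h <;> nlinarith
    rw [e1, Measure.addHaar_ball _ _ (Real.sqrt_nonneg _)]
    simp [Sf]
  · rw [Set.indicator_of_notMem (by exact hu)]
    have e1 : Prod.mk u ⁻¹' D = ∅ := by
      ext y; simp [D, hu]
    rw [e1]; simp

def rho (m : ℕ) (r : ℝ) : ℝ := ∫ u in (0:ℝ)..r, (1 - Sf m u)

lemma Sf_int {m : ℕ} (hm : 0 < m) : IntegrableOn (Sf m) (Set.Ioi 0) := by
  have h : IntegrableOn (Sf m) (Set.Icc 0 2) := (Sf_cont m).integrableOn_Icc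
  have : IntegrableOn (Sf m) (Set.Ioi 2) := by
    refine (integrableOn_zero).congr_fun (fun u hu => ?_) measurableSet_Ioi
    exact (Sf_big hm (le_of_lt hu)).symm
  refine (h.union this).mono_set ?_
  intro u hu
  by_cases h2 : u ≤ 2
  · left; exact ⟨le_of_lt hu, h2⟩
  · right; exact lt_of_not_ge h2

lemma cov_e0' {m : ℕ} (hm : 0 < m) (r : ℝ) (hr : 0 ≤ r) :
    cov (r • e0 m) = om m * ∫ u in Set.Ioi r, Sf m u := by
  unfold cov
  rw [measureReal_def, cov_e0 hm r hr, lintegral_mul_const _ (by have := Sf_cont m; fun_prop),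
    ENNReal.toReal_mul, mul_comm,
    integral_eq_lintegral_of_nonneg_ae (Eventually.of_forall (Sf_nonneg m))
    (Sf_cont m).aestronglyMeasurable]
  rfl

lemma cov_eq {m : ℕ} (hm : 0 < m) (z : V (m+1)) :
    cov z = cov (0 : V (m+1)) - om m * ‖z‖ + om m * rho m ‖z‖ := by
  obtain ⟨R, hR⟩ := rot_exists z (‖z‖ • e0 m) (by rw [norm_smul, e0_norm]; simp)
  have h1 : cov z = cov (‖z‖ • e0 m) := by
    unfold cov
    rw [← hR, measureReal_def, measureReal_def,
      ← (rot_meas R).measure_preimage (s := ball 0 1 ∩ ball (R z) 1) (measurableSet_ball.inter measurableSet_ball).nullMeasurableSet]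
    congr 2
    ext x
    have := R.dist_map x z
    simp only [Set.mem_inter_iff, mem_ball, Set.mem_preimage, dist_zero_right,
      LinearIsometryEquiv.norm_map, this]
  have h0 : cov (0 : V (m+1)) = cov ((0:ℝ) • e0 m) := by simp
  rw [h1, h0, cov_e0' hm _ (norm_nonneg _), cov_e0' hm 0 le_rfl]
  have h2 : (∫ u in Set.Ioi (0:ℝ), Sf m u) = (∫ u in (0:ℝ)..‖z‖, Sf m u) + ∫ u in Set.Ioi ‖z‖, Sf m u := by
    rw [intervalIntegral.integral_interval_add_Ioi (Sf_int hm)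
      ((Sf_int hm).mono_set (Set.Ioi_subset_Ioi (norm_nonneg _)))]
  have h3 : rho m ‖z‖ = ‖z‖ - ∫ u in (0:ℝ)..‖z‖, Sf m u := by
    unfold rho
    rw [intervalIntegral.integral_sub (by simp) ((Sf_cont m).intervalIntegrable _ _)]
    simp
  rw [h2, h3]; ring

lemma rho_deriv (m : ℕ) (r : ℝ) : HasDerivAt (rho m) (1 - Sf m r) r := by
  have hc : Continuous fun u => 1 - Sf m u := by have := Sf_cont m; fun_prop
  exact intervalIntegral.integral_hasDerivAt_right (hc.intervalIntegrable _ _)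
    (hc.stronglyMeasurableAtFilter _ _) hc.continuousAt
end

section
lemma smul_ae {n : ℕ} {p : V n → Prop} (h : ∀ᵐ x : V n, p x) {l : ℝ} (hl : l ≠ 0) :
    ∀ᵐ x : V n, p (l • x) := by
  have hq : Measure.QuasiMeasurePreserving (fun x : V n => l • x) volume volume := by
    refine ⟨measurable_const_smul l, ?_⟩
    rw [Measure.map_addHaar_smul volume hl]
    exact Measure.smul_absolutelyContinuous
  exact hq.ae h

lemma Gscale_H12 {n : ℕ} {G : V n → ℝ} (hG : H12 G) {l : ℝ} (hl : 0 < l) : H12 (Gscale G l) := by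
  refine ⟨?_, ?_, ?_, ?_, ?_⟩
  · exact (hG.measurable.comp (measurable_const_smul l)).const_mul _
  · intro x; exact mul_nonneg (by positivity) (hG.nonneg _)
  · obtain ⟨g, hg, hg2⟩ := hG.radial
    refine ⟨fun r => l^(n+1) * g (l * r), fun r hr => mul_nonneg (by positivity) (hg _ (by positivity)), ?_⟩
    filter_upwards [smul_ae hg2 hl.ne'] with x hx
    unfold Gscale
    rw [hx, norm_smul, Real.norm_of_nonneg hl.le]
  · exact (hG.integrable.comp_smul hl.ne').const_mul _
  · rw [← hG.firstMoment]
    have h := Measure.integral_comp_smul (volume : Measure (V n)) (fun x => ‖x‖ * G x) l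
    have h2 : ∫ x : V n, ‖x‖ * Gscale G l x = l^n * ∫ x : V n, (fun x => ‖x‖ * G x) (l • x) := by
      rw [← integral_const_mul]
      congr 1; ext x
      unfold Gscale
      simp only [norm_smul, Real.norm_of_nonneg hl.le]
      ring
    rw [h2, h]
    simp only [finrank_euclideanSpace, Fintype.card_fin, smul_eq_mul]
    rw [abs_of_pos (by positivity), ← mul_assoc, mul_inv_cancel₀ (by positivity), one_mul]

lemma ballnorm_pos (m : ℕ) : 0 < ∫ z in ball (0 : V (m+1)) 1, ‖z‖ := by
  have := ball_norm_pow (n := m+1) (by omega) 1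
  simp only [pow_one] at this
  rw [this]
  have := om_pos (m+1)
  unfold om at this
  positivity

lemma Kconst_pos {m : ℕ} (hm : 0 < m) : 0 < Kconst (m+1) 1 := by
  have h1 := Kconst_eq m
  rw [ball_coord hm] at h1
  have h2 := ballnorm_pos m
  have h3 := om_pos m
  by_contra h
  push Not at h
  have : 0 < 2 / ((m:ℝ) + 2) * om m := by positivity
  nlinarith

lemma int_norm {m : ℕ} (hm : 0 < m) {G : V (m+1) → ℝ} (hG : H12 G) :
    Integrable fun x => ‖x‖ * G x := by
  by_contra h
  have h1 := hG.firstMoment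
  rw [integral_undef h] at h1
  have := Kconst_pos hm
  have : 0 < 2 / Kconst (m+1) 1 := by positivity
  linarith

lemma ball_homog_integral {n : ℕ} (h : V n → ℝ) :
    ∫ x in ball (0 : V n) 1, h x = ∫ x : V n, (Set.Iio (1:ℝ)).indicator (fun _ => (1:ℝ)) ‖x‖ * h x := by
  rw [← integral_indicator measurableSet_ball]
  congr 1; ext x
  by_cases hx : ‖x‖ < 1
  · rw [Set.indicator_of_mem (by simpa using hx), Set.indicator_of_mem (by simpa using hx), one_mul]
  · rw [Set.indicator_of_notMem (by simpa using hx), Set.indicator_of_notMem (by simpa using hx), zero_mul]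

lemma G_homog {m : ℕ} (hm : 0 < m) {G : V (m+1) → ℝ} (hG : H12 G) (h : V (m+1) → ℝ)
    (hh : ∀ (r : ℝ) x, 0 < r → h (r • x) = r * h x) :
    om m * ∫ x, G x * h x = (m + 2) * ∫ x in ball (0 : V (m+1)) 1, h x := by
  obtain ⟨g, -, hg⟩ := hG.radial
  have e1 := homog (n := m+1) (by omega) g ((Set.Iio (1:ℝ)).indicator (fun _ => (1:ℝ))) h hh
  rw [← ball_homog_integral, ← ball_homog_integral] at e1
  have e2 : ∫ x : V (m+1), g ‖x‖ * h x = ∫ x, G x * h x :=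
    integral_congr_ae (by filter_upwards [hg] with x hx; rw [hx])
  have e3 : ∫ x : V (m+1), g ‖x‖ * ‖x‖ = 2 / Kconst (m+1) 1 := by
    rw [← hG.firstMoment]
    exact integral_congr_ae (by filter_upwards [hg] with x hx; rw [hx, mul_comm])
  rw [e2, e3] at e1
  have h1 := Kconst_eq m
  rw [ball_coord hm] at h1
  have h2 := ballnorm_pos m
  have h3 := om_pos m
  have h4 := Kconst_pos hm
  set N := ∫ z in ball (0 : V (m+1)) 1, ‖z‖
  set K := Kconst (m+1) 1
  set I := ∫ x, G x * h x
  set J := ∫ x in ball (0 : V (m+1)) 1, h x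
  field_simp at h1 e1
  have : K * N * (om m * I) = K * N * ((m+2) * J) := by
    linear_combination om m * e1 + J * h1
  exact mul_left_cancel₀ (by positivity) this
end

section
def chi {n : ℕ} (ε : ℝ) (x : V n) : ℝ := Real.smoothTransition ((1 - ‖x‖^2)/ε)

def wgt (ε r : ℝ) : ℝ := 2/ε * deriv Real.smoothTransition ((1 - r^2)/ε)

lemma st_deriv_nonneg (u : ℝ) : 0 ≤ deriv Real.smoothTransition u :=
  Real.smoothTransition.monotone.deriv_nonneg

lemma st_deriv_zero {u : ℝ} (h : u ≤ 0 ∨ 1 ≤ u) : deriv Real.smoothTransition u = 0 := by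
  rcases h with h | h
  · refine IsLocalMin.deriv_eq_zero (Eventually.of_forall fun y => ?_)
    rw [Real.smoothTransition.zero_of_nonpos h]
    exact Real.smoothTransition.nonneg y
  · refine IsLocalMax.deriv_eq_zero (Eventually.of_forall fun y => ?_)
    rw [Real.smoothTransition.one_of_one_le h]
    exact Real.smoothTransition.le_one y

lemma wgt_nonneg {ε : ℝ} (hε : 0 < ε) (r : ℝ) : 0 ≤ wgt ε r :=
  mul_nonneg (by positivity) (st_deriv_nonneg _)

lemma wgt_zero_out {ε : ℝ} (hε : 0 < ε) {r : ℝ} (h : 1 ≤ r^2) : wgt ε r = 0 := by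
  unfold wgt
  rw [st_deriv_zero (Or.inl (div_nonpos_of_nonpos_of_nonneg (by linarith) hε.le)), mul_zero]

lemma wgt_zero_in {ε : ℝ} (hε : 0 < ε) {r : ℝ} (h : r^2 ≤ 1 - ε) : wgt ε r = 0 := by
  unfold wgt
  rw [st_deriv_zero (Or.inr (by rw [le_div_iff₀ hε]; linarith)), mul_zero]

lemma st_deriv_cont : Continuous (deriv Real.smoothTransition) :=
  (Real.smoothTransition.contDiff (n := 1)).continuous_deriv le_rfl

lemma wgt_cont (ε : ℝ) : Continuous (wgt ε) := by
  unfold wgt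
  have := st_deriv_cont
  fun_prop

lemma chi_contDiff {n : ℕ} (ε : ℝ) : ContDiff ℝ 1 (chi (n := n) ε) := by
  unfold chi
  refine (Real.smoothTransition.contDiff (n := 1)).comp ?_
  exact (contDiff_const.sub (contDiff_norm_sq ℝ)).div_const _

lemma chi_fderiv {n : ℕ} (ε : ℝ) (x v : V n) :
    fderiv ℝ (chi ε) x v = - (wgt ε ‖x‖ * inner ℝ x v) := by
  have h1 : HasFDerivAt (fun x : V n => (1 - ‖x‖^2)/ε) (ε⁻¹ • (-((2:ℝ) • (innerSL ℝ x : V n →L[ℝ] ℝ)))) x := by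
    have h := ((hasStrictFDerivAt_norm_sq x).hasFDerivAt.const_sub 1).const_mul ε⁻¹
    rw [← Nat.cast_smul_eq_nsmul ℝ] at h
    simpa [div_eq_inv_mul] using h
  have h2 : HasDerivAt Real.smoothTransition (deriv Real.smoothTransition ((1 - ‖x‖^2)/ε)) ((1 - ‖x‖^2)/ε) :=
    (((Real.smoothTransition.contDiff (n := 1)).differentiable one_ne_zero) _).hasDerivAt
  have h3 := h2.comp_hasFDerivAt x h1
  have h4 : fderiv ℝ (chi ε) x = _ := h3.fderiv
  rw [h4]
  simp [wgt]
  ring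

lemma chi_zero {n : ℕ} {ε : ℝ} (hε : 0 < ε) {x : V n} (h : 1 ≤ ‖x‖) : chi ε x = 0 := by
  unfold chi
  exact Real.smoothTransition.zero_of_nonpos (div_nonpos_of_nonpos_of_nonneg (by nlinarith) hε.le)

lemma chi_cpt {n : ℕ} {ε : ℝ} (hε : 0 < ε) : HasCompactSupport (chi (n := n) ε) := by
  refine HasCompactSupport.intro (isCompact_closedBall (0 : V n) 1) fun x hx => ?_
  apply chi_zero hε
  simp at hx; exact hx.le

lemma wgt_cpt {n : ℕ} {ε : ℝ} (hε : 0 < ε) : HasCompactSupport (fun x : V n => wgt ε ‖x‖) := by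
  refine HasCompactSupport.intro (isCompact_closedBall (0 : V n) 1) fun x hx => ?_
  apply wgt_zero_out hε
  simp at hx; nlinarith

lemma wgt_int {n : ℕ} {ε : ℝ} (hε : 0 < ε) {h : V n → ℝ} (hh : Continuous h) :
    Integrable fun x : V n => wgt ε ‖x‖ * h x := by
  have := wgt_cont ε
  exact Continuous.integrable_of_hasCompactSupport (by fun_prop) ((wgt_cpt hε).mul_right)

lemma vdiv_cont {n : ℕ} {ψ : V n → V n} (hψ : ContDiff ℝ 1 ψ) : Continuous (vdiv ψ) := by
  unfold vdiv
  have : Continuous (fderiv ℝ ψ) := hψ.continuous_fderiv one_ne_zero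
  fun_prop

lemma ibp {n : ℕ} {ε : ℝ} (hε : 0 < ε) {ψ : V n → V n} (hψ : ContDiff ℝ 1 ψ) :
    ∫ x, chi ε x * vdiv ψ x = ∫ x : V n, wgt ε ‖x‖ * inner ℝ x (ψ x) := by
  have hc : Continuous (fderiv ℝ ψ) := hψ.continuous_fderiv one_ne_zero
  have hcd : Continuous (fderiv ℝ (chi (n := n) ε)) := (chi_contDiff ε).continuous_fderiv one_ne_zero
  have hcc : Continuous (chi (n := n) ε) := (chi_contDiff ε).continuous
  have hψc : Continuous ψ := hψ.continuous
  have hψd : Differentiable ℝ ψ := hψ.differentiable one_ne_zero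
  have e1 : ∀ i : Fin n, ∫ x, chi ε x * fderiv ℝ ψ x (EuclideanSpace.single i 1) i =
      - ∫ x, fderiv ℝ (chi ε) x (EuclideanSpace.single i 1) * ψ x i := by
    intro i
    have hfi : ∀ x, fderiv ℝ (fun y => ψ y i) x (EuclideanSpace.single i 1)
        = fderiv ℝ ψ x (EuclideanSpace.single i 1) i := by
      intro x
      have h := ((EuclideanSpace.proj i : V n →L[ℝ] ℝ).hasFDerivAt).comp x
        (hψd x).hasFDerivAt
      have h2 : fderiv ℝ (fun y => ψ y i) x = _ := h.fderiv
      rw [h2]; rfl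
    have hi : Differentiable ℝ (fun y => ψ y i) := fun x =>
      (((EuclideanSpace.proj i : V n →L[ℝ] ℝ).hasFDerivAt).comp x
        (hψd x).hasFDerivAt).differentiableAt
    have := integral_mul_fderiv_eq_neg_fderiv_mul_of_integrable (μ := (volume : Measure (V n)))
      (f := chi ε) (g := fun y => ψ y i) (v := EuclideanSpace.single i 1) ?_ ?_ ?_ ?_ ?_
    · simpa [hfi] using this
    · refine Continuous.integrable_of_hasCompactSupport (by fun_prop) ?_
      exact (HasCompactSupport.comp_left (g := fun L : V n →L[ℝ] ℝ => L (EuclideanSpace.single i 1)) ((chi_cpt hε).fderiv ℝ) (by simp)).mul_right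
    · simp only [hfi]
      exact Continuous.integrable_of_hasCompactSupport (by fun_prop) ((chi_cpt hε).mul_right)
    · exact Continuous.integrable_of_hasCompactSupport (by fun_prop) ((chi_cpt hε).mul_right)
    · exact fun x _ => (chi_contDiff ε).differentiable one_ne_zero x
    · exact fun x _ => hi x
  unfold vdiv
  simp_rw [Finset.mul_sum]
  rw [integral_finsetSum]
  · simp_rw [e1]
    rw [Finset.sum_neg_distrib, ← integral_finsetSum, ← integral_neg]
    · congr 1; ext x
      simp_rw [chi_fderiv]
      rw [← Finset.sum_neg_distrib, PiLp.inner_apply, Finset.mul_sum]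
      refine Finset.sum_congr rfl fun i _ => ?_
      rw [EuclideanSpace.inner_single_right]
      simp; ring
    · intro i _
      refine Continuous.integrable_of_hasCompactSupport (by fun_prop) ?_
      exact (HasCompactSupport.comp_left (g := fun L : V n →L[ℝ] ℝ => L (EuclideanSpace.single i 1)) ((chi_cpt hε).fderiv ℝ) (by simp)).mul_right
  · intro i _
    exact Continuous.integrable_of_hasCompactSupport (by fun_prop) ((chi_cpt hε).mul_right)

lemma chi_tendsto {n : ℕ} {f : V n → ℝ} (hf : Continuous f) :
    Tendsto (fun ε => ∫ x, chi ε x * f x) (𝓝[>] 0) (𝓝 (∫ x in ball (0 : V n) 1, f x)) := by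
  rw [← integral_indicator measurableSet_ball]
  refine tendsto_integral_filter_of_dominated_convergence
    (fun x => (closedBall (0 : V n) 1).indicator (fun x => ‖f x‖) x) ?_ ?_ ?_ ?_
  · refine Eventually.of_forall fun ε => ?_
    exact ((chi_contDiff ε).continuous.mul hf).aestronglyMeasurable
  · filter_upwards [self_mem_nhdsWithin] with ε hε
    refine Eventually.of_forall fun x => ?_
    by_cases hx : x ∈ closedBall (0 : V n) 1
    · rw [Set.indicator_of_mem hx, norm_mul]
      refine mul_le_of_le_one_left (norm_nonneg _) ?_
      unfold chi
      rw [Real.norm_of_nonneg (Real.smoothTransition.nonneg _)]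
      exact Real.smoothTransition.le_one _
    · rw [Set.indicator_of_notMem hx, chi_zero hε (by simp at hx; exact hx.le)]; simp
  · rw [integrable_indicator_iff measurableSet_closedBall]
    exact hf.norm.continuousOn.integrableOn_compact (isCompact_closedBall _ _)
  · refine Eventually.of_forall fun x => ?_
    refine tendsto_const_nhds.congr' ?_
    by_cases hx : ‖x‖ < 1
    · have h1 : 0 < 1 - ‖x‖^2 := by nlinarith [norm_nonneg x]
      filter_upwards [Ioo_mem_nhdsGT h1] with ε hε
      rw [Set.indicator_of_mem (by simpa using hx)]
      unfold chi
      rw [Real.smoothTransition.one_of_one_le (by rw [le_div_iff₀ hε.1]; linarith [hε.2]), one_mul]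
    · filter_upwards [self_mem_nhdsWithin] with ε hε
      rw [Set.indicator_of_notMem (by simpa using hx), chi_zero hε (by linarith), zero_mul]

lemma vdiv_id {n : ℕ} (x : V n) : vdiv (fun y : V n => y) x = n := by
  unfold vdiv
  simp

lemma w_norm_sq {n : ℕ} {ε : ℝ} (hε : 0 < ε) :
    ∫ x : V n, wgt ε ‖x‖ * ‖x‖^2 = n * ∫ x : V n, chi ε x := by
  have := ibp hε (ψ := fun y : V n => y) contDiff_id
  simp_rw [vdiv_id, real_inner_self_eq_norm_sq] at this
  rw [← this, integral_mul_const, mul_comm]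

lemma w_norm_sq_tendsto {n : ℕ} :
    Tendsto (fun ε => ∫ x : V n, wgt ε ‖x‖ * ‖x‖^2) (𝓝[>] 0) (𝓝 (n * om n)) := by
  have h := (chi_tendsto (n := n) (f := fun _ => 1) continuous_const).const_mul (n : ℝ)
  simp only [mul_one] at h
  have e : ∫ x in ball (0 : V n) 1, (1:ℝ) = om n := by simp [om]
  rw [e] at h
  refine h.congr' ?_
  filter_upwards [self_mem_nhdsWithin] with ε hε
  exact (w_norm_sq hε).symm

lemma one_sub_inv_tendsto (c : ℝ) {f : ℝ → ℝ} (hf : Tendsto f (𝓝[>] 0) (𝓝 c)) :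
    Tendsto (fun ε => (1-ε)⁻¹ * f ε) (𝓝[>] 0) (𝓝 c) := by
  have h : Tendsto (fun ε : ℝ => (1-ε)⁻¹) (𝓝[>] 0) (𝓝 1) := by
    have : ContinuousAt (fun ε : ℝ => (1-ε)⁻¹) 0 := by
      refine ContinuousAt.inv₀ (by fun_prop) (by simp)
    have := this.tendsto
    simp at this
    exact this.mono_left nhdsWithin_le_nhds
  simpa using h.mul hf

lemma w_norm_tendsto {n : ℕ} :
    Tendsto (fun ε => ∫ x : V n, wgt ε ‖x‖ * ‖x‖) (𝓝[>] 0) (𝓝 (n * om n)) := by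
  have h := w_norm_sq_tendsto (n := n)
  refine tendsto_of_tendsto_of_tendsto_of_le_of_le' h (one_sub_inv_tendsto _ h) ?_ ?_
  · filter_upwards [self_mem_nhdsWithin] with ε hε
    refine integral_mono (wgt_int hε (by fun_prop)) (wgt_int hε (by fun_prop)) fun x => ?_
    by_cases hx : 1 ≤ ‖x‖^2
    · simp [wgt_zero_out hε hx]
    · push Not at hx
      refine mul_le_mul_of_nonneg_left ?_ (wgt_nonneg hε _)
      nlinarith [norm_nonneg x]
  · filter_upwards [Ioo_mem_nhdsGT (one_pos (α := ℝ))] with ε hε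
    rw [← integral_const_mul]
    refine integral_mono (wgt_int hε.1 (by fun_prop)) ((wgt_int hε.1 (by fun_prop)).const_mul _) fun x => ?_
    by_cases hx : ‖x‖^2 ≤ 1 - ε
    · simp [wgt_zero_in hε.1 hx]
    · push Not at hx
      have h1 : 0 < 1 - ε := by linarith [hε.2]
      have h2 : ‖x‖ ≤ (1-ε)⁻¹ * ‖x‖^2 := by
        rw [inv_mul_eq_div, le_div_iff₀ h1]
        nlinarith [norm_nonneg x, hε.1, sq_nonneg (‖x‖ - (1-ε))]
      calc _ ≤ wgt ε ‖x‖ * ((1-ε)⁻¹ * ‖x‖^2) := mul_le_mul_of_nonneg_left h2 (wgt_nonneg hε.1 _)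
        _ = _ := by ring

lemma w_one_le {n : ℕ} {c : ℝ} (hc : ∀ᶠ ε in 𝓝[>] 0, c ≤ ∫ x : V n, wgt ε ‖x‖) : c ≤ n * om n := by
  refine ge_of_tendsto (one_sub_inv_tendsto _ (w_norm_sq_tendsto (n := n))) ?_
  filter_upwards [Ioo_mem_nhdsGT (one_pos (α := ℝ)), hc] with ε hε hc
  refine hc.trans ?_
  rw [← integral_const_mul]
  have := wgt_int (n := n) hε.1 (h := fun _ => 1) (by fun_prop)
  simp only [mul_one] at this
  refine integral_mono this ((wgt_int hε.1 (by fun_prop)).const_mul _) fun x => ?_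
  by_cases hx : ‖x‖^2 ≤ 1 - ε
  · simp [wgt_zero_in hε.1 hx]
  · push Not at hx
    have h1 : 0 < 1 - ε := by linarith [hε.2]
    have h2 : 1 ≤ (1-ε)⁻¹ * ‖x‖^2 := by
      rw [inv_mul_eq_div, le_div_iff₀ h1]; linarith
    calc _ = wgt ε ‖x‖ * 1 := by ring
      _ ≤ wgt ε ‖x‖ * ((1-ε)⁻¹ * ‖x‖^2) := mul_le_mul_of_nonneg_left h2 (wgt_nonneg hε.1 _)
      _ = _ := by ring

lemma w_homog_tendsto {m : ℕ} (h : V (m+1) → ℝ)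
    (hh : ∀ (r : ℝ) x, 0 < r → h (r • x) = r * h x) :
    Tendsto (fun ε => ∫ x : V (m+1), wgt ε ‖x‖ * h x) (𝓝[>] 0)
      (𝓝 ((m+2) * ∫ x in ball (0 : V (m+1)) 1, h x)) := by
  have h2 := ballnorm_pos m
  have e3 := ball_norm_pow (n := m+1) (by omega) 1
  simp only [pow_one] at e3
  have e1 : ∀ ε, ∫ x : V (m+1), wgt ε ‖x‖ * h x = (∫ x in ball (0 : V (m+1)) 1, h x) *
      (∫ x : V (m+1), wgt ε ‖x‖ * ‖x‖) / (∫ z in ball (0 : V (m+1)) 1, ‖z‖) := by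
    intro ε
    have e1 := homog (n := m+1) (by omega) (wgt ε) ((Set.Iio (1:ℝ)).indicator (fun _ => (1:ℝ))) h hh
    rw [← ball_homog_integral, ← ball_homog_integral] at e1
    rw [eq_div_iff h2.ne', e1]
  simp_rw [e1]
  have := ((w_norm_tendsto (n := m+1)).const_mul (∫ x in ball (0 : V (m+1)) 1, h x)).div_const (∫ z in ball (0 : V (m+1)) 1, ‖z‖)
  refine this.trans (le_of_eq ?_)
  congr 1
  rw [e3]
  have := om_pos (m+1)
  change _ = _
  rw [show volume.real (ball (0 : V (m+1)) 1) = om (m+1) from rfl]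
  push_cast
  field_simp
  ring

lemma div_le {m : ℕ} {h : V (m+1) → ℝ} (hh : ∀ (r : ℝ) x, 0 < r → h (r • x) = r * h x)
    (hc : Continuous h) {ψ : V (m+1) → V (m+1)} (hψ : ContDiff ℝ 1 ψ)
    (hle : ∀ x, ‖x‖ ≤ 1 → inner ℝ x (ψ x) ≤ h x) :
    ∫ x in ball (0 : V (m+1)) 1, vdiv ψ x ≤ (m+2) * ∫ x in ball (0 : V (m+1)) 1, h x := by
  refine le_of_tendsto_of_tendsto (chi_tendsto (vdiv_cont hψ)) (w_homog_tendsto h hh) ?_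
  filter_upwards [self_mem_nhdsWithin] with ε hε
  rw [ibp hε hψ]
  have := hψ.continuous
  refine integral_mono (wgt_int hε (by fun_prop)) (wgt_int hε hc) fun x => ?_
  by_cases hx : 1 ≤ ‖x‖^2
  · simp [wgt_zero_out hε hx]
  · push Not at hx
    exact mul_le_mul_of_nonneg_left (hle x (by nlinarith [norm_nonneg x])) (wgt_nonneg hε _)

lemma le_div {m : ℕ} {h : V (m+1) → ℝ} (hh : ∀ (r : ℝ) x, 0 < r → h (r • x) = r * h x)
    (hc : Continuous h) {ψ : V (m+1) → V (m+1)} (hψ : ContDiff ℝ 1 ψ) {c : ℝ} (hc0 : 0 < c)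
    (hle : ∀ x, ‖x‖ ≤ 1 → h x - c ≤ inner ℝ x (ψ x)) :
    (m+2) * ∫ x in ball (0 : V (m+1)) 1, h x ≤
      (∫ x in ball (0 : V (m+1)) 1, vdiv ψ x) + c * ((m+1) * om (m+1)) := by
  rw [← sub_le_iff_le_add', ]
  set A := (m+2) * ∫ x in ball (0 : V (m+1)) 1, h x with hA
  set B := ∫ x in ball (0 : V (m+1)) 1, vdiv ψ x with hB
  have h1 : ∀ ε, 0 < ε → ∫ x : V (m+1), wgt ε ‖x‖ * h x ≤
      (∫ x, chi ε x * vdiv ψ x) + c * ∫ x : V (m+1), wgt ε ‖x‖ := by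
    intro ε hε
    have := hψ.continuous
    have i1 := wgt_int (n := m+1) hε (h := fun _ => 1) (by fun_prop)
    simp only [mul_one] at i1
    rw [ibp hε hψ, ← integral_const_mul, ← integral_add (wgt_int hε (by fun_prop)) (i1.const_mul _)]
    refine integral_mono (wgt_int hε hc) ((wgt_int hε (by fun_prop)).add (i1.const_mul _)) fun x => ?_
    by_cases hx : 1 ≤ ‖x‖^2
    · simp [wgt_zero_out hε hx]
    · push Not at hx
      have := mul_le_mul_of_nonneg_left (hle x (by nlinarith [norm_nonneg x])) (wgt_nonneg hε ‖x‖)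
      simp only []
      linarith
  have h2 := ((w_homog_tendsto h hh).sub (chi_tendsto (vdiv_cont hψ)))
  refine le_of_forall_pos_le_add fun δ hδ => ?_
  have h3 : (A - B - δ) / c ≤ (m+1 : ℕ) * om (m+1) := by
    refine w_one_le ?_
    filter_upwards [h2.eventually (lt_mem_nhds (show A - B - δ < A - B by linarith)), self_mem_nhdsWithin] with ε he hε
    rw [div_le_iff₀ hc0]
    have := h1 ε hε
    linarith
  rw [div_le_iff₀ hc0] at h3
  push_cast at h3
  linarith
end

section
def Td {n : ℕ} (a : Fin n → ℝ) (t : ℝ) : V n →L[ℝ] V n :=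
  LinearMap.toContinuousLinearMap
    { toFun := fun x => WithLp.toLp 2 fun i => Real.exp (t * a i) * x i
      map_add' := fun x y => by ext i; simp [mul_add]
      map_smul' := fun c x => by ext i; simp; ring }

lemma Td_apply {n : ℕ} (a : Fin n → ℝ) (t : ℝ) (x : V n) (i : Fin n) :
    Td a t x i = Real.exp (t * a i) * x i := rfl

lemma Td_zero {n : ℕ} (a : Fin n → ℝ) (x : V n) : Td a 0 x = x := by
  ext i; simp [Td_apply]

lemma Td_add {n : ℕ} (a : Fin n → ℝ) (s t : ℝ) (x : V n) : Td a s (Td a t x) = Td a (s + t) x := by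
  ext i; simp only [Td_apply]; rw [add_mul, Real.exp_add]; ring

lemma Td_neg_left {n : ℕ} (a : Fin n → ℝ) (t : ℝ) (x : V n) : Td a (-t) (Td a t x) = x := by
  rw [Td_add, neg_add_cancel, Td_zero]

lemma Td_neg_right {n : ℕ} (a : Fin n → ℝ) (t : ℝ) (x : V n) : Td a t (Td a (-t) x) = x := by
  rw [Td_add, add_neg_cancel, Td_zero]

lemma Td_inner {n : ℕ} (a : Fin n → ℝ) (t : ℝ) (x y : V n) :
    inner ℝ (Td a t x) y = inner ℝ x (Td a t y) := by
  rw [PiLp.inner_apply, PiLp.inner_apply]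
  refine Finset.sum_congr rfl fun i _ => ?_
  simp only [Td_apply]; simp; ring

lemma Td_single {n : ℕ} (a : Fin n → ℝ) (t : ℝ) (i : Fin n) :
    Td a t (EuclideanSpace.single i 1) = Real.exp (t * a i) • EuclideanSpace.single i (1:ℝ) := by
  ext j; rw [Td_apply]
  by_cases h : j = i
  · subst h; simp
  · simp [h]

lemma Td_mp {n : ℕ} {a : Fin n → ℝ} (ha : ∑ i, a i = 0) (t : ℝ) :
    MeasurePreserving (Td a t) volume volume := by
  have hdet : LinearMap.det ((Td a t : V n →L[ℝ] V n) : V n →ₗ[ℝ] V n) = 1 := by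
    rw [← LinearMap.det_toMatrix (EuclideanSpace.basisFun (Fin n) ℝ).toBasis]
    have : LinearMap.toMatrix (EuclideanSpace.basisFun (Fin n) ℝ).toBasis
        (EuclideanSpace.basisFun (Fin n) ℝ).toBasis ((Td a t : V n →L[ℝ] V n) : V n →ₗ[ℝ] V n)
        = Matrix.diagonal (fun i => Real.exp (t * a i)) := by
      ext i j
      rw [LinearMap.toMatrix_apply]
      simp only [OrthonormalBasis.coe_toBasis, EuclideanSpace.basisFun_apply,
        OrthonormalBasis.coe_toBasis_repr_apply, EuclideanSpace.basisFun_repr]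
      change Td a t (EuclideanSpace.single j 1) i = _
      rw [Td_apply]
      by_cases h : i = j
      · subst h; simp
      · simp [h]
    rw [this, Matrix.det_diagonal, ← Real.exp_sum, ← Finset.mul_sum, ha]; simp
  refine ⟨(Td a t).continuous.measurable, ?_⟩
  have := Measure.map_linearMap_addHaar_eq_smul_addHaar (volume : Measure (V n))
    (f := ((Td a t : V n →L[ℝ] V n) : V n →ₗ[ℝ] V n)) (by rw [hdet]; exact one_ne_zero)
  rw [hdet] at this
  simpa using this

lemma Td_inj {n : ℕ} (a : Fin n → ℝ) (t : ℝ) : Function.Injective (Td a t) := by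
  intro x y h
  rw [← Td_neg_left a t x, h, Td_neg_left]

lemma Td_emb {n : ℕ} (a : Fin n → ℝ) (t : ℝ) : MeasurableEmbedding (Td a t) :=
  (Td a t).continuous.measurableEmbedding (Td_inj a t)

lemma Td_image {n : ℕ} (a : Fin n → ℝ) (t : ℝ) (s : Set (V n)) :
    Td a t '' s = Td a (-t) ⁻¹' s := by
  ext y; constructor
  · rintro ⟨x, hx, rfl⟩; simpa [Td_neg_left] using hx
  · intro h; exact ⟨_, h, Td_neg_right a t y⟩

lemma Td_setIntegral {n : ℕ} {a : Fin n → ℝ} (ha : ∑ i, a i = 0) (t : ℝ) (f : V n → ℝ) (s : Set (V n)) :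
    ∫ x in Td a t '' s, f x = ∫ x in s, f (Td a t x) :=
  (Td_mp ha t).setIntegral_image_emb (Td_emb a t) f s

lemma Td_volume {n : ℕ} {a : Fin n → ℝ} (ha : ∑ i, a i = 0) (t : ℝ) (s : Set (V n)) :
    volume (Td a t '' s) = volume s := by
  rw [Td_image]
  exact (Td_mp ha (-t)).measure_preimage_emb (Td_emb a (-t)) s

lemma Td_div {n : ℕ} (a : Fin n → ℝ) (t : ℝ) {φ : V n → V n} (hφ : ContDiff ℝ 1 φ) (x : V n) :
    vdiv φ (Td a t x) = vdiv (fun y => Td a (-t) (φ (Td a t y))) x := by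
  unfold vdiv
  refine Finset.sum_congr rfl fun i _ => ?_
  have h1 : HasFDerivAt φ (fderiv ℝ φ (Td a t x)) (Td a t x) :=
    (hφ.differentiable one_ne_zero _).hasFDerivAt
  have h2 := (Td a (-t)).hasFDerivAt.comp x (h1.comp x (Td a t).hasFDerivAt)
  have h3 : fderiv ℝ (fun y => Td a (-t) (φ (Td a t y))) x = _ := h2.fderiv
  rw [h3]
  simp only [ContinuousLinearMap.comp_apply, Td_apply, Td_single, map_smul, PiLp.smul_apply, smul_eq_mul]
  rw [← mul_assoc, ← Real.exp_add]; simp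

def hT {n : ℕ} (a : Fin n → ℝ) (t : ℝ) (x : V n) : ℝ := ‖Td a (-t) x‖

lemma hT_homog {n : ℕ} (a : Fin n → ℝ) (t : ℝ) (r : ℝ) (x : V n) (hr : 0 < r) :
    hT a t (r • x) = r * hT a t x := by
  unfold hT; rw [map_smul, norm_smul, Real.norm_of_nonneg hr.le]

lemma hT_cont {n : ℕ} (a : Fin n → ℝ) (t : ℝ) : Continuous (hT a t) := by
  unfold hT; exact (Td a (-t)).continuous.norm

lemma hT_nonneg {n : ℕ} (a : Fin n → ℝ) (t : ℝ) (x : V n) : 0 ≤ hT a t x := norm_nonneg _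

lemma div_Td_le {m : ℕ} {a : Fin (m+1) → ℝ} (ha : ∑ i, a i = 0) (t : ℝ) {φ : V (m+1) → V (m+1)}
    (hφ : ContDiff ℝ 1 φ) (hb : ∀ x, ‖φ x‖ ≤ 1) :
    ∫ x in Td a t '' ball 0 1, vdiv φ x ≤ (m+2) * ∫ x in ball (0 : V (m+1)) 1, hT a t x := by
  rw [Td_setIntegral ha]
  simp_rw [Td_div a t hφ]
  refine div_le (hT_homog a t) (hT_cont a t) ?_ ?_
  · exact (Td a (-t)).contDiff.comp (hφ.comp (Td a t).contDiff)
  · intro x _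
    rw [← Td_inner]
    calc _ ≤ ‖Td a (-t) x‖ * ‖φ (Td a t x)‖ := real_inner_le_norm _ _
      _ ≤ ‖Td a (-t) x‖ * 1 := mul_le_mul_of_nonneg_left (hb _) (norm_nonneg _)
      _ = _ := by rw [mul_one]; rfl

lemma exists_cutoff {n : ℕ} (R : ℝ) (hR : 0 < R) : ∃ ζ : V n → ℝ, ContDiff ℝ (⊤ : ℕ∞) ζ ∧ HasCompactSupport ζ ∧
    (∀ x, 0 ≤ ζ x) ∧ (∀ x, ζ x ≤ 1) ∧ ∀ x, ‖x‖ ≤ R → ζ x = 1 := by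
  let f : ContDiffBump (0 : V n) := ⟨R, R+1, hR, by linarith⟩
  exact ⟨f, f.contDiff, f.hasCompactSupport, fun x => f.nonneg, fun x => f.le_one,
    fun x hx => f.one_of_mem_closedBall (by simpa using hx)⟩

lemma le_div_Td {m : ℕ} {a : Fin (m+1) → ℝ} (ha : ∑ i, a i = 0) (t : ℝ) {c : ℝ} (hc : 0 < c) :
    ∃ φ : V (m+1) → V (m+1), ContDiff ℝ 1 φ ∧ HasCompactSupport φ ∧ (∀ x, ‖φ x‖ ≤ 1) ∧
    (m+2) * ∫ x in ball (0 : V (m+1)) 1, hT a t x ≤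
      (∫ x in Td a t '' ball 0 1, vdiv φ x) + c * ((m+1) * om (m+1)) := by
  obtain ⟨ζ, hζ, hζc, hζ0, hζ1, hζR⟩ := exists_cutoff (n := m+1) (‖Td a t‖ + 1) (by positivity)
  have hpos : ∀ x : V (m+1), 0 < ‖Td a (-(2*t)) x‖^2 + c^2 := fun x => by positivity
  let φ : V (m+1) → V (m+1) := fun x => (ζ x * (Real.sqrt (‖Td a (-(2*t)) x‖^2 + c^2))⁻¹) • Td a (-(2*t)) x
  have hq : ContDiff ℝ 1 fun x : V (m+1) => ζ x * (Real.sqrt (‖Td a (-(2*t)) x‖^2 + c^2))⁻¹ := by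
    refine (hζ.of_le (by exact_mod_cast le_top)).mul (ContDiff.inv ?_ fun x => (Real.sqrt_pos.2 (hpos x)).ne')
    refine ContDiff.sqrt ?_ fun x => (hpos x).ne'
    have h1 : ContDiff ℝ 1 fun x : V (m+1) => ‖Td a (-(2*t)) x‖^2 := (Td a (-(2*t))).contDiff.norm_sq ℝ
    exact h1.add contDiff_const
  have hφ : ContDiff ℝ 1 φ := by
    have h2 : ContDiff ℝ 1 fun x : V (m+1) => Td a (-(2*t)) x := (Td a (-(2*t))).contDiff
    exact hq.smul h2
  have hcs : HasCompactSupport φ := by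
    refine hζc.mono fun x hx => ?_
    simp only [φ, Function.mem_support] at hx ⊢
    intro h0
    apply hx
    rw [h0, zero_mul, zero_smul]
  refine ⟨φ, hφ, hcs, ?_, ?_⟩
  · intro x
    simp only [φ]
    rw [norm_smul, Real.norm_of_nonneg (mul_nonneg (hζ0 x) (by positivity)), mul_assoc]
    refine mul_le_one₀ (hζ1 x) (by positivity) ?_
    rw [inv_mul_le_iff₀ (Real.sqrt_pos.2 (hpos x)), mul_one]
    exact Real.le_sqrt_of_sq_le (by nlinarith)
  · rw [Td_setIntegral ha]
    simp_rw [Td_div a t hφ]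
    refine le_div (hT_homog a t) (hT_cont a t) ?_ hc ?_
    · exact (Td a (-t)).contDiff.comp (hφ.comp (Td a t).contDiff)
    · intro x hx
      rw [← Td_inner]
      have h1 : ζ (Td a t x) = 1 := by
        apply hζR
        calc _ ≤ ‖Td a t‖ * ‖x‖ := (Td a t).le_opNorm x
          _ ≤ ‖Td a t‖ * 1 := by gcongr
          _ ≤ _ := by linarith
      simp only [φ]
      rw [h1, one_mul, Td_add, show -(2*t) + t = -t by ring, real_inner_smul_right, real_inner_self_eq_norm_sq]
      change hT a t x - c ≤ (Real.sqrt (hT a t x ^2 + c^2))⁻¹ * hT a t x ^2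
      have hh := hT_nonneg a t x
      set h := hT a t x
      have hs : 0 < Real.sqrt (h^2+c^2) := Real.sqrt_pos.2 (by positivity)
      have hs2 : Real.sqrt (h^2+c^2)^2 = h^2+c^2 := Real.sq_sqrt (by positivity)
      have hs3 : Real.sqrt (h^2+c^2) ≤ h + c := Real.sqrt_le_iff.2 ⟨by positivity, by nlinarith⟩
      rw [inv_mul_eq_div, le_div_iff₀ hs]
      by_cases hhc : h ≤ c
      · nlinarith [sq_nonneg h]
      · push Not at hhc
        nlinarith

lemma perimeter_Td {m : ℕ} {a : Fin (m+1) → ℝ} (ha : ∑ i, a i = 0) (t : ℝ) :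
    perimeter (Td a t '' ball (0 : V (m+1)) 1) =
      ENNReal.ofReal ((m+2) * ∫ x in ball (0 : V (m+1)) 1, hT a t x) := by
  apply le_antisymm
  · exact iSup_le fun φ => ENNReal.ofReal_le_ofReal (div_Td_le ha t φ.2.1 φ.2.2.2)
  · have ho := om_pos (m+1)
    set A := (m+2) * ∫ x in ball (0 : V (m+1)) 1, hT a t x
    refine ENNReal.le_of_forall_pos_le_add fun δ hδ _ => ?_
    obtain ⟨φ, h1, h2, h3, h4⟩ := le_div_Td ha t (c := δ / ((m+1) * om (m+1))) (by positivity)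
    rw [div_mul_cancel₀ _ (by positivity)] at h4
    calc ENNReal.ofReal A ≤ ENNReal.ofReal ((∫ x in Td a t '' ball 0 1, vdiv φ x) + δ) := ENNReal.ofReal_le_ofReal h4
      _ ≤ ENNReal.ofReal (∫ x in Td a t '' ball 0 1, vdiv φ x) + ENNReal.ofReal δ := ENNReal.ofReal_add_le
      _ ≤ perimeter (Td a t '' ball (0 : V (m+1)) 1) + δ := by
        rw [ENNReal.ofReal_coe_nnreal]
        gcongr
        exact le_iSup (fun φ : {φ : V (m+1) → V (m+1) // ContDiff ℝ 1 φ ∧ HasCompactSupport φ ∧ ∀ x, ‖φ x‖ ≤ 1} =>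
          ENNReal.ofReal (∫ x in Td a t '' ball 0 1, vdiv φ.1 x)) ⟨φ, h1, h2, h3⟩

lemma P_Td {m : ℕ} {a : Fin (m+1) → ℝ} (ha : ∑ i, a i = 0) (t : ℝ) :
    P (Td a t '' ball (0 : V (m+1)) 1) = (m+2) * ∫ x in ball (0 : V (m+1)) 1, hT a t x := by
  unfold P
  rw [perimeter_Td ha, ENNReal.toReal_ofReal]
  exact mul_nonneg (by positivity) (integral_nonneg fun x => hT_nonneg a t x)

lemma perimeter_ball {m : ℕ} : perimeter (ball (0 : V (m+1)) 1) = ENNReal.ofReal ((m+1) * om (m+1)) := by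
  have h := perimeter_Td (m := m) (a := fun _ => 0) (by simp) 0
  have e1 : Td (fun _ : Fin (m+1) => (0:ℝ)) 0 '' ball (0 : V (m+1)) 1 = ball 0 1 := by
    rw [Td_image]; ext x; simp [Td_zero]
  have e2 : ∀ x, hT (fun _ : Fin (m+1) => (0:ℝ)) 0 x = ‖x‖ := by intro x; simp [hT, Td_zero]
  rw [e1] at h
  simp_rw [e2] at h
  have e3 := ball_norm_pow (n := m+1) (by omega) 1
  simp only [pow_one] at e3
  rw [h, e3, show volume.real (ball (0 : V (m+1)) 1) = om (m+1) from rfl]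
  congr 1
  push_cast
  field_simp
  ring
end

section
lemma sol_unique {n : ℕ} {X : V n → V n} {K : ℝ≥0} (hK : LipschitzWith K X) {f g : ℝ → V n} {b : ℝ} (hb : 0 < b)
    (hf : ∀ t ∈ Set.Ioo (-b) b, HasDerivAt f (X (f t)) t) (hg : ∀ t ∈ Set.Ioo (-b) b, HasDerivAt g (X (g t)) t)
    (h0 : f 0 = g 0) : Set.EqOn f g (Set.Ioo (-b) b) :=
  ODE_solution_unique_of_mem_Ioo (v := fun _ => X) (s := fun _ => Set.univ) (K := K) (t₀ := 0)
    (fun _ _ => hK.lipschitzOnWith) ⟨by linarith, hb⟩ (fun t ht => ⟨hf t ht, trivial⟩)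
    (fun t ht => ⟨hg t ht, trivial⟩) h0

lemma flow_exists {n : ℕ} {X : V n → V n} {K L : ℝ≥0} (hK : LipschitzWith K X) (hL : ∀ x, ‖X x‖ ≤ L) :
    ∃ Φ : ℝ → V n → V n, (∀ x, Φ 0 x = x) ∧ ∀ t x, HasDerivAt (fun s => Φ s x) (X (Φ t x)) t := by
  have h1 : ∀ (x : V n) (N : ℕ), ∃ α : ℝ → V n, α 0 = x ∧ ∀ t ∈ Set.Ioo (-((N:ℝ)+1)) ((N:ℝ)+1), HasDerivAt α (X (α t)) t := by
    intro x N
    have hN : (0:ℝ) ≤ (N:ℝ)+1 := by positivity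
    have hp : IsPicardLindelof (fun _ => X) (tmin := -((N:ℝ)+1)) (tmax := (N:ℝ)+1) ⟨0, by constructor <;> linarith⟩ x
        (L * ((N:ℝ≥0)+1)) 0 L K := by
      refine IsPicardLindelof.of_time_independent (fun y _ => hL y) hK.lipschitzOnWith ?_
      simp
    obtain ⟨α, h0, h⟩ := hp.exists_eq_forall_mem_Icc_hasDerivWithinAt₀
    refine ⟨α, h0, fun t ht => ?_⟩
    exact (h t (Set.Ioo_subset_Icc_self ht)).hasDerivAt (Icc_mem_nhds ht.1 ht.2)
  choose α h0 hα using h1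
  have key : ∀ x (N : ℕ), ∀ s ∈ Set.Ioo (-((N:ℝ)+1)) ((N:ℝ)+1), α x ⌊|s|⌋₊ s = α x N s := by
    intro x N s hs
    have hs' : |s| < N + 1 := abs_lt.2 hs
    have hle : ⌊|s|⌋₊ ≤ N := by
      have : ⌊|s|⌋₊ < N + 1 := (Nat.floor_lt (abs_nonneg s)).2 (by exact_mod_cast hs')
      omega
    have hleR : ((⌊|s|⌋₊ : ℕ) : ℝ) ≤ N := by exact_mod_cast hle
    refine sol_unique hK (b := (⌊|s|⌋₊ : ℝ) + 1) (by positivity) (hα x _) (fun t ht => hα x N t ⟨by linarith [ht.1], by linarith [ht.2]⟩) (by rw [h0, h0]) ?_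
    exact abs_lt.1 (Nat.lt_floor_add_one _)
  refine ⟨fun t x => α x ⌊|t|⌋₊ t, fun x => by simp [h0], fun t x => ?_⟩
  have ht : t ∈ Set.Ioo (-((⌊|t|⌋₊:ℝ)+1)) ((⌊|t|⌋₊:ℝ)+1) := abs_lt.1 (Nat.lt_floor_add_one _)
  refine (hα x ⌊|t|⌋₊ t ht).congr_of_eventuallyEq ?_
  filter_upwards [Ioo_mem_nhds ht.1 ht.2] with s hs
  exact key x _ s hs

structure FlowFacts {n : ℕ} (X : V n → V n) (Φ : ℝ → V n → V n) (L : ℝ) : Prop where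
  cont : ∀ t, Continuous (Φ t)
  inv : ∀ t x, Φ (-t) (Φ t x) = x
  disp : ∀ t x, ‖Φ t x - x‖ ≤ L * |t|

lemma flow_group {n : ℕ} {X : V n → V n} {Φ : ℝ → V n → V n} {K : ℝ≥0} (hK : LipschitzWith K X)
    (h0 : ∀ x, Φ 0 x = x) (hΦ : ∀ t x, HasDerivAt (fun s => Φ s x) (X (Φ t x)) t) (s t : ℝ) (x : V n) :
    Φ s (Φ t x) = Φ (s + t) x := by
  have := ODE_solution_unique_univ (v := fun _ => X) (s := fun _ => Set.univ) (K := K) (t₀ := 0)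
    (f := fun s => Φ s (Φ t x)) (g := fun s => Φ (s + t) x) (fun _ => hK.lipschitzOnWith)
    (fun s => ⟨hΦ s _, trivial⟩) (fun s => ⟨(hΦ (s+t) x).comp_add_const s t, trivial⟩) (by simp [h0])
  exact congrFun this s

lemma flow_cont_nonneg {n : ℕ} {X : V n → V n} {Φ : ℝ → V n → V n} {K : ℝ≥0} (hK : LipschitzWith K X)
    (h0 : ∀ x, Φ 0 x = x) (hΦ : ∀ t x, HasDerivAt (fun s => Φ s x) (X (Φ t x)) t) {t : ℝ} (ht : 0 ≤ t) :
    Continuous (Φ t) := by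
  have : LipschitzWith (Real.toNNReal (Real.exp (K * t))) (Φ t) := by
    refine LipschitzWith.of_dist_le_mul fun x y => ?_
    have := dist_le_of_trajectories_ODE (v := fun _ => X) (K := K) (f := fun s => Φ s x) (g := fun s => Φ s y) (a := 0) (b := t)
      (δ := dist x y) (fun _ => hK) (fun s _ => (hΦ s x).continuousAt.continuousWithinAt)
      (fun s _ => (hΦ s x).hasDerivWithinAt) (fun s _ => (hΦ s y).continuousAt.continuousWithinAt)
      (fun s _ => (hΦ s y).hasDerivWithinAt) (by simp [h0]) t ⟨ht, le_rfl⟩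
    rw [Real.coe_toNNReal _ (Real.exp_pos _).le, mul_comm]
    simpa using this
  exact this.continuous

lemma flow_facts {n : ℕ} {X : V n → V n} {Φ : ℝ → V n → V n} (h : IsFlowOf X Φ) :
    ∃ L : ℝ, 0 < L ∧ FlowFacts X Φ L := by
  obtain ⟨K, hK⟩ := ContDiff.lipschitzWith_of_hasCompactSupport h.cptSupp h.smooth (by simp)
  obtain ⟨L, hL⟩ := h.smooth.continuous.bounded_above_of_compact_support h.cptSupp
  refine ⟨max L 1, by positivity, ⟨fun t => ?_, fun t x => ?_, fun t x => ?_⟩⟩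
  · rcases le_total 0 t with ht | ht
    · exact flow_cont_nonneg hK h.init h.isFlow ht
    · have := flow_cont_nonneg (X := fun x => - X x) (Φ := fun s => Φ (-s)) (K := K) hK.neg
        (by simpa using h.init) (fun s x => ?_) (neg_nonneg.2 ht)
      · simpa using this
      · have := (h.isFlow (-s) x).scomp s (hasDerivAt_neg s)
        simpa [Function.comp_def] using this
  · rw [flow_group hK h.init h.isFlow, neg_add_cancel, h.init]
  · have := Convex.norm_image_sub_le_of_norm_hasDerivWithin_le (f := fun s => Φ s x) (C := max L 1) (s := Set.univ)
      (x := 0) (y := t) (fun s _ => (h.isFlow s x).hasDerivWithinAt) (fun s _ => (hL _).trans (le_max_left _ _)) convex_univ trivial trivial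
    simpa [h.init] using this

lemma flow_image {n : ℕ} {X : V n → V n} {Φ : ℝ → V n → V n} {L : ℝ} (h : FlowFacts X Φ L) (t : ℝ) (s : Set (V n)) :
    Φ t '' s = Φ (-t) ⁻¹' s := by
  ext y; constructor
  · rintro ⟨x, hx, rfl⟩; simpa [h.inv] using hx
  · intro hy; exact ⟨_, hy, by simpa using h.inv (-t) y⟩

def Aop {n : ℕ} (a : Fin n → ℝ) : V n →L[ℝ] V n :=
  LinearMap.toContinuousLinearMap
    { toFun := fun x => WithLp.toLp 2 fun i => a i * x i
      map_add' := fun x y => by ext i; simp [mul_add]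
      map_smul' := fun c x => by ext i; simp; ring }

lemma Aop_apply {n : ℕ} (a : Fin n → ℝ) (x : V n) (i : Fin n) : Aop a x i = a i * x i := rfl

lemma Td_deriv {n : ℕ} (a : Fin n → ℝ) (t : ℝ) (x : V n) :
    HasDerivAt (fun s => Td a s x) (Aop a (Td a t x)) t := by
  have h1 : HasDerivAt (fun s => (fun i => Real.exp (s * a i) * x i : Fin n → ℝ))
      (fun i => a i * (Real.exp (t * a i) * x i)) t := by
    rw [hasDerivAt_pi]
    intro i
    have := ((hasDerivAt_mul_const (a i) (x := t)).exp).mul_const (x i)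
    have e : a i * (Real.exp (t * a i) * x i) = Real.exp (t * a i) * a i * x i := by ring
    simp only [e]
    exact this
  exact (PiLp.hasFDerivAt_toLp (𝕜 := ℝ) 2 _).comp_hasDerivAt t h1

lemma Td_norm_le {n : ℕ} {a : Fin n → ℝ} (ha : ∀ i, |a i| ≤ 1) (t : ℝ) (x : V n) :
    ‖Td a t x‖ ≤ Real.exp |t| * ‖x‖ := by
  rw [← sq_le_sq₀ (norm_nonneg _) (by positivity), mul_pow, EuclideanSpace.norm_sq_eq, EuclideanSpace.norm_sq_eq,
    Finset.mul_sum]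
  refine Finset.sum_le_sum fun i _ => ?_
  rw [Td_apply, norm_mul, mul_pow, Real.norm_of_nonneg (Real.exp_pos _).le]
  gcongr
  calc t * a i ≤ |t * a i| := le_abs_self _
    _ = |t| * |a i| := abs_mul _ _
    _ ≤ |t| * 1 := by gcongr; exact ha i
    _ = |t| := mul_one _

lemma exists_Td_flow {n : ℕ} {a : Fin n → ℝ} (ha : ∀ i, |a i| ≤ 1) :
    ∃ (X : V n → V n) (Φ : ℝ → V n → V n), IsFlowOf X Φ ∧
      ∀ t, |t| < 1 → Φ t '' ball 0 1 = Td a t '' ball 0 1 := by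
  obtain ⟨ζ, hζ, hζc, hζ0, hζ1, hζR⟩ := exists_cutoff (n := n) 3 (by norm_num)
  let X : V n → V n := fun x => ζ x • Aop a x
  have hX : ContDiff ℝ (⊤ : ℕ∞) X := hζ.smul (Aop a).contDiff
  have hXc : HasCompactSupport X := by
    refine hζc.mono fun x hx => ?_
    simp only [X, Function.mem_support] at hx ⊢
    intro h0
    exact hx (by rw [h0, zero_smul])
  obtain ⟨K, hK⟩ := ContDiff.lipschitzWith_of_hasCompactSupport hXc hX (by simp)
  obtain ⟨L, hL⟩ := hX.continuous.bounded_above_of_compact_support hXc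
  obtain ⟨Φ, h0, hΦ⟩ := flow_exists (L := Real.toNNReal L) hK (fun x => (hL x).trans (Real.le_coe_toNNReal L))
  refine ⟨X, Φ, ⟨hX, hXc, h0, hΦ⟩, fun t ht => Set.image_congr fun x hx => ?_⟩
  refine sol_unique hK (f := fun s => Φ s x) (g := fun s => Td a s x) one_pos (fun s _ => hΦ s x) (fun s hs => ?_) (by simp [h0, Td_zero]) (abs_lt.1 ht)
  have := Td_deriv a s x
  have h1 : ζ (Td a s x) = 1 := by
    apply hζR
    have hs1 : |s| < 1 := abs_lt.2 hs
    have hx1 : ‖x‖ < 1 := by simpa using hx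
    calc _ ≤ Real.exp |s| * ‖x‖ := Td_norm_le ha s x
      _ ≤ Real.exp 1 * 1 := by gcongr
      _ ≤ 3 := by linarith [Real.exp_one_lt_d9]
  simp only [X, h1, one_smul]
  exact this
end

section
def shell {n : ℕ} (r : ℝ) : Set (V n) := {x | |‖x‖ - 1| ≤ r}

lemma shell_bigO {n : ℕ} (hn : 0 < n) : ∃ C : ℝ, 0 < C ∧ ∃ r0 > 0, ∀ r, 0 ≤ r → r < r0 →
    volume.real (shell (n := n) r) ≤ C * r := by
  have : Nonempty (Fin n) := ⟨⟨0, hn⟩⟩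
  have : Nontrivial (V n) := inferInstance
  have hd : HasDerivAt (fun r : ℝ => ((1+r)^n - (1-r)^n) * om n)
     ((((n:ℝ)*(1+0)^(n-1) * (1) - (n:ℝ)*(1-0)^(n-1) * (-1))) * om n) 0 := by
    refine HasDerivAt.mul_const ?_ _
    refine HasDerivAt.sub ?_ ?_
    · exact ((hasDerivAt_id' (0:ℝ)).const_add 1).pow n
    · exact ((hasDerivAt_id' (0:ℝ)).const_sub 1).pow n
  have h := hd.isBigO_sub
  obtain ⟨C, hC, hb⟩ := h.exists_pos
  rw [isBigOWith_iff, Metric.eventually_nhds_iff] at hb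
  obtain ⟨r0, hr0, hb⟩ := hb
  refine ⟨C, hC, min r0 1, by positivity, fun r hr hr1 => ?_⟩
  have hb := hb (y := r) (by simpa [abs_of_nonneg hr] using lt_of_lt_of_le hr1 (min_le_left _ _))
  have hr2 : r < 1 := lt_of_lt_of_le hr1 (min_le_right _ _)
  simp only [add_zero, sub_zero, one_pow, sub_self, zero_mul, Real.norm_eq_abs, abs_of_nonneg hr] at hb
  refine le_trans ?_ ((le_abs_self _).trans hb)
  have hsub : shell (n := n) r ⊆ closedBall 0 (1+r) \ ball 0 (1-r) := by
    intro x hx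
    have : |‖x‖ - 1| ≤ r := hx
    rw [abs_le] at this
    simp; constructor <;> linarith
  have hvol : volume.real (closedBall (0 : V n) (1+r) \ ball 0 (1-r)) = (1+r)^n * om n - (1-r)^n * om n := by
    rw [measureReal_sdiff (ball_subset_closedBall.trans (closedBall_subset_closedBall (by linarith))) measurableSet_ball measure_closedBall_lt_top.ne]
    congr 1
    · rw [measureReal_def, Measure.addHaar_closedBall _ _ (by linarith)]
      simp [om, measureReal_def, ENNReal.toReal_ofReal (by positivity : (0:ℝ) ≤ (1+r)^n)]
    · rw [measureReal_def, Measure.addHaar_ball _ _ (by linarith)]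
      simp [om, measureReal_def, ENNReal.toReal_ofReal (pow_nonneg (by linarith) n : (0:ℝ) ≤ (1-r)^n)]
  rw [sub_mul, ← hvol]
  exact measureReal_mono hsub (measure_diff_lt_top_of_lt_top measure_closedBall_lt_top).ne
where
  measure_diff_lt_top_of_lt_top {n : ℕ} {s t : Set (V n)} (h : volume s < ⊤) : volume (s \ t) < ⊤ :=
    lt_of_le_of_lt (measure_mono Set.sdiff_subset) h

lemma diff_bound {n : ℕ} {E B : Set (V n)} (hE : MeasurableSet E) (hB : MeasurableSet B)
    (hBf : volume B < ⊤) (hv : volume E = volume B) {k : V n → ℝ} (hkE : IntegrableOn k E) (hkB : IntegrableOn k B)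
    {c ε : ℝ} (hε : ∀ x ∈ symmDiff E B, |k x - c| ≤ ε) :
    |(∫ x in E, k x) - ∫ x in B, k x| ≤ ε * volume.real (symmDiff E B) := by
  have hEf : volume E < ⊤ := by rwa [hv]
  have iE : IntegrableOn (fun x => k x - c) E := hkE.sub (integrableOn_const hEf.ne)
  have iB : IntegrableOn (fun x => k x - c) B := hkB.sub (integrableOn_const hBf.ne)
  have e1 : (∫ x in E, k x) - ∫ x in B, k x = (∫ x in E, (k x - c)) - ∫ x in B, (k x - c) := by
    rw [integral_sub hkE (integrableOn_const hEf.ne), integral_sub hkB (integrableOn_const hBf.ne)]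
    simp [measureReal_def, hv]
  have e2 := integral_inter_add_sdiff (μ := volume) hB iE
  have e3 := integral_inter_add_sdiff (μ := volume) hE iB
  rw [Set.inter_comm] at e3
  have e4 : (∫ x in E, k x) - ∫ x in B, k x = (∫ x in E \ B, (k x - c)) - ∫ x in B \ E, (k x - c) := by
    rw [e1, ← e2, ← e3]; ring
  have hEB : volume (E \ B) < ⊤ := lt_of_le_of_lt (measure_mono Set.sdiff_subset) hEf
  have hBE : volume (B \ E) < ⊤ := lt_of_le_of_lt (measure_mono Set.sdiff_subset) hBf
  have b1 : ‖∫ x in E \ B, (k x - c)‖ ≤ ε * volume.real (E \ B) :=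
    norm_setIntegral_le_of_norm_le_const hEB (fun x hx => hε x (Or.inl hx))
  have b2 : ‖∫ x in B \ E, (k x - c)‖ ≤ ε * volume.real (B \ E) :=
    norm_setIntegral_le_of_norm_le_const hBE (fun x hx => hε x (Or.inr hx))
  have hs : volume.real (symmDiff E B) = volume.real (E \ B) + volume.real (B \ E) := by
    rw [Set.symmDiff_def]
    exact measureReal_union (Set.disjoint_left.2 fun x hx hx2 => hx.2 hx2.1) (hB.diff hE) hEB.ne hBE.ne
  rw [e4, hs, mul_add]
  exact (abs_sub _ _).trans (add_le_add b1 b2)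

lemma near_sphere {n : ℕ} {k : V n → ℝ} (hk : Continuous k) {c : ℝ} (hc : ∀ x, ‖x‖ = 1 → k x = c) {ε : ℝ} (hε : 0 < ε) :
    ∃ r0 > 0, ∀ x ∈ shell (n := n) r0, |k x - c| ≤ ε := by
  have hu := (isCompact_closedBall (0 : V n) 2).uniformContinuousOn_of_continuous hk.continuousOn
  rw [Metric.uniformContinuousOn_iff] at hu
  obtain ⟨δ, hδ, hu⟩ := hu ε hε
  refine ⟨min (δ/2) (1/2), by positivity, fun x hx => ?_⟩
  have h1 : |‖x‖ - 1| ≤ min (δ/2) (1/2) := hx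
  have h2 := h1.trans (min_le_left _ _)
  have h3 := abs_le.1 (h1.trans (min_le_right _ _))
  have hx0 : 0 < ‖x‖ := by linarith
  have hy : ‖‖x‖⁻¹ • x‖ = 1 := by rw [norm_smul, norm_inv, norm_norm, inv_mul_cancel₀ hx0.ne']
  have := hu x (by simp; linarith) (‖x‖⁻¹ • x) (by simp only [mem_closedBall_zero_iff, hy]; norm_num) ?_
  · rw [hc _ hy, Real.dist_eq] at this; exact this.le
  · rw [dist_eq_norm]
    have : x - ‖x‖⁻¹ • x = (1 - ‖x‖⁻¹) • x := by rw [sub_smul, one_smul]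
    rw [this, norm_smul, Real.norm_eq_abs]
    have : |1 - ‖x‖⁻¹| * ‖x‖ = |‖x‖ - 1| := by
      nth_rewrite 2 [← abs_of_pos hx0]
      rw [← abs_mul, sub_mul, one_mul, inv_mul_cancel₀ hx0.ne']
    rw [this]; linarith

section GG
variable {n : ℕ} {G : V n → ℝ}

def gE (G : V n → ℝ) (E : Set (V n)) (x : V n) : ℝ := ∫ y in E, G (x - y)

lemma G_int (hG : H12 G) (x : V n) : Integrable fun y => G (x - y) := hG.integrable.comp_sub_left x

lemma G_even (hG : H12 G) (R : V n ≃ₗᵢ[ℝ] V n) : ∀ᵐ x, G (R x) = G x := by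
  obtain ⟨g, -, hg⟩ := hG.radial
  have h2 := (rot_meas R).quasiMeasurePreserving.ae hg
  filter_upwards [hg, h2] with x h1 h2
  rw [h1, h2, R.norm_map]

lemma G_prod (hG : H12 G) {E F : Set (V n)} (hE : volume E < ⊤) :
    Integrable (Function.uncurry fun x y => G (x - y)) ((volume.restrict E).prod (volume.restrict F)) := by
  have : IsFiniteMeasure (volume.restrict E) := ⟨by rwa [Measure.restrict_apply_univ]⟩
  have hm : StronglyMeasurable (Function.uncurry fun x y => G (x - y)) :=
    (hG.measurable.comp (measurable_fst.sub measurable_snd)).stronglyMeasurable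
  rw [integrable_prod_iff hm.aestronglyMeasurable]
  constructor
  · exact Eventually.of_forall fun x => (G_int hG x).integrableOn
  · refine Integrable.of_bound (C := ∫ x, G x) hm.norm.integral_prod_right.aestronglyMeasurable ?_
    refine Eventually.of_forall fun x => ?_
    simp only [Function.uncurry_apply_pair, Real.norm_of_nonneg (hG.nonneg _)]
    rw [Real.norm_of_nonneg (integral_nonneg fun _ => hG.nonneg _), ← integral_sub_left_eq_self G volume x]
    exact setIntegral_le_integral (G_int hG x) (Eventually.of_forall fun _ => hG.nonneg _)

lemma gE_int (hG : H12 G) {E F : Set (V n)} (hE : volume E < ⊤) : IntegrableOn (gE G F) E :=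
  (G_prod hG hE).integral_prod_left

lemma gE_symm (hG : H12 G) {E F : Set (V n)} (hE : volume E < ⊤) :
    ∫ x in E, gE G F x = ∫ x in F, gE G E x := by
  unfold gE
  rw [integral_integral_swap (G_prod hG hE)]
  refine integral_congr_ae (Eventually.of_forall fun y => ?_)
  refine integral_congr_ae (ae_restrict_of_ae ?_)
  have h1 := G_even hG (LinearIsometryEquiv.neg ℝ)
  have h2 := (quasiMeasurePreserving_sub_left (volume : Measure (V n)) y).ae h1
  filter_upwards [h2] with x hx
  simpa using hx

lemma PerG_eq (hG : H12 G) {E : Set (V n)} (hE : MeasurableSet E) (hEf : volume E < ⊤) :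
    PerG G E = (∫ x, G x) * volume.real E - ∫ x in E, gE G E x := by
  have : ∀ x, ∫ y in Eᶜ, G (x - y) = (∫ x, G x) - gE G E x := by
    intro x
    have := integral_add_compl hE (G_int hG x)
    rw [integral_sub_left_eq_self G volume x] at this
    unfold gE; linarith
  unfold PerG
  simp_rw [this]
  have i1 : IntegrableOn (fun _ : V n => ∫ x, G x) E := integrableOn_const hEf.ne
  rw [integral_sub i1 (gE_int hG hEf)]
  simp [mul_comm]

lemma gE_cont (hG : H12 G) (hn : 0 < n) : Continuous (gE G (ball 0 1)) := by
  have : Nonempty (Fin n) := ⟨⟨0, hn⟩⟩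
  have : Nontrivial (V n) := inferInstance
  have e : gE G (ball 0 1) = fun x => ∫ z, (ball (0:V n) 1).indicator (fun _ => (1:ℝ)) (x - z) * G z := by
    ext x
    unfold gE
    rw [← integral_indicator measurableSet_ball, ← integral_sub_left_eq_self _ volume x]
    congr 1; ext z
    by_cases h : x - z ∈ ball (0 : V n) 1
    · rw [Set.indicator_of_mem h, Set.indicator_of_mem h]; simp
    · rw [Set.indicator_of_notMem h, Set.indicator_of_notMem h]; simp
  rw [e]
  rw [continuous_iff_continuousAt]
  intro x
  refine continuousAt_of_dominated (bound := G) ?_ ?_ hG.integrable ?_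
  · refine Eventually.of_forall fun y => Measurable.aestronglyMeasurable ?_
    exact ((measurable_const.indicator measurableSet_ball).comp (measurable_const.sub measurable_id)).mul hG.measurable
  · refine Eventually.of_forall fun y => Eventually.of_forall fun z => ?_
    rw [norm_mul, Real.norm_of_nonneg (hG.nonneg z)]
    refine mul_le_of_le_one_left (hG.nonneg z) ?_
    by_cases h : y - z ∈ ball (0 : V n) 1
    · rw [Set.indicator_of_mem h]; simp
    · rw [Set.indicator_of_notMem h]; simp
  · have h0 : ∀ᵐ z : V n, z ∉ sphere x 1 :=
      measure_eq_zero_iff_ae_notMem.1 (Measure.addHaar_sphere volume x 1)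
    filter_upwards [h0] with z hz
    refine ContinuousAt.mul ?_ continuousAt_const
    have hz' : ‖x - z‖ ≠ 1 := by
      rw [mem_sphere, dist_comm, dist_eq_norm] at hz; exact hz
    have hc : ContinuousAt (fun y : V n => ‖y - z‖) x := by fun_prop
    rcases lt_or_gt_of_ne hz' with h | h
    · refine continuousAt_const (y := (1:ℝ)).congr ?_
      filter_upwards [hc.eventually (gt_mem_nhds h)] with y hy
      rw [Set.indicator_of_mem (by simpa using hy)]
    · refine continuousAt_const (y := (0:ℝ)).congr ?_
      filter_upwards [hc.eventually (lt_mem_nhds h)] with y hy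
      rw [Set.indicator_of_notMem (by simpa using hy.le)]

lemma gE_radial (hG : H12 G) (x y : V n) (h : ‖x‖ = ‖y‖) : gE G (ball 0 1) x = gE G (ball 0 1) y := by
  obtain ⟨R, hR⟩ := rot_exists x y h
  unfold gE
  rw [← hR]
  refine Eq.trans ?_ (rot_setIntegral R (fun z => G (R x - z)) 1)
  refine integral_congr_ae (ae_restrict_of_ae ?_)
  have h2 := (quasiMeasurePreserving_sub_left (volume : Measure (V n)) x).ae (G_even hG R)
  filter_upwards [h2] with z hz
  rw [← map_sub, hz]

lemma gE_abs_cont (hG : H12 G) {ε : ℝ} (hε : 0 < ε) : ∃ δ > 0, ∀ (D : Set (V n)), MeasurableSet D → volume D < ⊤ →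
    volume.real D < δ → ∀ x, gE G D x ≤ ε := by
  have hfin : ∫⁻ x, ENNReal.ofReal (G x) ≠ ⊤ := by
    have := hG.integrable.hasFiniteIntegral
    rw [hasFiniteIntegral_iff_ofReal (Eventually.of_forall hG.nonneg)] at this
    exact this.ne
  obtain ⟨δ, hδ, h⟩ := exists_pos_setLIntegral_lt_of_measure_lt hfin (ε := ENNReal.ofReal ε) (by simpa using hε)
  refine ⟨(min δ 1).toReal, ENNReal.toReal_pos (by simp [hδ.ne']) (by simp), fun D hDm hDf hD x => ?_⟩
  have hD1 : volume D < δ := by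
    refine lt_of_lt_of_le ?_ (min_le_left δ 1)
    rw [measureReal_def] at hD
    exact (ENNReal.toReal_lt_toReal hDf.ne (by simp)).1 hD
  have hmp : MeasurePreserving (fun z : V n => x - z) volume volume := Measure.measurePreserving_sub_left volume x
  have hm : Measurable (fun y : V n => G (x - y)) := hG.measurable.comp (measurable_const.sub measurable_id)
  have e : ∫⁻ y in D, ENNReal.ofReal (G (x - y)) = ∫⁻ z in (fun z => x - z) ⁻¹' D, ENNReal.ofReal (G z) := by
    rw [← hmp.setLIntegral_comp_preimage hDm hm.ennreal_ofReal]
    simp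
  have hlt := h _ (lt_of_eq_of_lt (hmp.measure_preimage hDm.nullMeasurableSet) hD1)
  unfold gE
  rw [integral_eq_lintegral_of_nonneg_ae (Eventually.of_forall fun _ => hG.nonneg _)
    hm.aestronglyMeasurable, e]
  exact ENNReal.toReal_le_of_le_ofReal hε.le hlt.le

lemma gE_diff (hG : H12 G) {E B : Set (V n)} (hE : MeasurableSet E) (hB : MeasurableSet B) (x : V n) :
    |gE G E x - gE G B x| ≤ gE G (symmDiff E B) x := by
  have iE := (G_int hG x).integrableOn (s := E)
  have iB := (G_int hG x).integrableOn (s := B)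
  have e2 := integral_inter_add_sdiff (μ := volume) hB iE
  have e3 := integral_inter_add_sdiff (μ := volume) hE iB
  rw [Set.inter_comm] at e3
  have hs : gE G (symmDiff E B) x = gE G (E \ B) x + gE G (B \ E) x := by
    unfold gE
    rw [Set.symmDiff_def]
    exact setIntegral_union (Set.disjoint_left.2 fun x hx hx2 => hx.2 hx2.1) (hB.diff hE) (G_int hG x).integrableOn (G_int hG x).integrableOn
  have p1 : 0 ≤ gE G (E \ B) x := integral_nonneg fun _ => hG.nonneg _
  have p2 : 0 ≤ gE G (B \ E) x := integral_nonneg fun _ => hG.nonneg _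
  rw [hs]
  have e4 : gE G E x - gE G B x = gE G (E \ B) x - gE G (B \ E) x := by
    unfold gE; rw [← e2, ← e3]; ring
  rw [e4, abs_le]; constructor <;> linarith

lemma PerG_small (hG : H12 G) (hn : 0 < n) {ε : ℝ} (hε : 0 < ε) : ∃ r0 > 0, ∃ δ > 0, ∀ E : Set (V n), MeasurableSet E →
    volume E = volume (ball (0 : V n) 1) → symmDiff E (ball 0 1) ⊆ shell r0 → volume.real (symmDiff E (ball (0 : V n) 1)) < δ →
    |PerG G E - PerG G (ball 0 1)| ≤ 3 * ε * volume.real (symmDiff E (ball (0 : V n) 1)) := by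
  have : Nonempty (Fin n) := ⟨⟨0, hn⟩⟩
  have : Nontrivial (V n) := inferInstance
  obtain ⟨z0, hz0⟩ := exists_norm_eq (V n) zero_le_one
  obtain ⟨r0, hr0, hr⟩ := near_sphere (gE_cont hG hn) (c := gE G (ball 0 1) z0) (fun x hx => gE_radial hG x z0 (by rw [hx, hz0])) hε
  obtain ⟨δ, hδ, hd⟩ := gE_abs_cont hG hε
  refine ⟨r0, hr0, δ, hδ, fun E hE hv hsub hvol => ?_⟩
  have hBf : volume (ball (0 : V n) 1) < ⊤ := measure_ball_lt_top
  have hEf : volume E < ⊤ := by rwa [hv]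
  have hDf : volume (symmDiff E (ball (0 : V n) 1)) < ⊤ :=
    lt_of_le_of_lt (measure_mono Set.symmDiff_subset_union) (measure_union_lt_top hEf hBf)
  have hDm : MeasurableSet (symmDiff E (ball (0 : V n) 1)) := hE.symmDiff measurableSet_ball
  set B := ball (0 : V n) 1
  have b1 := diff_bound hE measurableSet_ball hBf hv (k := fun x => gE G E x - gE G B x)
    ((gE_int hG hEf).sub (gE_int hG hEf)) ((gE_int hG hBf).sub (gE_int hG hBf)) (c := 0) (ε := ε)
    (fun x _ => by rw [sub_zero]; exact (gE_diff hG hE measurableSet_ball x).trans (hd _ hDm hDf hvol x))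
  have b2 := diff_bound hE measurableSet_ball hBf hv (k := gE G B) (gE_int hG hEf) (gE_int hG hBf)
    (c := gE G B z0) (ε := ε) (fun x hx => hr x (hsub hx))
  rw [PerG_eq hG hE hEf, PerG_eq hG measurableSet_ball hBf, show volume.real E = volume.real B by rw [measureReal_def, hv]; rfl]
  rw [integral_sub (gE_int hG hEf) (gE_int hG hEf), integral_sub (gE_int hG hBf) (gE_int hG hBf), gE_symm hG hBf (F := E)] at b1
  rw [abs_le] at b1 b2 ⊢
  constructor <;> linarith [b1.1, b1.2, b2.1, b2.2]

end GG
end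

section
def zb : ContDiffBump (1:ℝ) := ⟨1/2, 3/4, by norm_num, by norm_num⟩

def psi (s : ℝ) : ℝ := zb s * ((3 - s)/2)

lemma psi_contDiff : ContDiff ℝ 1 psi := by
  unfold psi
  exact zb.contDiff.mul ((contDiff_const.sub contDiff_id).div_const _)

def calib {n : ℕ} (x : V n) : V n := psi (‖x‖^2) • x

lemma calib_contDiff {n : ℕ} : ContDiff ℝ 1 (calib (n := n)) := by
  unfold calib
  exact (psi_contDiff.comp (contDiff_norm_sq ℝ)).smul contDiff_id

lemma calib_cpt {n : ℕ} : HasCompactSupport (calib (n := n)) := by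
  refine HasCompactSupport.intro (isCompact_closedBall (0 : V n) 2) fun x hx => ?_
  simp at hx
  have : zb (‖x‖^2) = 0 := by
    apply zb.zero_of_le_dist
    rw [Real.dist_eq, abs_of_nonneg (by nlinarith)]
    show (3/4:ℝ) ≤ _
    nlinarith
  simp [calib, psi, this]

lemma calib_norm {n : ℕ} (x : V n) : ‖calib x‖ ≤ 1 := by
  unfold calib
  rw [norm_smul, Real.norm_eq_abs]
  by_cases h : (3/4:ℝ) ≤ |‖x‖^2 - 1|
  · have : zb (‖x‖^2) = 0 := by
      apply zb.zero_of_le_dist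
      rw [Real.dist_eq]; exact h
    simp [psi, this]
  · push Not at h
    rw [abs_lt] at h
    unfold psi
    have h1 := zb.nonneg (x := ‖x‖^2)
    have h2 := zb.le_one (x := ‖x‖^2)
    rw [abs_of_nonneg (mul_nonneg h1 (by linarith))]
    have h3 : zb (‖x‖^2) * ((3 - ‖x‖^2)/2) ≤ 1 * ((3 - ‖x‖^2)/2) := mul_le_mul_of_nonneg_right h2 (by linarith)
    have h4 := norm_nonneg x
    calc _ ≤ 1 * ((3 - ‖x‖^2)/2) * ‖x‖ := mul_le_mul_of_nonneg_right h3 h4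
      _ ≤ 1 := by nlinarith [mul_nonneg (sq_nonneg (‖x‖ - 1)) (by linarith : 0 ≤ ‖x‖ + 2)]

lemma calib_vdiv {n : ℕ} (x : V n) : vdiv calib x = n * psi (‖x‖^2) + 2 * ‖x‖^2 * deriv psi (‖x‖^2) := by
  have h1 : HasFDerivAt (fun x : V n => ‖x‖^2) (((2:ℝ) • (innerSL ℝ x : V n →L[ℝ] ℝ))) x := by
    have h := ((hasStrictFDerivAt_norm_sq x).hasFDerivAt)
    rw [← Nat.cast_smul_eq_nsmul ℝ] at h
    simpa using h
  have h2 : HasDerivAt psi (deriv psi (‖x‖^2)) (‖x‖^2) :=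
    (psi_contDiff.differentiable one_ne_zero _).hasDerivAt
  have h3 := (h2.comp_hasFDerivAt x h1).smul (hasFDerivAt_id x)
  have h4 : fderiv ℝ (calib (n := n)) x = _ := h3.fderiv
  unfold vdiv
  rw [h4]
  simp [Finset.sum_add_distrib]
  have : ∀ i, inner ℝ x (EuclideanSpace.single i (1:ℝ)) = x i := by
    intro i; simp [EuclideanSpace.inner_single_right]
  simp only [this]
  rw [EuclideanSpace.norm_sq_eq]
  rw [Finset.mul_sum, Finset.sum_mul]
  try rw [add_right_inj]
  refine Finset.sum_congr rfl fun i _ => ?_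
  simp
  ring

lemma calib_le_per {n : ℕ} (E : Set (V n)) : ENNReal.ofReal (∫ x in E, vdiv calib x) ≤ perimeter E :=
  le_iSup (fun φ : {φ : V n → V n // ContDiff ℝ 1 φ ∧ HasCompactSupport φ ∧ ∀ x, ‖φ x‖ ≤ 1} =>
          ENNReal.ofReal (∫ x in E, vdiv φ.1 x)) ⟨calib, calib_contDiff, calib_cpt, calib_norm⟩

lemma calib_le_P {n : ℕ} {E : Set (V n)} (hE : perimeter E ≠ ⊤) : ∫ x in E, vdiv calib x ≤ P E := by
  unfold P
  exact (le_max_left _ _).trans (by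
    rw [← ENNReal.toReal_ofReal']
    exact ENNReal.toReal_mono hE (calib_le_per E))

lemma P_ball (m : ℕ) : P (ball (0 : V (m+1)) 1) = (m+1) * om (m+1) := by
  have := om_pos (m+1)
  rw [P, perimeter_ball, ENNReal.toReal_ofReal (by positivity)]

lemma calib_ball (m : ℕ) : ∫ x in ball (0 : V (m+1)) 1, vdiv calib x = P (ball (0 : V (m+1)) 1) := by
  apply le_antisymm
  · exact calib_le_P (by rw [perimeter_ball]; simp)
  · rw [P_ball]
    have h1 := w_norm_sq_tendsto (n := m+1)
    push_cast at h1
    refine le_of_tendsto_of_tendsto h1 (chi_tendsto (vdiv_cont calib_contDiff)) ?_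
    filter_upwards [Ioo_mem_nhdsGT (show (0:ℝ) < 1/2 by norm_num)] with ε hε
    rw [ibp hε.1 calib_contDiff]
    have := (calib_contDiff (n := m+1)).continuous
    refine integral_mono (wgt_int hε.1 (by fun_prop)) (wgt_int hε.1 (by fun_prop)) fun x => ?_
    by_cases hx : 1 ≤ ‖x‖^2
    · simp [wgt_zero_out hε.1 hx]
    by_cases hx2 : ‖x‖^2 ≤ 1 - ε
    · simp [wgt_zero_in hε.1 hx2]
    push Not at hx hx2
    refine mul_le_mul_of_nonneg_left ?_ (wgt_nonneg hε.1 _)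
    have h2 := hε.2
    have : zb (‖x‖^2) = 1 := by
      apply zb.one_of_mem_closedBall
      rw [mem_closedBall, Real.dist_eq, abs_of_nonpos (by linarith)]
      show _ ≤ (1/2:ℝ)
      linarith
    rw [calib, inner_smul_right, real_inner_self_eq_norm_sq, psi, this]
    nlinarith

lemma flow_symmDiff {n : ℕ} {X : V n → V n} {Φ : ℝ → V n → V n} {L : ℝ} (h : FlowFacts X Φ L) (t : ℝ) :
    symmDiff (Φ t '' ball 0 1) (ball 0 1) ⊆ shell (L * |t|) := by
  rw [flow_image h]
  intro x hx
  have hd := h.disp (-t) x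
  have h1 := abs_norm_sub_norm_le (Φ (-t) x) x
  rw [abs_neg] at hd
  have h2 := abs_le.1 (h1.trans hd)
  show |‖x‖ - 1| ≤ _
  rw [abs_le]
  rcases hx with ⟨h3, h4⟩ | ⟨h3, h4⟩
  · simp at h3 h4
    constructor <;> linarith
  · simp at h3 h4
    constructor <;> linarith

lemma flow_meas {n : ℕ} {X : V n → V n} {Φ : ℝ → V n → V n} {L : ℝ} (h : FlowFacts X Φ L) (t : ℝ) :
    MeasurableSet (Φ t '' ball 0 1) := by
  rw [flow_image h]
  exact (isOpen_ball.preimage (h.cont (-t))).measurableSet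

/-- A set functional which is `o` of the symmetric difference near the ball has zero derivative. -/
lemma deriv_zero_of_small {n : ℕ} (hn : 0 < n) {X : V n → V n} {Φ : ℝ → V n → V n} (h : IsFlowOf X Φ)
    (hv : PreservesVolume Φ (ball 0 1)) {J : Set (V n) → ℝ} {K : ℝ}
    (hJ : ∀ ε : ℝ, 0 < ε → ∃ r0 > 0, ∃ δ > 0, ∀ E : Set (V n), MeasurableSet E →
    volume E = volume (ball (0 : V n) 1) → symmDiff E (ball 0 1) ⊆ shell r0 → volume.real (symmDiff E (ball (0 : V n) 1)) < δ →
    |J E - J (ball 0 1)| ≤ K * ε * volume.real (symmDiff E (ball (0 : V n) 1))) (hK : 0 < K) :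
    HasDerivAt (fun t => J (Φ t '' ball 0 1)) 0 0 := by
  obtain ⟨L, hL, hF⟩ := flow_facts h
  obtain ⟨C, hC, rs, hrs, hs⟩ := shell_bigO hn
  obtain ⟨δv, hδv, hvol⟩ := hv
  have h0 : Φ 0 '' ball 0 1 = ball 0 1 := by
    rw [show Φ 0 = id from funext h.init]; simp
  rw [hasDerivAt_iff_isLittleO]
  simp only [smul_zero, sub_zero, h0]
  rw [isLittleO_iff]
  intro c hc
  obtain ⟨r0, hr0, δ, hδ, hJ⟩ := hJ (c / (K * (C * L))) (by positivity)
  rw [Metric.eventually_nhds_iff]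
  refine ⟨min (min δv (rs/L)) (min (r0/L) (δ/(C*L))), by positivity, fun t ht => ?_⟩
  rw [Real.dist_eq, sub_zero] at ht
  simp only [lt_min_iff] at ht
  obtain ⟨⟨ht1, ht2⟩, ht3, ht4⟩ := ht
  rw [lt_div_iff₀ (by positivity)] at ht2 ht3 ht4
  have hsub := flow_symmDiff hF t
  have b1 : volume.real (symmDiff (Φ t '' ball 0 1) (ball (0 : V n) 1)) ≤ C * (L * |t|) := by
    refine le_trans (measureReal_mono hsub ?_) (hs (L * |t|) (by positivity) (by linarith))
    refine ne_top_of_le_ne_top (measure_closedBall_lt_top (x := (0:V n)) (r := 1 + L * |t|)).ne (measure_mono ?_)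
    intro x hx
    have : |‖x‖ - 1| ≤ L * |t| := hx
    have := (abs_le.1 this).2
    simp; linarith
  have := hJ _ (flow_meas hF t) (hvol t ht1) (hsub.trans (fun x (hx : |‖x‖ - 1| ≤ L * |t|) => ?_)) (by nlinarith)
  · rw [Real.norm_eq_abs, Real.norm_eq_abs]
    refine this.trans ((mul_le_mul_of_nonneg_left b1 (by positivity)).trans (le_of_eq ?_))
    field_simp
  · show |‖x‖ - 1| ≤ r0
    linarith

lemma calib_small {n : ℕ} (hn : 0 < n) {ε : ℝ} (hε : 0 < ε) : ∃ r0 > 0, ∃ δ > 0, ∀ E : Set (V n), MeasurableSet E →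
    volume E = volume (ball (0 : V n) 1) → symmDiff E (ball 0 1) ⊆ shell r0 → volume.real (symmDiff E (ball (0 : V n) 1)) < δ →
    |(∫ x in E, vdiv calib x) - ∫ x in ball (0 : V n) 1, vdiv calib x| ≤ 1 * ε * volume.real (symmDiff E (ball (0 : V n) 1)) := by
  obtain ⟨r0, hr0, hr⟩ := near_sphere (vdiv_cont (calib_contDiff (n := n))) (c := n * psi 1 + 2 * deriv psi 1)
    (fun x hx => by rw [calib_vdiv, hx]; norm_num) hε
  refine ⟨r0, hr0, 1, one_pos, fun E hE hv hsub _ => ?_⟩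
  have hi : Integrable (vdiv (calib (n := n))) := by
    refine (vdiv_cont (calib_contDiff (n := n))).integrable_of_hasCompactSupport ?_
    have h1 := (calib_cpt (n := n)).fderiv ℝ
    refine h1.mono fun x hx => ?_
    contrapose! hx
    simp at hx
    simp [vdiv, hx]
  rw [one_mul]
  exact diff_bound hE measurableSet_ball measure_ball_lt_top hv hi.integrableOn hi.integrableOn (fun x hx => hr x (hsub hx))

theorem stationary {m : ℕ} {G : V (m+1) → ℝ} {γ l : ℝ} (hG : H12 (Gscale G l)) {X : V (m+1) → V (m+1)} {Φ : ℝ → V (m+1) → V (m+1)} (h : IsFlowOf X Φ)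
    (hv : PreservesVolume Φ (ball 0 1)) : deriv (fun t => Ffun γ G l (Φ t '' ball 0 1)) 0 = 0 := by
  by_cases hd : DifferentiableAt ℝ (fun t => Ffun γ G l (Φ t '' ball 0 1)) 0
  swap
  · exact deriv_zero_of_not_differentiableAt hd
  have h0 : Φ 0 '' ball 0 1 = ball 0 1 := by
    rw [show Φ 0 = id from funext h.init]; simp
  have d1 := deriv_zero_of_small (by omega) h hv (J := PerG (Gscale G l)) (K := 3) (fun ε hε => PerG_small hG (by omega) hε) (by norm_num)
  have d2 := deriv_zero_of_small (by omega) h hv (J := fun E => ∫ x in E, vdiv calib x) (K := 1) (fun ε hε => calib_small (by omega) hε) (by norm_num)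
  have d3 := hd.hasDerivAt
  set d := deriv (fun t => Ffun γ G l (Φ t '' ball 0 1)) 0
  have d4 : HasDerivAt (fun t => P (Φ t '' ball 0 1)) d 0 := by
    have := d3.add (d1.const_mul γ)
    simp only [mul_zero, add_zero] at this
    refine this.congr_of_eventuallyEq (Eventually.of_forall fun t => ?_)
    simp [Ffun]
  have hPpos : 0 < P (ball (0 : V (m+1)) 1) := by
    rw [P_ball]; have := om_pos (m+1); positivity
  have hev : ∀ᶠ t in 𝓝 (0:ℝ), 0 < P (Φ t '' ball 0 1) := by
    refine d4.continuousAt.eventually (lt_mem_nhds ?_)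
    simp only [h0]; exact hPpos
  have hmin : IsLocalMin (fun t => P (Φ t '' ball 0 1) - ∫ x in Φ t '' ball 0 1, vdiv calib x) 0 := by
    filter_upwards [hev] with t ht
    rw [h0, calib_ball, sub_self, sub_nonneg]
    refine calib_le_P fun htop => ?_
    rw [P, htop] at ht
    simp at ht
  have := hmin.hasDerivAt_eq_zero (d4.sub d2)
  linarith
end

section
lemma gE_conv {n : ℕ} {G : V n → ℝ} {E : Set (V n)} (hE : MeasurableSet E) (x : V n) :
    gE G E x = ∫ z, E.indicator (fun _ => (1:ℝ)) (x - z) * G z := by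
  unfold gE
  rw [← integral_indicator hE, ← integral_sub_left_eq_self _ volume x]
  congr 1; ext z
  by_cases h : x - z ∈ E
  · rw [Set.indicator_of_mem h, Set.indicator_of_mem h]; simp
  · rw [Set.indicator_of_notMem h, Set.indicator_of_notMem h]; simp

lemma gE_self {n : ℕ} {G : V n → ℝ} (hG : H12 G) {E : Set (V n)} (hE : MeasurableSet E) (hEf : volume E < ⊤) :
    ∫ x in E, gE G E x = ∫ z, G z * volume.real (E ∩ {x | x - z ∈ E}) := by
  simp_rw [gE_conv hE]
  have hfin : IsFiniteMeasure (volume.restrict E) := ⟨by simpa using hEf⟩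
  rw [integral_integral_swap]
  · refine integral_congr_ae (Eventually.of_forall fun z => ?_)
    simp only
    rw [integral_mul_const, mul_comm]
    congr 1
    have hm : MeasurableSet {x | x - z ∈ E} := hE.preimage (measurable_id.sub measurable_const)
    have : (fun x => E.indicator (fun _ => (1:ℝ)) (x - z)) = {x | x - z ∈ E}.indicator (fun _ => (1:ℝ)) := by
      ext x; rfl
    rw [this, integral_indicator hm]
    simp [Measure.restrict_restrict hm, Set.inter_comm, measureReal_def]
  · have h1 : Integrable (fun p : V n × V n => (1:ℝ) * G p.2) ((volume.restrict E).prod volume) :=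
      Integrable.mul_prod (f := fun _ : V n => (1:ℝ)) (g := G) (integrable_const 1) hG.integrable
    refine h1.mono ?_ (Eventually.of_forall fun p => ?_)
    · refine Measurable.aestronglyMeasurable ?_
      have : Measurable fun p : V n × V n => E.indicator (fun _ => (1:ℝ)) (p.1 - p.2) :=
        (measurable_const.indicator hE).comp (measurable_fst.sub measurable_snd)
      exact this.mul (hG.measurable.comp measurable_snd)
    · simp only [Function.uncurry]
      rw [norm_mul, norm_mul]
      refine mul_le_mul_of_nonneg_right ?_ (norm_nonneg _)
      by_cases h : p.1 - p.2 ∈ E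
      · rw [Set.indicator_of_mem h]
      · rw [Set.indicator_of_notMem h]; simp

lemma PerG_Td {n : ℕ} {G : V n → ℝ} (hG : H12 G) {a : Fin n → ℝ} (ha : ∑ i, a i = 0) (t : ℝ) :
    PerG G (Td a t '' ball 0 1) = (∫ x, G x) * om n - ∫ z, G z * cov (Td a (-t) z) := by
  have hm : MeasurableSet (Td a t '' ball (0 : V n) 1) := (Td_emb a t).measurableSet_image.2 measurableSet_ball
  have hf : volume (Td a t '' ball (0 : V n) 1) < ⊤ := by rw [Td_volume ha]; exact measure_ball_lt_top
  rw [PerG_eq hG hm hf, gE_self hG hm hf]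
  congr 1
  · congr 1
    rw [measureReal_def, Td_volume ha]; rfl
  · congr 1; ext z; congr 1
    unfold cov
    rw [measureReal_def, measureReal_def, Td_image,
      ← (Td_mp ha (-t)).measure_preimage_emb (Td_emb a (-t)) (ball 0 1 ∩ ball (Td a (-t) z) 1)]
    congr 2
    ext x
    simp [dist_eq_norm]

lemma rho_nonneg (m : ℕ) {r : ℝ} (hr : 0 ≤ r) : 0 ≤ rho m r := by
  unfold rho
  exact intervalIntegral.integral_nonneg hr fun u _ => by linarith [Sf_le_one m u]

lemma rho_le (m : ℕ) {r : ℝ} (hr : 0 ≤ r) : rho m r ≤ r := by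
  unfold rho
  have hc : Continuous fun u => 1 - Sf m u := by have := Sf_cont m; fun_prop
  have := intervalIntegral.integral_mono_on (μ := volume) hr (hc.intervalIntegrable _ _) (intervalIntegrable_const (c := (1:ℝ))) (fun u _ => by linarith [Sf_nonneg m u])
  simpa using this

lemma rho_cont (m : ℕ) : Continuous (rho m) :=
  continuous_iff_continuousAt.2 fun r => (rho_deriv m r).continuousAt

lemma hT_le {n : ℕ} {a : Fin n → ℝ} (ha : ∀ i, |a i| ≤ 1) (t : ℝ) (x : V n) : hT a t x ≤ Real.exp |t| * ‖x‖ := by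
  have := Td_norm_le ha (-t) x
  rwa [abs_neg] at this

lemma int_G_le {m : ℕ} (hm : 0 < m) {G : V (m+1) → ℝ} (hG : H12 G) {h : V (m+1) → ℝ} (hc : Measurable h) {C : ℝ}
    (hb : ∀ x, |h x| ≤ C * ‖x‖) : Integrable fun x => G x * h x := by
  refine ((int_norm hm hG).const_mul C).mono (hG.measurable.mul hc).aestronglyMeasurable (Eventually.of_forall fun x => ?_)
  rw [Real.norm_eq_abs, Real.norm_eq_abs, abs_mul, abs_of_nonneg (hG.nonneg x)]
  refine le_trans ?_ (le_abs_self _)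
  have := mul_le_mul_of_nonneg_left (hb x) (hG.nonneg x)
  linarith

/-- The remainder. -/
def Rem {m : ℕ} (G : V (m+1) → ℝ) (a : Fin (m+1) → ℝ) (t : ℝ) : ℝ := ∫ w, G w * rho m (hT a t w)

def Mf {m : ℕ} (a : Fin (m+1) → ℝ) (t : ℝ) : ℝ := ∫ x in ball (0 : V (m+1)) 1, hT a t x

lemma energy {m : ℕ} (hm : 0 < m) {G : V (m+1) → ℝ} {γ l : ℝ} (hG : H12 (Gscale G l)) {a : Fin (m+1) → ℝ}
    (ha : ∑ i, a i = 0) (ha1 : ∀ i, |a i| ≤ 1) : ∃ c : ℝ, ∀ t,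
    Ffun γ G l (Td a t '' ball 0 1) = c + (1 - γ) * (m+2) * Mf a t + γ * om m * Rem (Gscale G l) a t := by
  set K := Gscale G l
  refine ⟨-γ * ((∫ x, K x) * om (m+1)) + γ * (∫ z, K z * cov (0 : V (m+1))), fun t => ?_⟩
  have hc := hT_cont a t
  have b1 : ∀ x, |hT a t x| ≤ Real.exp |t| * ‖x‖ := fun x => by
    rw [abs_of_nonneg (hT_nonneg a t x)]; exact hT_le ha1 t x
  have b2 : ∀ x, |rho m (hT a t x)| ≤ Real.exp |t| * ‖x‖ := fun x => by
    rw [abs_of_nonneg (rho_nonneg m (hT_nonneg a t x))]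
    exact (rho_le m (hT_nonneg a t x)).trans (hT_le ha1 t x)
  have i1 := int_G_le hm hG hc.measurable b1
  have i2 : Integrable fun x => K x * rho m (hT a t x) := int_G_le hm hG ((rho_cont m).comp hc).measurable b2
  have e : ∀ z, K z * cov (Td a (-t) z) = K z * cov (0 : V (m+1)) - om m * (K z * hT a t z) + om m * (K z * rho m (hT a t z)) := by
    intro z
    rw [cov_eq hm]
    unfold hT; ring
  have i0 : Integrable fun z => K z * cov (0 : V (m+1)) := hG.integrable.mul_const _
  unfold Ffun
  rw [P_Td ha, PerG_Td hG ha]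
  simp_rw [e]
  have i3 : Integrable fun z => K z * cov (0 : V (m+1)) - om m * (K z * hT a t z) := i0.sub (i1.const_mul _)
  rw [integral_add i3 (i2.const_mul _), integral_sub i0 (i1.const_mul _), integral_const_mul, integral_const_mul,
    G_homog hm hG (hT a t) (fun r x hr => hT_homog a t r x hr)]
  unfold Mf Rem
  ring
end

section
section hcalc
variable {n : ℕ}

def q0 (a : Fin n → ℝ) (t : ℝ) (x : V n) : ℝ := ∑ i, Real.exp (-2 * a i * t) * x i ^ 2
def q1 (a : Fin n → ℝ) (t : ℝ) (x : V n) : ℝ := ∑ i, Real.exp (-2 * a i * t) * (-2 * a i) * x i ^ 2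
def q2 (a : Fin n → ℝ) (t : ℝ) (x : V n) : ℝ := ∑ i, Real.exp (-2 * a i * t) * (-2 * a i) * (-2 * a i) * x i ^ 2

lemma hT_eq (a : Fin n → ℝ) (t : ℝ) (x : V n) : hT a t x = √(q0 a t x) := by
  unfold hT q0
  rw [EuclideanSpace.norm_eq]
  congr 1
  refine Finset.sum_congr rfl fun i _ => ?_
  rw [Td_apply, Real.norm_eq_abs, sq_abs, mul_pow, ← Real.exp_nat_mul]
  congr 2
  push_cast; ring

lemma q0_nonneg (a : Fin n → ℝ) (t : ℝ) (x : V n) : 0 ≤ q0 a t x :=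
  Finset.sum_nonneg fun i _ => by positivity

lemma q0_sq (a : Fin n → ℝ) (t : ℝ) (x : V n) : q0 a t x = hT a t x ^ 2 := by
  rw [hT_eq, Real.sq_sqrt (q0_nonneg a t x)]

lemma exp_aux (c t : ℝ) : HasDerivAt (fun t => Real.exp (c * t)) (Real.exp (c * t) * c) t := by
  have := ((hasDerivAt_id' t).const_mul c).exp
  simpa using this

lemma q0_deriv (a : Fin n → ℝ) (t : ℝ) (x : V n) : HasDerivAt (fun t => q0 a t x) (q1 a t x) t := by
  unfold q0 q1
  exact HasDerivAt.fun_sum fun i _ => (exp_aux _ t).mul_const _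

lemma q1_deriv (a : Fin n → ℝ) (t : ℝ) (x : V n) : HasDerivAt (fun t => q1 a t x) (q2 a t x) t := by
  unfold q1 q2
  exact HasDerivAt.fun_sum fun i _ => ((exp_aux _ t).mul_const _).mul_const _

lemma q1_le {a : Fin n → ℝ} (ha : ∀ i, |a i| ≤ 1) (t : ℝ) (x : V n) : |q1 a t x| ≤ 2 * q0 a t x := by
  unfold q1 q0
  refine (Finset.abs_sum_le_sum_abs _ _).trans ?_
  rw [Finset.mul_sum]
  refine Finset.sum_le_sum fun i _ => ?_
  rw [abs_mul, abs_mul, abs_mul, abs_of_nonneg (Real.exp_nonneg _), abs_of_nonneg (sq_nonneg (x i))]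
  have h : 0 ≤ Real.exp (-2 * a i * t) * x i ^ 2 := by positivity
  have := mul_le_mul_of_nonneg_left (ha i) h
  rw [abs_neg, abs_two]
  linarith

lemma q2_le {a : Fin n → ℝ} (ha : ∀ i, |a i| ≤ 1) (t : ℝ) (x : V n) : |q2 a t x| ≤ 4 * q0 a t x := by
  unfold q2 q0
  refine (Finset.abs_sum_le_sum_abs _ _).trans ?_
  rw [Finset.mul_sum]
  refine Finset.sum_le_sum fun i _ => ?_
  have h : 0 ≤ Real.exp (-2 * a i * t) * x i ^ 2 := by positivity
  have h2 : a i ^ 2 ≤ 1 := by rw [← sq_abs]; nlinarith [ha i, abs_nonneg (a i)]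
  rw [show Real.exp (-2 * a i * t) * (-2 * a i) * (-2 * a i) * x i ^ 2 = 4 * (a i ^ 2 * (Real.exp (-2 * a i * t) * x i ^ 2)) by ring]
  rw [abs_of_nonneg (by positivity)]
  nlinarith

def h1 (a : Fin n → ℝ) (t : ℝ) (x : V n) : ℝ := q1 a t x / (2 * √(q0 a t x))
def h2 (a : Fin n → ℝ) (t : ℝ) (x : V n) : ℝ :=
  (q2 a t x * (2 * √(q0 a t x)) - q1 a t x * (2 * h1 a t x)) / (2 * √(q0 a t x))^2

lemma q0_pos (a : Fin n → ℝ) (t : ℝ) {x : V n} (hx : x ≠ 0) : 0 < q0 a t x := by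
  rw [q0_sq]
  have : 0 < hT a t x := by
    unfold hT
    rw [norm_pos_iff]
    intro h
    exact hx (Td_inj a (-t) (by rw [h, map_zero]))
  positivity

lemma q_zero (a : Fin n → ℝ) (t : ℝ) : q0 a t 0 = 0 ∧ q1 a t 0 = 0 ∧ q2 a t 0 = 0 := by
  simp [q0, q1, q2]

lemma hT_deriv (a : Fin n → ℝ) (t : ℝ) (x : V n) : HasDerivAt (fun t => hT a t x) (h1 a t x) t := by
  by_cases hx : x = 0
  · subst hx
    have : (fun t => hT a t (0 : V n)) = fun _ => 0 := by ext; simp [hT]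
    rw [this, h1, (q_zero a t).2.1]
    simpa using hasDerivAt_const t (0:ℝ)
  · simp_rw [hT_eq]
    exact (q0_deriv a t x).sqrt (q0_pos a t hx).ne'

lemma h1_deriv (a : Fin n → ℝ) (t : ℝ) (x : V n) : HasDerivAt (fun t => h1 a t x) (h2 a t x) t := by
  by_cases hx : x = 0
  · subst hx
    have : (fun t => h1 a t (0 : V n)) = fun _ => 0 := by ext t; simp [h1, q_zero]
    rw [this, h2, (q_zero a t).2.1, (q_zero a t).2.2]
    simpa using hasDerivAt_const t (0:ℝ)
  · unfold h1
    have h := hT_deriv a t x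
    simp_rw [hT_eq] at h
    have hp := Real.sqrt_pos.2 (q0_pos a t hx)
    exact (q1_deriv a t x).div (h.const_mul 2) (by positivity)

lemma h1_le {a : Fin n → ℝ} (ha : ∀ i, |a i| ≤ 1) (t : ℝ) (x : V n) : |h1 a t x| ≤ hT a t x := by
  by_cases hx : x = 0
  · subst hx; simp [h1, q_zero, hT_eq]
  have h := hT_eq a t x
  have hp := Real.sqrt_pos.2 (q0_pos a t hx)
  rw [h1, ← h, abs_div, abs_of_pos (by rw [h]; positivity : 0 < 2 * hT a t x), div_le_iff₀ (by rw [h]; positivity)]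
  have := q1_le ha t x
  rw [q0_sq] at this
  linarith

lemma h2_le {a : Fin n → ℝ} (ha : ∀ i, |a i| ≤ 1) (t : ℝ) (x : V n) : |h2 a t x| ≤ 3 * hT a t x := by
  by_cases hx : x = 0
  · subst hx; simp [h2, q_zero, hT_eq]
  have h := hT_eq a t x
  have hp := Real.sqrt_pos.2 (q0_pos a t hx)
  rw [← h] at hp
  have e1 := q1_le ha t x
  have e2 := q2_le ha t x
  have e3 := h1_le ha t x
  rw [q0_sq] at e1 e2
  rw [h2, ← h, abs_div, abs_of_pos (by positivity : 0 < (2 * hT a t x)^2), div_le_iff₀ (by positivity)]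
  have f1 : |q2 a t x * (2 * hT a t x)| ≤ 4 * hT a t x ^2 * (2 * hT a t x) := by
    rw [abs_mul, abs_of_pos (by positivity : 0 < 2 * hT a t x)]
    exact mul_le_mul_of_nonneg_right e2 (by positivity)
  have f2 : |q1 a t x * (2 * h1 a t x)| ≤ 2 * hT a t x ^ 2 * (2 * hT a t x) := by
    rw [abs_mul, abs_mul, abs_two]
    exact mul_le_mul e1 (by linarith) (by positivity) (by positivity)
  rw [abs_le] at f1 f2 ⊢
  constructor <;> linarith [f1.1, f1.2, f2.1, f2.2]

lemma exp_one_le : Real.exp 1 ≤ 3 := by linarith [Real.exp_one_lt_d9]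

lemma hT_le3 {a : Fin n → ℝ} (ha : ∀ i, |a i| ≤ 1) {t : ℝ} (ht : |t| ≤ 1) (x : V n) : hT a t x ≤ 3 * ‖x‖ :=
  (hT_le ha t x).trans (mul_le_mul_of_nonneg_right ((Real.exp_le_exp.2 ht).trans exp_one_le) (norm_nonneg x))

lemma hT_ge3 {a : Fin n → ℝ} (ha : ∀ i, |a i| ≤ 1) {t : ℝ} (ht : |t| ≤ 1) (x : V n) : ‖x‖ ≤ 3 * hT a t x := by
  have := Td_norm_le ha t (Td a (-t) x)
  rw [Td_neg_right] at this
  exact this.trans (mul_le_mul_of_nonneg_right ((Real.exp_le_exp.2 ht).trans exp_one_le) (norm_nonneg _))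

lemma hT_zero (a : Fin n → ℝ) (x : V n) : hT a 0 x = ‖x‖ := by simp [hT, Td_zero]

lemma h1_lip {a : Fin n → ℝ} (ha : ∀ i, |a i| ≤ 1) {t : ℝ} (ht : |t| ≤ 1) (x : V n) :
    |h1 a t x - h1 a 0 x| ≤ 9 * ‖x‖ * |t| := by
  have := (convex_Icc (-1:ℝ) 1).norm_image_sub_le_of_norm_hasDerivWithin_le (f := fun t => h1 a t x) (f' := fun t => h2 a t x) (C := 9 * ‖x‖)
    (x := 0) (y := t) (fun s _ => (h1_deriv a s x).hasDerivWithinAt) (fun s hs => ?_) (by simp) (abs_le.1 ht)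
  · simpa using this
  · have h := h2_le ha s x
    have h' := hT_le3 ha (abs_le.2 hs) x
    rw [Real.norm_eq_abs]; linarith

lemma q0_lip {a : Fin n → ℝ} (ha : ∀ i, |a i| ≤ 1) {t : ℝ} (ht : |t| ≤ 1) (x : V n) :
    |q0 a t x - ‖x‖^2| ≤ 18 * ‖x‖^2 * |t| := by
  have := (convex_Icc (-1:ℝ) 1).norm_image_sub_le_of_norm_hasDerivWithin_le (f := fun t => q0 a t x) (f' := fun t => q1 a t x) (C := 18 * ‖x‖^2)
    (x := 0) (y := t) (fun s _ => (q0_deriv a s x).hasDerivWithinAt) (fun s hs => ?_) (by simp) (abs_le.1 ht)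
  · rw [q0_sq a 0, hT_zero] at this
    simpa using this
  · have h := q1_le ha s x
    have h' := hT_le3 ha (abs_le.2 hs) x
    rw [q0_sq] at h
    have h0 := hT_nonneg a s x
    rw [Real.norm_eq_abs]; nlinarith [norm_nonneg x]

end hcalc

lemma sqrt_diff (a b : ℝ) : |√a - √b| * √|b| ≤ |a - b| := by
  rcases le_or_gt 0 b with hb | hb
  · rw [abs_of_nonneg hb]
    rcases le_or_gt 0 a with ha | ha
    · have e : |a - b| = |√a - √b| * (√a + √b) := by
        rw [← abs_of_nonneg (by positivity : 0 ≤ √a + √b), ← abs_mul]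
        congr 1
        have := Real.sq_sqrt ha; have := Real.sq_sqrt hb
        nlinarith
      rw [e]
      exact mul_le_mul_of_nonneg_left (by linarith [Real.sqrt_nonneg a]) (abs_nonneg _)
    · rw [Real.sqrt_eq_zero_of_nonpos ha.le, zero_sub, abs_neg, abs_of_nonneg (Real.sqrt_nonneg _), Real.mul_self_sqrt hb,
        abs_of_nonpos (by linarith)]
      linarith
  · rw [Real.sqrt_eq_zero_of_nonpos hb.le, sub_zero, abs_of_nonneg (Real.sqrt_nonneg _)]
    rcases le_or_gt 0 a with ha | ha
    · rw [abs_of_neg hb, abs_of_nonneg (by linarith)]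
      have h1 := Real.sq_sqrt ha; have h2 := Real.sq_sqrt (neg_nonneg.2 hb.le)
      nlinarith [sq_nonneg (√a - √(-b)), Real.sqrt_nonneg a, Real.sqrt_nonneg (-b)]
    · rw [Real.sqrt_eq_zero_of_nonpos ha.le, zero_mul]; exact abs_nonneg _

lemma sqrt_sq_diff (a b : ℝ) : |√a^2 - √b^2| ≤ |a - b| := by
  have e : ∀ a : ℝ, √a^2 = max a 0 := by
    intro a
    rcases le_total 0 a with h | h
    · rw [Real.sq_sqrt h, max_eq_left h]
    · rw [Real.sqrt_eq_zero_of_nonpos h, max_eq_right h]; simp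
  rw [e, e]
  exact abs_max_sub_max_le_abs a b 0

lemma pow_diff1 {x y : ℝ} (hx : 0 ≤ x) (hx1 : x ≤ 1) (hy : 0 ≤ y) (hy1 : y ≤ 1) (m : ℕ) : |x^m - y^m| ≤ m * |x - y| := by
  induction m with
  | zero => simp
  | succ m ih =>
    have e : x^(m+1) - y^(m+1) = x * (x^m - y^m) + y^m * (x - y) := by ring
    rw [e]
    refine (abs_add_le _ _).trans ?_
    rw [abs_mul, abs_mul, abs_of_nonneg hx, abs_of_nonneg (pow_nonneg hy m)]
    have h1 := mul_le_mul_of_nonneg_right hx1 (abs_nonneg (x^m - y^m))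
    have h2 := mul_le_mul_of_nonneg_right (pow_le_one₀ hy hy1 (n := m)) (abs_nonneg (x - y))
    push_cast; linarith

lemma pow_diff2 {x y : ℝ} (hx : 0 ≤ x) (hx1 : x ≤ 1) (hy : 0 ≤ y) (hy1 : y ≤ 1) {m : ℕ} (hm : 2 ≤ m) :
    |x^m - y^m| ≤ m * |x^2 - y^2| := by
  induction m, hm using Nat.le_induction with
  | base => push_cast; linarith [abs_nonneg (x^2 - y^2)]
  | succ m hm ih =>
    have e : x^(m+1) - y^(m+1) = x * (x^m - y^m) + y^m * (x - y) := by ring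
    rw [e]
    refine (abs_add_le _ _).trans ?_
    rw [abs_mul, abs_mul, abs_of_nonneg hx, abs_of_nonneg (pow_nonneg hy m)]
    have h1 := mul_le_mul_of_nonneg_right hx1 (abs_nonneg (x^m - y^m))
    have h3 : y^m ≤ x + y := (pow_le_of_le_one hy hy1 (by omega)).trans (by linarith)
    have h2 := mul_le_mul_of_nonneg_right h3 (abs_nonneg (x - y))
    have h4 : (x + y) * |x - y| = |x^2 - y^2| := by
      rw [← abs_of_nonneg (by positivity : 0 ≤ x + y), ← abs_mul]
      congr 1; ring
    push_cast; linarith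

def kap (m : ℕ) (r : ℝ) : ℝ := if m = 1 then (√|1 - r^2/4|)⁻¹ else 1

lemma Sf_diff {m : ℕ} (hm : 0 < m) {u r : ℝ} (hr : 0 ≤ r) (hr2 : r ≠ 2) : |Sf m u - Sf m r| ≤ m * kap m r * (|u^2 - r^2|/4) := by
  have e : |u^2 - r^2|/4 = |(1 - u^2/4) - (1 - r^2/4)| := by
    rw [show (1 - u^2/4) - (1 - r^2/4) = -((u^2 - r^2)/4) by ring, abs_neg, abs_div]; norm_num
  rw [e]
  unfold Sf kap
  split_ifs with h
  · subst h
    have hne : 1 - r^2/4 ≠ 0 := by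
      intro h
      apply hr2
      nlinarith
    have hp : 0 < √|1 - r^2/4| := Real.sqrt_pos.2 (abs_pos.2 hne)
    have := sqrt_diff (1 - u^2/4) (1 - r^2/4)
    simp only [pow_one, Nat.cast_one, one_mul]
    rw [inv_mul_eq_div, le_div_iff₀ hp]
    exact this
  · rw [mul_one]
    refine (pow_diff2 (Real.sqrt_nonneg _) (sqrt_le_one' u) (Real.sqrt_nonneg _) (sqrt_le_one' r) (by omega : 2 ≤ m)).trans ?_
    exact mul_le_mul_of_nonneg_left (sqrt_sq_diff _ _) (by positivity)

lemma one_sub_Sf {m : ℕ} (hm : 0 < m) (u : ℝ) : 1 - Sf m u ≤ m * min (u^2) 1 := by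
  have hm1 : (1:ℝ) ≤ m := by exact_mod_cast hm
  rw [mul_min_of_nonneg _ _ (by positivity), le_min_iff]
  constructor
  · have h1 := pow_diff1 zero_le_one le_rfl (Real.sqrt_nonneg (1 - u^2/4)) (sqrt_le_one' u) m
    rw [one_pow] at h1
    have h2 := (le_abs_self _).trans h1
    rw [abs_of_nonneg (by linarith [sqrt_le_one' u])] at h2
    refine h2.trans (mul_le_mul_of_nonneg_left ?_ (by positivity))
    have h3 : 1 - u^2/4 ≤ √(1 - u^2/4) := by
      rcases le_total 0 (1 - u^2/4) with h | h
      · have := Real.sq_sqrt h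
        nlinarith [sqrt_le_one' u, Real.sqrt_nonneg (1 - u^2/4)]
      · exact h.trans (Real.sqrt_nonneg _)
    nlinarith [sq_nonneg u]
  · have := Sf_nonneg m u
    linarith

def bet (m : ℕ) (r : ℝ) : ℝ := r * min (r^2) 1 + if m = 1 ∧ 1 ≤ r ∧ r ≤ 6 then (√|1 - r^2/4|)⁻¹ else 0

lemma kap_nonneg (m : ℕ) (r : ℝ) : 0 ≤ kap m r := by
  unfold kap; split_ifs <;> positivity

lemma kap_bet {m : ℕ} (hm : 0 < m) {r : ℝ} (hr : 0 ≤ r) (hr6 : r < 6) : kap m r * r^3 ≤ 216 * bet m r := by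
  unfold bet kap
  have h0 : 0 ≤ (√|1 - r^2/4|)⁻¹ := by positivity
  rcases lt_or_ge r 1 with h1 | h1
  · have : min (r^2) 1 = r^2 := min_eq_left (by nlinarith)
    rw [this, if_neg (c := m = 1 ∧ 1 ≤ r ∧ r ≤ 6) (by rintro ⟨-, h, -⟩; linarith)]
    have h3 : 0 ≤ r^3 := by positivity
    split_ifs
    · have : (√|1 - r^2/4|)⁻¹ ≤ 2 := by
        rw [inv_le_comm₀ (Real.sqrt_pos.2 (abs_pos.2 (by nlinarith))) (by norm_num)]
        apply Real.le_sqrt_of_sq_le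
        refine le_trans ?_ (le_abs_self _)
        nlinarith
      nlinarith
    · nlinarith
  · have : min (r^2) 1 = 1 := min_eq_right (by nlinarith)
    rw [this]
    have h3 : r^3 ≤ 216 := by
      calc r^3 ≤ 6^3 := by gcongr
        _ = 216 := by norm_num
    split_ifs with h4 h5 h5
    · nlinarith
    · exact absurd ⟨h4, h1, hr6.le⟩ h5
    · exact absurd h5.1 h4
    · nlinarith

lemma bet_ge (m : ℕ) {r : ℝ} : r * min (r^2) 1 ≤ bet m r := by
  unfold bet
  split_ifs
  · have h0 : 0 ≤ (√|1 - r^2/4|)⁻¹ := by positivity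
    linarith
  · linarith

/-- The first time derivative of `rho (hT)`. -/
def Df {m : ℕ} (a : Fin (m+1) → ℝ) (t : ℝ) (w : V (m+1)) : ℝ := (1 - Sf m (hT a t w)) * h1 a t w

lemma Df_deriv {m : ℕ} (a : Fin (m+1) → ℝ) (t : ℝ) (w : V (m+1)) :
    HasDerivAt (fun t => rho m (hT a t w)) (Df a t w) t :=
  (rho_deriv m _).comp t (hT_deriv a t w)

lemma Df_le {m : ℕ} {a : Fin (m+1) → ℝ} (ha : ∀ i, |a i| ≤ 1) {t : ℝ} (ht : |t| ≤ 1) (w : V (m+1)) : |Df a t w| ≤ 3 * ‖w‖ := by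
  unfold Df
  rw [abs_mul]
  have e1 : |1 - Sf m (hT a t w)| ≤ 1 := by
    rw [abs_le]; constructor <;> linarith [Sf_nonneg m (hT a t w), Sf_le_one m (hT a t w)]
  have e2 := (h1_le ha t w).trans (hT_le3 ha ht w)
  have := mul_le_mul e1 e2 (abs_nonneg _) zero_le_one
  linarith

lemma Df_lip {m : ℕ} (hm : 0 < m) {a : Fin (m+1) → ℝ} (ha : ∀ i, |a i| ≤ 1) {t : ℝ} (ht : |t| ≤ 1) {w : V (m+1)} (hw : ‖w‖ ≠ 2) :
    |Df a t w - Df a 0 w| ≤ (20000 * m * bet m ‖w‖) * |t| := by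
  have hm1 : (1:ℝ) ≤ m := by exact_mod_cast hm
  have e1 := one_sub_Sf hm ‖w‖
  have e2 := h1_lip ha ht w
  have e3 := (h1_le ha 0 w)
  rw [hT_zero] at e3
  have hr := norm_nonneg w
  set r := ‖w‖
  have e4 : |Sf m (hT a t w) - Sf m r| ≤ m * kap m r * (5 * r^2 * |t|) := by
    refine (Sf_diff hm hr hw).trans ?_
    refine mul_le_mul_of_nonneg_left ?_ (mul_nonneg (by positivity) (kap_nonneg m r))
    rw [← q0_sq]
    have := q0_lip ha ht w
    have : 0 ≤ r^2 * |t| := by positivity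
    linarith
  have e6 : 6 ≤ r → Sf m (hT a t w) - Sf m r = 0 := by
    intro h6
    have h7 := hT_ge3 ha ht w
    change r ≤ _ at h7
    rw [Sf_big hm (by linarith : 2 ≤ hT a t w), Sf_big hm (by linarith : 2 ≤ r), sub_zero]
  have e5 : |Sf m (hT a t w) - Sf m r| * r ≤ 5 * m * (216 * bet m r) * |t| := by
    rcases lt_or_ge r 6 with h6 | h6
    · have := mul_le_mul_of_nonneg_right e4 hr
      have h7 := mul_le_mul_of_nonneg_left (kap_bet hm hr h6) (by positivity : 0 ≤ 5 * m * |t|)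
      linarith
    · rw [e6 h6]
      have := (bet_ge m (r := r))
      have h8 : 0 ≤ r * min (r^2) 1 := by positivity
      have h9 : 0 ≤ bet m r := h8.trans this
      simp only [abs_zero, zero_mul]
      positivity
  have e : Df a t w - Df a 0 w = (1 - Sf m r) * (h1 a t w - h1 a 0 w) - (Sf m (hT a t w) - Sf m r) * h1 a t w := by
    unfold Df
    rw [hT_zero]; change (_ - (1 - Sf m r) * _ = _); ring
  rw [e]
  have f1 : |(1 - Sf m r) * (h1 a t w - h1 a 0 w)| ≤ (m * min (r^2) 1) * (9 * r * |t|) := by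
    rw [abs_mul, abs_of_nonneg (by linarith [Sf_le_one m r])]
    exact mul_le_mul e1 e2 (abs_nonneg _) (by positivity)
  have f2 : |(Sf m (hT a t w) - Sf m r) * h1 a t w| ≤ |Sf m (hT a t w) - Sf m r| * (3 * r) := by
    rw [abs_mul]
    exact mul_le_mul_of_nonneg_left ((h1_le ha t w).trans (hT_le3 ha ht w)) (abs_nonneg _)
  have f3 : (m * min (r^2) 1) * (9 * r * |t|) ≤ 9 * m * |t| * bet m r := by
    have := mul_le_mul_of_nonneg_left (bet_ge m (r := r)) (by positivity : 0 ≤ 9 * m * |t|)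
    linarith
  have f4 : 0 ≤ m * |t| * bet m r := by
    have h8 : 0 ≤ r * min (r^2) 1 := by positivity
    have := h8.trans (bet_ge m (r := r))
    positivity
  refine (abs_sub _ _).trans ?_
  linarith

lemma Df_diff {m : ℕ} (a : Fin (m+1) → ℝ) {w : V (m+1)} (hw : ‖w‖ ≠ 2) :
    DifferentiableAt ℝ (fun t => Df a t w) 0 := by
  unfold Df
  refine DifferentiableAt.mul ?_ (h1_deriv a 0 w).differentiableAt
  refine DifferentiableAt.const_sub ?_ _
  unfold Sf
  refine DifferentiableAt.pow ?_ _
  refine DifferentiableAt.sqrt ?_ ?_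
  · have := (hT_deriv a 0 w).differentiableAt
    fun_prop
  · rw [hT_zero]
    intro h
    apply hw
    nlinarith [norm_nonneg w]
end

section
lemma deriv0_lip {α : Type*} [MeasurableSpace α] {μ : Measure α} {F : ℝ → α → ℝ} {b : α → ℝ}
    (hF : ∀ t, |t| < 1 → Integrable (F t) μ) (hb : Integrable b μ)
    (hl : ∀ᵐ w ∂μ, ∀ t, |t| < 1 → |F t w - F 0 w| ≤ b w * |t|)
    (hd : ∀ᵐ w ∂μ, DifferentiableAt ℝ (fun t => F t w) 0) :
    HasDerivAt (fun t => ∫ w, F t w ∂μ) (∫ w, deriv (fun t => F t w) 0 ∂μ) 0 ∧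
      |∫ w, deriv (fun t => F t w) 0 ∂μ| ≤ ∫ w, b w ∂μ := by
  have hev : ∀ᶠ t in 𝓝[≠] (0:ℝ), |t| < 1 ∧ t ≠ 0 := by
    refine Filter.Eventually.and (nhdsWithin_le_nhds ?_) self_mem_nhdsWithin
    have := ball_mem_nhds (0:ℝ) one_pos
    filter_upwards [this] with t ht
    simpa using ht
  have hbd : ∀ᵐ w ∂μ, ∀ t, |t| < 1 → t ≠ 0 → |t⁻¹ * (F t w - F 0 w)| ≤ b w := by
    filter_upwards [hl] with w hw t ht ht0
    rw [abs_mul, abs_inv, inv_mul_le_iff₀ (abs_pos.2 ht0)]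
    linarith [hw t ht]
  have hlim : ∀ᵐ w ∂μ, Tendsto (fun t => t⁻¹ * (F t w - F 0 w)) (𝓝[≠] 0) (𝓝 (deriv (fun t => F t w) 0)) := by
    filter_upwards [hd] with w hw
    have := hasDerivAt_iff_tendsto_slope.1 hw.hasDerivAt
    refine this.congr fun t => ?_
    rw [slope_def_field, sub_zero, div_eq_inv_mul]
  constructor
  · rw [hasDerivAt_iff_tendsto_slope]
    have : Tendsto (fun t => ∫ w, t⁻¹ * (F t w - F 0 w) ∂μ) (𝓝[≠] 0) (𝓝 (∫ w, deriv (fun t => F t w) 0 ∂μ)) := by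
      refine tendsto_integral_filter_of_dominated_convergence b ?_ ?_ hb hlim
      · filter_upwards [hev] with t ht
        exact (((hF t ht.1).sub (hF 0 (by simp))).const_mul _).aestronglyMeasurable
      · filter_upwards [hev] with t ht
        filter_upwards [hbd] with w hw
        exact hw t ht.1 ht.2
    refine this.congr' ?_
    filter_upwards [hev] with t ht
    rw [slope_def_field, sub_zero, div_eq_inv_mul, integral_const_mul, integral_sub (hF t ht.1) (hF 0 (by simp))]
  · rw [← Real.norm_eq_abs]
    refine norm_integral_le_of_norm_le hb ?_
    filter_upwards [hbd, hlim] with w h1 h2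
    refine le_of_tendsto h2.norm ?_
    filter_upwards [hev] with t ht
    exact h1 t ht.1 ht.2

section meas
variable {n : ℕ}
lemma q0_contx (a : Fin n → ℝ) (t : ℝ) : Continuous (q0 a t) := by unfold q0; fun_prop
lemma q1_contx (a : Fin n → ℝ) (t : ℝ) : Continuous (q1 a t) := by unfold q1; fun_prop
lemma q2_contx (a : Fin n → ℝ) (t : ℝ) : Continuous (q2 a t) := by unfold q2; fun_prop
lemma h1_meas (a : Fin n → ℝ) (t : ℝ) : Measurable (h1 a t) := by
  have := (q0_contx a t).measurable
  have := (q1_contx a t).measurable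
  unfold h1; fun_prop
lemma h2_meas (a : Fin n → ℝ) (t : ℝ) : Measurable (h2 a t) := by
  have := (q0_contx a t).measurable
  have := (q1_contx a t).measurable
  have := (q2_contx a t).measurable
  have := h1_meas a t
  unfold h2; fun_prop
end meas

lemma Df_meas {m : ℕ} (a : Fin (m+1) → ℝ) (t : ℝ) : Measurable (Df a t) := by
  have := h1_meas a t
  have : Measurable fun w => Sf m (hT a t w) := ((Sf_cont m).comp (hT_cont a t)).measurable
  unfold Df; fun_prop

lemma Rem_deriv {m : ℕ} (hm : 0 < m) {G : V (m+1) → ℝ} (hG : H12 G) {a : Fin (m+1) → ℝ} (ha : ∀ i, |a i| ≤ 1) {t : ℝ} (ht : |t| < 1) :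
    HasDerivAt (Rem G a) (∫ w, G w * Df a t w) t := by
  have hs : Set.Ioo (-1:ℝ) 1 ∈ 𝓝 t := Ioo_mem_nhds (abs_lt.1 ht).1 (abs_lt.1 ht).2
  have hm2 : ∀ t, Measurable fun w => rho m (hT a t w) := fun t => ((rho_cont m).comp (hT_cont a t)).measurable
  refine (hasDerivAt_integral_of_dominated_loc_of_deriv_le (F := fun t w => G w * rho m (hT a t w)) (F' := fun t w => G w * Df a t w)
    (bound := fun w => 3 * (‖w‖ * G w)) hs ?_ ?_ ?_ ?_ ?_ ?_).2
  · exact Eventually.of_forall fun t => (hG.measurable.mul (hm2 t)).aestronglyMeasurable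
  · refine int_G_le hm hG (hm2 t) (C := 3) fun x => ?_
    rw [abs_of_nonneg (rho_nonneg m (hT_nonneg a t x))]
    exact (rho_le m (hT_nonneg a t x)).trans (hT_le3 ha ht.le x)
  · exact (hG.measurable.mul (Df_meas a t)).aestronglyMeasurable
  · refine Eventually.of_forall fun w s hs => ?_
    rw [norm_mul, Real.norm_of_nonneg (hG.nonneg w), Real.norm_eq_abs]
    have := mul_le_mul_of_nonneg_left (Df_le ha (abs_le.2 ⟨hs.1.le, hs.2.le⟩) w) (hG.nonneg w)
    linarith
  · exact (int_norm hm hG).const_mul 3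
  · exact Eventually.of_forall fun w s hs => (Df_deriv a s w).const_mul (G w)

lemma Rem_deriv2 {m : ℕ} (hm : 0 < m) {G : V (m+1) → ℝ} (hG : H12 G) {a : Fin (m+1) → ℝ} (ha : ∀ i, |a i| ≤ 1)
    (hb : Integrable fun w => G w * bet m ‖w‖) : ∃ d, HasDerivAt (fun t => ∫ w, G w * Df a t w) d 0 ∧
      |d| ≤ 20000 * m * ∫ w, G w * bet m ‖w‖ := by
  have h2 : ∀ᵐ w : V (m+1), ‖w‖ ≠ 2 := by
    have h0 : ∀ᵐ z : V (m+1), z ∉ sphere (0 : V (m+1)) 2 :=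
      measure_eq_zero_iff_ae_notMem.1 (Measure.addHaar_sphere volume 0 2)
    filter_upwards [h0] with z hz
    simpa using hz
  have := deriv0_lip (μ := volume) (F := fun t w => G w * Df a t w) (b := fun w => 20000 * m * (G w * bet m ‖w‖))
    (fun t ht => int_G_le hm hG (Df_meas a t) (C := 3) (fun x => Df_le ha ht.le x)) (hb.const_mul _) ?_ ?_
  · refine ⟨_, this.1, ?_⟩
    rw [← integral_const_mul]
    exact this.2
  · filter_upwards [h2] with w hw t ht
    rw [← mul_sub, abs_mul, abs_of_nonneg (hG.nonneg w)]
    have := mul_le_mul_of_nonneg_left (Df_lip hm ha ht.le hw) (hG.nonneg w)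
    linarith
  · filter_upwards [h2] with w hw
    exact (Df_diff a hw).const_mul (G w)

lemma ball_int {n : ℕ} {f : V n → ℝ} (hf : Measurable f) {C : ℝ} (h : ∀ x, |f x| ≤ C * ‖x‖) : IntegrableOn f (ball 0 1) := by
  have : IntegrableOn (fun x : V n => C * ‖x‖) (ball 0 1) :=
    ((by fun_prop : Continuous fun x : V n => C * ‖x‖).continuousOn.integrableOn_compact (isCompact_closedBall 0 1)).mono_set ball_subset_closedBall
  refine Integrable.mono this hf.aestronglyMeasurable (Eventually.of_forall fun x => ?_)
  rw [Real.norm_eq_abs]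
  exact (h x).trans (le_abs_self _)

lemma Mf_deriv {m : ℕ} {a : Fin (m+1) → ℝ} (ha : ∀ i, |a i| ≤ 1) {t : ℝ} (ht : |t| < 1) :
    HasDerivAt (Mf a) (∫ x in ball (0 : V (m+1)) 1, h1 a t x) t := by
  have hs : Set.Ioo (-1:ℝ) 1 ∈ 𝓝 t := Ioo_mem_nhds (abs_lt.1 ht).1 (abs_lt.1 ht).2
  refine (hasDerivAt_integral_of_dominated_loc_of_deriv_le (F := fun t w => hT a t w) (F' := fun t w => h1 a t w)
    (bound := fun w => 3 * ‖w‖) hs ?_ ?_ ?_ ?_ ?_ ?_).2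
  · exact Eventually.of_forall fun t => (hT_cont a t).aestronglyMeasurable
  · exact ball_int (hT_cont a t).measurable (C := 3) fun x => by
      rw [abs_of_nonneg (hT_nonneg a t x)]; exact hT_le3 ha ht.le x
  · exact (h1_meas a t).aestronglyMeasurable
  · exact Eventually.of_forall fun w s hs => (h1_le ha s w).trans (hT_le3 ha (abs_le.2 ⟨hs.1.le, hs.2.le⟩) w)
  · exact ball_int (by fun_prop) (C := 3) fun x => by rw [abs_of_nonneg (by positivity)]
  · exact Eventually.of_forall fun w s hs => hT_deriv a s w

lemma Mf_deriv2 {m : ℕ} {a : Fin (m+1) → ℝ} (ha : ∀ i, |a i| ≤ 1) :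
    HasDerivAt (fun t => ∫ x in ball (0 : V (m+1)) 1, h1 a t x) (∫ x in ball (0 : V (m+1)) 1, h2 a 0 x) 0 := by
  have := (deriv0_lip (μ := volume.restrict (ball (0 : V (m+1)) 1)) (F := fun t w => h1 a t w) (b := fun w => 9 * ‖w‖)
    (fun t ht => ball_int (h1_meas a t) (C := 3) fun x => (h1_le ha t x).trans (hT_le3 ha ht.le x))
    (ball_int (by fun_prop) (C := 9) fun x => by rw [abs_of_nonneg (by positivity)])
    (Eventually.of_forall fun w t ht => h1_lip ha ht.le w) (Eventually.of_forall fun w => (h1_deriv a 0 w).differentiableAt)).1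
  have e : ∀ w, deriv (fun t => h1 a t w) 0 = h2 a 0 w := fun w => (h1_deriv a 0 w).deriv
  simp_rw [e] at this
  exact this

lemma h2_ge {n : ℕ} (a : Fin n → ℝ) {x : V n} (hx : ‖x‖ < 1) : q2 a 0 x / 4 ≤ h2 a 0 x := by
  by_cases h0 : x = 0
  · subst h0; simp [h2, q_zero]
  have hr : 0 < ‖x‖ := norm_pos_iff.2 h0
  have e0 : √(q0 a 0 x) = ‖x‖ := by rw [← hT_eq, hT_zero]
  have eq0 : ‖x‖^2 = ∑ i, x i ^ 2 := by
    rw [EuclideanSpace.norm_sq_eq]; simp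
  have hq2 : 0 ≤ q2 a 0 x := by
    unfold q2
    refine Finset.sum_nonneg fun i _ => ?_
    rw [mul_assoc (Real.exp _)]
    exact mul_nonneg (mul_nonneg (Real.exp_nonneg _) (mul_self_nonneg _)) (sq_nonneg _)
  have cs : q1 a 0 x ^ 2 ≤ q2 a 0 x * ‖x‖^2 := by
    have := Finset.sum_mul_sq_le_sq_mul_sq Finset.univ (fun i => -2 * a i * x i) (fun i => x i)
    rw [eq0]
    unfold q1 q2
    simp only [mul_zero, Real.exp_zero, one_mul]
    refine le_of_eq_of_le ?_ (this.trans (le_of_eq ?_))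
    · congr 1; refine Finset.sum_congr rfl fun i _ => ?_
      ring
    · congr 1; refine Finset.sum_congr rfl fun i _ => ?_
      ring
  unfold h2 h1
  rw [e0]
  have : (q2 a 0 x * (2 * ‖x‖) - q1 a 0 x * (2 * (q1 a 0 x / (2 * ‖x‖)))) / (2 * ‖x‖)^2 =
    (2 * (q2 a 0 x * ‖x‖^2) - q1 a 0 x ^ 2) / (4 * ‖x‖^3) := by
    field_simp
    ring
  rw [this, div_le_div_iff₀ (by norm_num) (by positivity)]
  have h3 : ‖x‖^3 ≤ ‖x‖^2 := by
    rw [pow_succ]; nlinarith [sq_nonneg ‖x‖]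
  have := mul_le_mul_of_nonneg_left h3 hq2
  linarith

lemma Mf2_pos {m : ℕ} {a : Fin (m+1) → ℝ} (ha : ∀ i, |a i| ≤ 1) (ha0 : a 0 ≠ 0) : 0 < ∫ x in ball (0 : V (m+1)) 1, h2 a 0 x := by
  have hi : IntegrableOn (h2 a 0) (ball (0 : V (m+1)) 1) := ball_int (h2_meas a 0) (C := 3) fun x => by
    have := h2_le ha 0 x; rwa [hT_zero] at this
  have hq := q2_contx a 0
  have hiq : IntegrableOn (fun x => q2 a 0 x / 4) (ball (0 : V (m+1)) 1) :=
    ((by fun_prop : Continuous fun x : V (m+1) => q2 a 0 x / 4).continuousOn.integrableOn_compact (isCompact_closedBall 0 1)).mono_set ball_subset_closedBall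
  have hq2 : ∀ x, 0 ≤ q2 a 0 x := by
    intro x
    unfold q2
    refine Finset.sum_nonneg fun i _ => ?_
    rw [mul_assoc (Real.exp _)]
    exact mul_nonneg (mul_nonneg (Real.exp_nonneg _) (mul_self_nonneg _)) (sq_nonneg _)
  refine lt_of_lt_of_le ?_ (setIntegral_mono_on hiq hi measurableSet_ball fun x hx => h2_ge a (by simpa using hx))
  rw [setIntegral_pos_iff_support_of_nonneg_ae (Eventually.of_forall fun x => by have := hq2 x; simp only [Pi.zero_apply]; positivity) hiq]
  refine IsOpen.measure_pos _ (IsOpen.inter ?_ isOpen_ball) ?_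
  · exact (isOpen_compl_singleton (x := (0:ℝ))).preimage (by fun_prop : Continuous fun x : V (m+1) => q2 a 0 x / 4)
  · refine ⟨EuclideanSpace.single 0 (1/2), ?_, by simp; norm_num⟩
    simp only [Function.mem_support]
    simp [q2, ha0]
end

section
def kone (r : ℝ) : ℝ := if 1 ≤ r ∧ r ≤ 6 then (√|1 - r^2/4|)⁻¹ else 0

lemma kone_nonneg (r : ℝ) : 0 ≤ kone r := by
  unfold kone; split_ifs <;> positivity

lemma kone_meas : Measurable kone := by
  unfold kone
  refine Measurable.ite ?_ (by fun_prop) measurable_const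
  exact measurableSet_Icc (a := (1:ℝ)) (b := 6)

lemma kone_int1 : IntegrableOn (fun y : ℝ => y / √|1 - y^2/4|) (Set.Ioc 1 2) := by
  refine intervalIntegral.integrableOn_deriv_of_nonneg (g := fun y => -4 * √(1 - y^2/4)) (by fun_prop) ?_ ?_
  · intro y hy
    have h0 : 0 < 1 - y^2/4 := by nlinarith [hy.1, hy.2]
    have h1 : HasDerivAt (fun y : ℝ => 1 - y^2/4) (-(y/2)) y := by
      have := ((hasDerivAt_pow 2 y).div_const 4).const_sub 1
      refine this.congr_deriv ?_
      norm_num; ring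
    have h2 := (h1.sqrt h0.ne').const_mul (-4)
    refine h2.congr_deriv ?_
    rw [abs_of_pos h0]
    have : √(1 - y^2/4) ≠ 0 := (Real.sqrt_pos.2 h0).ne'
    field_simp
    ring
  · intro y hy
    have := hy.1
    positivity

lemma kone_int2 : IntegrableOn (fun y : ℝ => y / √|1 - y^2/4|) (Set.Ioc 2 6) := by
  refine intervalIntegral.integrableOn_deriv_of_nonneg (g := fun y => 4 * √(y^2/4 - 1)) (by fun_prop) ?_ ?_
  · intro y hy
    have h0 : 0 < y^2/4 - 1 := by nlinarith [hy.1, hy.2]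
    have h1 : HasDerivAt (fun y : ℝ => y^2/4 - 1) (y/2) y := by
      have := ((hasDerivAt_pow 2 y).div_const 4).sub_const 1
      refine this.congr_deriv ?_
      norm_num; ring
    have h2 := (h1.sqrt h0.ne').const_mul 4
    refine h2.congr_deriv ?_
    rw [abs_sub_comm, abs_of_pos h0]
    have : √(y^2/4 - 1) ≠ 0 := (Real.sqrt_pos.2 h0).ne'
    field_simp
    ring
  · intro y hy
    have := hy.1
    positivity

lemma kone_integrable : Integrable (fun w : V (1+1) => kone ‖w‖) := by
  rw [integrable_fun_norm_addHaar (volume : Measure (V (1+1))) (f := kone)]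
  have h := (kone_int1.union kone_int2)
  rw [Set.Ioc_union_Ioc_eq_Ioc (by norm_num) (by norm_num)] at h
  rw [← integrableOn_Icc_iff_integrableOn_Ioc] at h
  have h2 := (h.integrable_indicator measurableSet_Icc).integrableOn (s := Set.Ioi 0)
  refine h2.congr_fun (fun y _ => ?_) measurableSet_Ioi
  simp only [finrank_euclideanSpace, Fintype.card_fin, smul_eq_mul, Nat.add_sub_cancel, pow_one, kone]
  by_cases hy : 1 ≤ y ∧ y ≤ 6
  · rw [if_pos hy, Set.indicator_of_mem (show y ∈ Set.Icc 1 6 from hy)]; rfl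
  · rw [if_neg hy, Set.indicator_of_notMem (show y ∉ Set.Icc 1 6 from hy), mul_zero]

lemma part_a {m : ℕ} (hm : 0 < m) {G : V (m+1) → ℝ} (hG : H12 G) {ε : ℝ} (hε : 0 < ε) :
    ∃ lu : ℝ, 1 ≤ lu ∧ ∀ l, lu < l → Integrable (fun w => Gscale G l w * (‖w‖ * min (‖w‖^2) 1)) ∧
      ∫ w, Gscale G l w * (‖w‖ * min (‖w‖^2) 1) < ε := by
  have hInt : ∀ l : ℝ, 0 < l → Integrable (fun w => Gscale G l w * (‖w‖ * min (‖w‖^2) 1)) := by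
    intro l hl
    refine int_G_le hm (Gscale_H12 hG hl) (by fun_prop) (C := 1) ?_
    intro x
    rw [abs_of_nonneg (by positivity)]
    have := min_le_right (‖x‖^2) 1
    nlinarith [norm_nonneg x]
  have heq : ∀ l : ℝ, 0 < l → ∫ w, Gscale G l w * (‖w‖ * min (‖w‖^2) 1) = ∫ z, ‖z‖ * G z * min ((‖z‖ / l)^2) 1 := by
    intro l hl
    have h := Measure.integral_comp_smul (volume : Measure (V (m+1))) (fun z => ‖z‖ * G z * min ((‖z‖ / l)^2) 1) l
    have h2 : ∫ w, Gscale G l w * (‖w‖ * min (‖w‖^2) 1) =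
        l^(m+1) * ∫ x : V (m+1), (fun z => ‖z‖ * G z * min ((‖z‖ / l)^2) 1) (l • x) := by
      rw [← integral_const_mul]
      congr 1; ext x
      unfold Gscale
      simp only [norm_smul, Real.norm_of_nonneg hl.le]
      rw [mul_div_cancel_left₀ _ hl.ne']
      ring
    rw [h2, h]
    simp only [finrank_euclideanSpace, Fintype.card_fin, smul_eq_mul]
    rw [abs_of_pos (by positivity), ← mul_assoc, mul_inv_cancel₀ (by positivity), one_mul]
  have hlim : Tendsto (fun l : ℝ => ∫ z : V (m+1), ‖z‖ * G z * min ((‖z‖ / l)^2) 1) atTop (𝓝 (∫ z : V (m+1), (0:ℝ))) := by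
    refine tendsto_integral_filter_of_dominated_convergence (fun x => ‖x‖ * G x) ?_ ?_ (int_norm hm hG) ?_
    · refine Eventually.of_forall fun l => ?_
      have := hG.measurable
      exact Measurable.aestronglyMeasurable (by fun_prop)
    · refine Eventually.of_forall fun l => Eventually.of_forall fun z => ?_
      have h0 := hG.nonneg z
      rw [Real.norm_of_nonneg (by positivity)]
      have := min_le_right ((‖z‖ / l)^2) 1
      have h3 : 0 ≤ ‖z‖ * G z := by positivity
      nlinarith
    · refine Eventually.of_forall fun z => ?_
      have h1 : Tendsto (fun l : ℝ => ‖z‖ / l) atTop (𝓝 0) := tendsto_const_nhds.div_atTop tendsto_id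
      have h2 := ((h1.pow 2).min (tendsto_const_nhds (x := (1:ℝ)))).const_mul (‖z‖ * G z)
      simpa using h2
  rw [integral_zero] at hlim
  obtain ⟨L, hL⟩ := eventually_atTop.1 (hlim.eventually_lt_const hε)
  refine ⟨max L 1, le_max_right _ _, fun l hl => ?_⟩
  have hl1 : 0 < l := by have := le_max_right L 1; linarith
  refine ⟨hInt l hl1, ?_⟩
  rw [heq l hl1]
  exact hL l ((le_max_left _ _).trans hl.le)

lemma part_b {G : V (1+1) → ℝ} (hG : H12 G) (hG' : H34 G) {ε : ℝ} (hε : 0 < ε) :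
    ∃ lu : ℝ, 1 ≤ lu ∧ ∀ l, lu < l → Integrable (fun w => Gscale G l w * kone ‖w‖) ∧
      ∫ w, Gscale G l w * kone ‖w‖ < ε := by
  set I := ∫ w : V (1+1), kone ‖w‖ with hI
  have hI0 : 0 ≤ I := integral_nonneg fun w => kone_nonneg _
  set δ := ε / (I + 1) / 2 with hδ
  have hδ0 : 0 < δ := by positivity
  have h := (isLittleO_iff.1 (hG'.inftyTwo rfl)) hδ0
  obtain ⟨R, -, hR⟩ := hasBasis_cobounded_norm.eventually_iff.1 h
  refine ⟨max R 1, le_max_right _ _, fun l hl => ?_⟩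
  have hl1 : 1 < l := (le_max_right R 1).trans_lt hl
  have hlR : R < l := (le_max_left R 1).trans_lt hl
  have hb : ∀ w : V (1+1), Gscale G l w * kone ‖w‖ ≤ δ * kone ‖w‖ := by
    intro w
    by_cases hw : 1 ≤ ‖w‖
    · refine mul_le_mul_of_nonneg_right ?_ (kone_nonneg _)
      have hn : ‖l • w‖ = l * ‖w‖ := by rw [norm_smul, Real.norm_of_nonneg (by linarith)]
      have h3 := @hR (l • w) (show R ≤ ‖l • w‖ by rw [hn]; nlinarith)
      rw [Real.norm_of_nonneg (hG.nonneg _), Real.norm_of_nonneg (by positivity), hn,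
        Real.rpow_neg (by positivity)] at h3
      have h4 : (l * ‖w‖)^(3:ℝ) = (l * ‖w‖)^3 := by exact_mod_cast Real.rpow_natCast (l * ‖w‖) 3
      rw [h4] at h3
      unfold Gscale
      calc l^(1+1+1) * G (l • w) ≤ l^(1+1+1) * (δ * ((l * ‖w‖)^3)⁻¹) := by gcongr
        _ = δ * (‖w‖^3)⁻¹ := by
          have : l ≠ 0 := by positivity
          have : ‖w‖ ≠ 0 := by positivity
          field_simp
        _ ≤ δ * 1 := by
          gcongr
          exact inv_le_one_of_one_le₀ (one_le_pow₀ hw)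
        _ = δ := mul_one _
    · have : kone ‖w‖ = 0 := by unfold kone; rw [if_neg (fun h => hw h.1)]
      rw [this, mul_zero, mul_zero]
  have hS := Gscale_H12 hG (show 0 < l by linarith)
  have hInt : Integrable (fun w => Gscale G l w * kone ‖w‖) := by
    refine (kone_integrable.const_mul δ).mono' ?_ (Eventually.of_forall fun w => ?_)
    · exact (hS.measurable.mul (kone_meas.comp measurable_norm)).aestronglyMeasurable
    · rw [Real.norm_of_nonneg (mul_nonneg (hS.nonneg _) (kone_nonneg _))]
      exact hb w
  refine ⟨hInt, ?_⟩
  calc ∫ w, Gscale G l w * kone ‖w‖ ≤ ∫ w : V (1+1), δ * kone ‖w‖ :=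
        integral_mono hInt (kone_integrable.const_mul δ) hb
    _ = δ * I := by rw [integral_const_mul]
    _ < ε := by
      have : δ * (I + 1) = ε / 2 := by rw [hδ]; field_simp
      nlinarith

lemma bet_small {m : ℕ} (hm : 0 < m) {G : V (m+1) → ℝ} (hG : H12 G) (hG' : H34 G) {ε : ℝ} (hε : 0 < ε) :
    ∃ lu : ℝ, 1 ≤ lu ∧ ∀ l, lu < l → Integrable (fun w => Gscale G l w * bet m ‖w‖) ∧
      ∫ w, Gscale G l w * bet m ‖w‖ < ε := by
  obtain ⟨l1, h1, H1⟩ := part_a hm hG (half_pos hε)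
  by_cases hm1 : m = 1
  · subst hm1
    obtain ⟨l2, h2, H2⟩ := part_b hG hG' (half_pos hε)
    refine ⟨max l1 l2, h1.trans (le_max_left _ _), fun l hl => ?_⟩
    obtain ⟨i1, e1⟩ := H1 l ((le_max_left _ _).trans_lt hl)
    obtain ⟨i2, e2⟩ := H2 l ((le_max_right _ _).trans_lt hl)
    have he : (fun w => Gscale G l w * bet 1 ‖w‖) = fun w => Gscale G l w * (‖w‖ * min (‖w‖^2) 1) + Gscale G l w * kone ‖w‖ := by
      ext w; unfold bet kone; simp only [true_and]; ring
    rw [he]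
    refine ⟨i1.add i2, ?_⟩
    rw [integral_add i1 i2]; linarith
  · refine ⟨l1, h1, fun l hl => ?_⟩
    have he : (fun w => Gscale G l w * bet m ‖w‖) = fun w => Gscale G l w * (‖w‖ * min (‖w‖^2) 1) := by
      ext w; unfold bet; simp [hm1]
    rw [he]
    exact ⟨(H1 l hl).1, by linarith [(H1 l hl).2]⟩
end

section
lemma exists_dir {m : ℕ} (hm : 0 < m) : ∃ a : Fin (m+1) → ℝ, ∑ i, a i = 0 ∧ (∀ i, |a i| ≤ 1) ∧ a 0 ≠ 0 := by
  have hne : (0 : Fin (m+1)) ≠ Fin.last m := by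
    intro h
    have := congrArg Fin.val h
    simp at this
    omega
  refine ⟨fun i => (if i = 0 then 1 else 0) - (if i = Fin.last m then 1 else 0), ?_, ?_, ?_⟩
  · simp [Finset.sum_sub_distrib]
  · intro i
    dsimp only
    split_ifs <;> simp
  · simp [hne]

lemma main_aux {m : ℕ} (hm : 0 < m) {G : V (m+1) → ℝ} (hG : H12 G) (hG' : H34 G)
    {γ : ℝ} (hγ : 1 < γ) :
    ∃ lu : ℝ, ∀ l : ℝ, lu < l →
      (∀ (X : V (m+1) → V (m+1)) (Φ : ℝ → V (m+1) → V (m+1)), IsFlowOf X Φ →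
        PreservesVolume Φ (ball (0 : V (m+1)) 1) →
        deriv (fun t => Ffun γ G l (Φ t '' ball (0 : V (m+1)) 1)) 0 = 0) ∧
      (∃ (X : V (m+1) → V (m+1)) (Φ : ℝ → V (m+1) → V (m+1)), IsFlowOf X Φ ∧
        PreservesVolume Φ (ball (0 : V (m+1)) 1) ∧
        deriv (deriv (fun t => Ffun γ G l (Φ t '' ball (0 : V (m+1)) 1))) 0 < 0) ∧
      ¬ IsMinimizer γ G l (ball (0 : V (m+1)) 1) := by
  obtain ⟨a, ha, ha1, ha0⟩ := exists_dir hm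
  have hpos := Mf2_pos ha1 ha0
  set J := ∫ x in ball (0 : V (m+1)) 1, h2 a 0 x with hJ
  have hom := om_pos m
  have hm' : (0:ℝ) < m := by exact_mod_cast hm
  have hγ0 : 0 < γ - 1 := by linarith
  have hγ1 : 0 < γ := by linarith
  set A := γ * om m * (20000 * m) with hA
  have hA0 : 0 < A := by positivity
  obtain ⟨lu, hlu, H⟩ := bet_small hm hG hG' (show 0 < (γ - 1) * (m+2) * J / A by positivity)
  refine ⟨lu, fun l hl => ?_⟩
  have hl0 : 0 < l := by linarith
  have hS := Gscale_H12 hG hl0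
  obtain ⟨hbi, hbe⟩ := H l hl
  have p1 : ∀ (X : V (m+1) → V (m+1)) (Φ : ℝ → V (m+1) → V (m+1)), IsFlowOf X Φ →
        PreservesVolume Φ (ball (0 : V (m+1)) 1) →
        deriv (fun t => Ffun γ G l (Φ t '' ball (0 : V (m+1)) 1)) 0 = 0 := fun X Φ h hv => stationary hS h hv
  obtain ⟨X, Φ, hΦ, hT⟩ := exists_Td_flow ha1
  have hPV : PreservesVolume Φ (ball (0 : V (m+1)) 1) :=
    ⟨1, one_pos, fun t ht => by rw [hT t ht, Td_volume ha]⟩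
  obtain ⟨c, hc⟩ := energy hm (γ := γ) hS ha ha1
  obtain ⟨d, hd, hd2⟩ := Rem_deriv2 hm hS ha1 hbi
  set f := fun t => Ffun γ G l (Φ t '' ball (0 : V (m+1)) 1) with hf
  have hU : ∀ t : ℝ, |t| < 1 → ∀ᶠ s in 𝓝 t, |s| < 1 := fun t ht =>
    continuous_abs.continuousAt.eventually_lt_const ht
  have hfd : ∀ t : ℝ, |t| < 1 → HasDerivAt f ((1 - γ) * (m+2) * (∫ x in ball (0 : V (m+1)) 1, h1 a t x) +
      γ * om m * ∫ w, Gscale G l w * Df a t w) t := by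
    intro t ht
    have h := (((Mf_deriv ha1 ht).const_mul ((1 - γ) * (m+2))).const_add c).add
      ((Rem_deriv hm hS ha1 ht).const_mul (γ * om m))
    refine h.congr_of_eventuallyEq ?_
    filter_upwards [hU t ht] with s hs
    simp only [hf]
    rw [hT s hs, hc s]
    rfl
  have h00 : |(0:ℝ)| < 1 := by simp
  have hfd2 : deriv (deriv f) 0 = (1 - γ) * (m+2) * J + γ * om m * d := by
    have h := ((Mf_deriv2 ha1).const_mul ((1 - γ) * (m+2))).add (hd.const_mul (γ * om m))
    refine (h.congr_of_eventuallyEq ?_).deriv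
    filter_upwards [hU 0 h00] with s hs
    exact (hfd s hs).deriv
  have hneg : deriv (deriv f) 0 < 0 := by
    rw [hfd2]
    rw [lt_div_iff₀ hA0] at hbe
    have e1 : γ * om m * d ≤ γ * om m * (20000 * m * ∫ w, Gscale G l w * bet m ‖w‖) :=
      mul_le_mul_of_nonneg_left ((le_abs_self d).trans hd2) (by positivity)
    have e2 : γ * om m * (20000 * m * ∫ w, Gscale G l w * bet m ‖w‖) = (∫ w, Gscale G l w * bet m ‖w‖) * A := by
      rw [hA]; ring
    nlinarith
  refine ⟨p1, ⟨X, Φ, hΦ, hPV, hneg⟩, ?_⟩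
  intro hmin
  have hmax := isLocalMax_of_deriv_deriv_neg hneg (p1 X Φ hΦ hPV) (hfd 0 h00).continuousAt
  have hconst : f =ᶠ[𝓝 0] fun _ => f 0 := by
    filter_upwards [hmax, hU 0 h00] with s hs1 hs2
    refine le_antisymm hs1 ?_
    simp only [hf]
    rw [hT s hs2, hT 0 h00]
    have hb0 : Td a 0 '' ball (0 : V (m+1)) 1 = ball 0 1 := by
      have : ⇑(Td a 0) = id := by funext x; exact Td_zero a x
      rw [this, Set.image_id]
    rw [hb0]
    refine hmin.2.2 _ ⟨(Td_emb a s).measurableSet_image.2 measurableSet_ball, ?_⟩ (Td_volume ha s _)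
    rw [perimeter_Td ha]
    exact ENNReal.ofReal_lt_top
  have h1 : deriv f =ᶠ[𝓝 0] deriv fun _ => f 0 := hconst.deriv
  have h2 := h1.deriv_eq
  simp at h2
  linarith
end

/-- If `γ > 1`, then for all large `λ` the unit ball is a
volume-constrained stationary set of `F_{γ,G_λ}` which is unstable: some smooth
compactly supported vector field inducing a volume-preserving flow on `B₁` gives a
negative second variation. In particular `B₁` is not a minimizer of (P_{γ,λ}). -/
theorem statement2 (n : ℕ) (hn : 2 ≤ n) (G : V n → ℝ) (hG : H12 G) (hG' : H34 G)
    (γ : ℝ) (hγ : 1 < γ) :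
    ∃ lu : ℝ, ∀ l : ℝ, lu < l →
      (∀ (X : V n → V n) (Φ : ℝ → V n → V n), IsFlowOf X Φ →
        PreservesVolume Φ (ball (0 : V n) 1) →
        deriv (fun t => Ffun γ G l (Φ t '' ball (0 : V n) 1)) 0 = 0) ∧
      (∃ (X : V n → V n) (Φ : ℝ → V n → V n), IsFlowOf X Φ ∧
        PreservesVolume Φ (ball (0 : V n) 1) ∧
        deriv (deriv (fun t => Ffun γ G l (Φ t '' ball (0 : V n) 1))) 0 < 0) ∧
      ¬ IsMinimizer γ G l (ball (0 : V n) 1) := by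
  obtain ⟨m, rfl⟩ : ∃ m, n = m + 1 := ⟨n - 1, by omega⟩
  exact main_aux (by omega) hG hG' hγ
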